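/- Fix θ > 0 and an integer m ≥ 1. Let y_1, …, y_m, y be real numbers with y_1 > y_2 > ⋯ > y_m > y > 0 and y_1 − y_2 > y_3, …, y_{m−2} − y_{m−1} > y_m, y_{m−1} − y_m > y. Let {a(N) ∈ 𝒫_N}_{N≥1} be a regular sequence of ordered tuples such that ∑_{i=1}^N a(N)_i = 0 for every N. Then lim_{N→∞} [ 𝓑_{a(N)}( −y_1/√N, …, −y_m/√N; N; θ ) · 𝓑_{a(N)}( −y/√N; N; θ ) − 𝓑_{a(N)}( −y_1/√N, …, −y_m/√N, −y/√N; N; θ ) ] = 0. -/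

import Mathlib

open MeasureTheory Filter Topology
open scoped ENNReal

noncomputable section

/-- A triangular array with `M` levels: for `k : Fin M`, level `k+1` has `k+1` real entries. -/
abbrev Tri (M : ℕ) := ∀ k : Fin M, Fin (k.1 + 1) → ℝ

/-- `Interlaces u v` means `u ≺ v`, i.e. `v 1 > u 1 > v 2 > u 2 > ⋯ > v n > u n > v (n+1)`. -/
def Interlaces {n : ℕ} (u : Fin n → ℝ) (v : Fin (n + 1) → ℝ) : Prop :=
  ∀ i : Fin n, u i < v i.castSucc ∧ v i.succ < u i

/-- Level `k+1` (for `k < N`) of the configuration consisting of the triangular array `x`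
(levels `1, …, N-1`) together with the top level `a` (level `N`). -/
def lvl {N : ℕ} (a : Fin N → ℝ) (x : Tri (N - 1)) (k : ℕ) (hk : k < N) :
    Fin (k + 1) → ℝ :=
  if h : k < N - 1 then fun i => x ⟨k, h⟩ i
  else fun i => a ⟨i.1, by have := i.isLt; omega⟩

/-- The (unnormalized) density of the orbital beta process with top level `a`. -/
def obpWt (θ : ℝ) {N : ℕ} (a : Fin N → ℝ) (x : Tri (N - 1)) : ℝ :=
  ∏ k : Fin (N - 1),
    ((∏ i : Fin (k.1 + 1), ∏ j : Fin (k.1 + 1),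
        if i < j then |x k i - x k j| ^ (2 - 2 * θ) else 1) *
      ∏ s : Fin (k.1 + 2), ∏ r : Fin (k.1 + 1),
        |lvl a x (k.1 + 1) (by have := k.isLt; omega) s - x k r| ^ (θ - 1))

/-- The interlacing scheme `𝒫(a)`: arrays `(a⁽¹⁾ ≺ a⁽²⁾ ≺ ⋯ ≺ a⁽ᴺ⁻¹⁾ ≺ a)`. -/
def obpDomain {N : ℕ} (a : Fin N → ℝ) : Set (Tri (N - 1)) :=
  {x | ∀ k : Fin (N - 1),
      Interlaces (x k) (lvl a x (k.1 + 1) (by have := k.isLt; omega))}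

/-- The orbital beta process `𝕄^{a,θ}` with top level `a`. -/
def obp (θ : ℝ) {N : ℕ} (a : Fin N → ℝ) : Measure (Tri (N - 1)) :=
  (ENNReal.ofReal (∫ x in obpDomain a, obpWt θ a x))⁻¹ •
    volume.withDensity fun x =>
      ENNReal.ofReal ((obpDomain a).indicator (obpWt θ a) x)

/-- The Weyl chamber `𝒲_m = {x : x 0 ≥ x 1 ≥ ⋯}`. -/
def weylChamber (m : ℕ) : Set (Fin m → ℝ) :=
  {x | ∀ i j : Fin m, i ≤ j → x j ≤ x i}

/-- The (unnormalized) density of the Gaussian beta ensemble. -/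
def gbeWt (θ : ℝ) (m : ℕ) (x : Fin m → ℝ) : ℝ :=
  (∏ i : Fin m, ∏ j : Fin m, if i < j then |x i - x j| ^ (2 * θ) else 1) *
    Real.exp (-(θ / 2) * ∑ i, x i ^ 2)

/-- The Gaussian beta ensemble `𝕄^{(θ)}_m` of rank `m`. -/
def gbe (θ : ℝ) (m : ℕ) : Measure (Fin m → ℝ) :=
  (ENNReal.ofReal (∫ x in weylChamber m, gbeWt θ m x))⁻¹ •
    volume.withDensity fun x =>
      ENNReal.ofReal ((weylChamber m).indicator (gbeWt θ m) x)

/-- The empirical measure `μ_N = (1/N) ∑ δ_{a_i/N}`. -/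
def empMeasure {N : ℕ} (a : Fin N → ℝ) : Measure ℝ :=
  ((N : ℝ≥0∞))⁻¹ • ∑ i : Fin N, Measure.dirac (a i / N)

/-- The mean `𝔼[ν]` of a measure on `ℝ`. -/
def meanM (ν : Measure ℝ) : ℝ := ∫ t, t ∂ν

/-- The variance `Var[ν]` of a measure on `ℝ`. -/
def varM (ν : Measure ℝ) : ℝ := (∫ t, t ^ 2 ∂ν) - meanM ν ^ 2

/-- A regular sequence of ordered tuples with limiting measure `μ`. -/
def RegularSeq (a : (N : ℕ) → Fin N → ℝ) (μ : Measure ℝ) : Prop :=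
  (∀ N : ℕ, 1 ≤ N → StrictAnti (a N)) ∧
  (∃ C : ℝ, ∀ N : ℕ, ∀ hN : 1 ≤ N,
      |a N ⟨0, by omega⟩| ≤ C * N ∧ |a N ⟨N - 1, by omega⟩| ≤ C * N) ∧
  IsProbabilityMeasure μ ∧
  (∃ R : ℝ, μ {t : ℝ | |t| ≤ R}ᶜ = 0) ∧
  ∀ f : BoundedContinuousFunction ℝ ℝ,
    Tendsto (fun N : ℕ => ∫ t, f t ∂empMeasure (a N)) atTop (𝓝 (∫ t, f t ∂μ))

/-- Projection of a triangular array (with top level of size `N`) to its `m`-th level. -/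
def levelProj {N : ℕ} (m : ℕ) (h1 : 1 ≤ m) (h2 : m < N) (x : Tri (N - 1)) :
    Fin m → ℝ :=
  fun i => x ⟨m - 1, by omega⟩ ⟨i.1, (by have := i.isLt; omega : i.1 < m - 1 + 1)⟩

/-- Projection of a triangular array to its bottom `m` levels. -/
def triProj {N : ℕ} (m : ℕ) (h : m < N) (x : Tri (N - 1)) : Tri m :=
  fun k i => x ⟨k.1, by have := k.isLt; omega⟩ ⟨i.1, i.isLt⟩

/-- The top level of a triangular array with `m` levels. -/
def topLvl {m : ℕ} (hm : 1 ≤ m) (x : Tri m) : Fin m → ℝ :=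
  fun i => x ⟨m - 1, by omega⟩ ⟨i.1, (by have := i.isLt; omega : i.1 < m - 1 + 1)⟩

/-- The Gelfand–Tsetlin polytope `𝒲_{m,corners}` (weak interlacing). -/
def gtPoly (m : ℕ) : Set (Tri m) :=
  {x | ∀ k : Fin m, ∀ hk : k.1 + 1 < m, ∀ i : Fin (k.1 + 1),
      x k i ≤ x ⟨k.1 + 1, hk⟩ i.castSucc ∧ x ⟨k.1 + 1, hk⟩ i.succ ≤ x k i}

/-- Unnormalized density of the Gaussian beta corners process with `m` levels. -/
def gbcWt (θ : ℝ) {m : ℕ} (hm : 1 ≤ m) (x : Tri m) : ℝ :=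
  (∏ i : Fin m, ∏ j : Fin m,
      if i < j then topLvl hm x i - topLvl hm x j else 1) *
    Real.exp (-(θ / 2) * ∑ i, topLvl hm x i ^ 2) *
    ∏ k : Fin (m - 1),
      ((∏ i : Fin (k.1 + 1), ∏ j : Fin (k.1 + 1),
          if i < j then
            |x ⟨k.1, by have := k.isLt; omega⟩ i -
              x ⟨k.1, by have := k.isLt; omega⟩ j| ^ (2 - 2 * θ)
          else 1) *
        ∏ i : Fin (k.1 + 1), ∏ j : Fin (k.1 + 2),
          |x ⟨k.1, by have := k.isLt; omega⟩ i -
            x ⟨k.1 + 1, by have := k.isLt; omega⟩ j| ^ (θ - 1))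

/-- The Gaussian beta corners process `𝕄^{(θ)}_{m,corners}`. -/
def gbc (θ : ℝ) {m : ℕ} (hm : 1 ≤ m) : Measure (Tri m) :=
  (ENNReal.ofReal (∫ x in gtPoly m, gbcWt θ hm x))⁻¹ •
    volume.withDensity fun x =>
      ENNReal.ofReal ((gtPoly m).indicator (gbcWt θ hm) x)

/-- Strict interlacing domain `x⁽¹⁾ ≺ x⁽²⁾ ≺ ⋯ ≺ x⁽ᵐ⁾` inside `Tri m`. -/
def triDomain (m : ℕ) : Set (Tri m) :=
  {x | ∀ k : Fin m, ∀ hk : k.1 + 1 < m, Interlaces (x k) (x ⟨k.1 + 1, hk⟩)}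

/-- The θ-Gibbs conditional density of the bottom `n` levels given level `n+1`. -/
def gibbsWt (θ : ℝ) (n : ℕ) (x : Tri (n + 1)) : ℝ :=
  ((∏ k : Fin (n + 1), Real.Gamma ((k.1 + 1) * θ)) /
      Real.Gamma θ ^ ((n + 1) * (n + 2) / 2)) *
    (∏ i : Fin (n + 1), ∏ j : Fin (n + 1),
      if i < j then
        (x ⟨n, Nat.lt_succ_self n⟩ i - x ⟨n, Nat.lt_succ_self n⟩ j) ^ (1 - 2 * θ)
      else 1) *
    ∏ k : Fin n,
      ((∏ i : Fin (k.1 + 1), ∏ j : Fin (k.1 + 1),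
          if i < j then
            (x ⟨k.1, by have := k.isLt; omega⟩ i -
              x ⟨k.1, by have := k.isLt; omega⟩ j) ^ (2 - 2 * θ)
          else 1) *
        ∏ i : Fin (k.1 + 1), ∏ j : Fin (k.1 + 2),
          |x ⟨k.1, by have := k.isLt; omega⟩ i -
            x ⟨k.1 + 1, by have := k.isLt; omega⟩ j| ^ (θ - 1))

/-- `|a⁽ᵏ⁾|`, the sum of the entries of level `k` (with `a⁽⁰⁾ := 0` and `a⁽ᴺ⁾ := a`). -/
def sumLvl {N : ℕ} (a : Fin N → ℝ) (x : Tri (N - 1)) (k : ℕ) : ℝ :=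
  if k = 0 then 0
  else if h : k - 1 < N - 1 then ∑ i, x ⟨k - 1, h⟩ i
  else ∑ i, a i

/-- The multivariate Bessel function `𝓑_a(y; θ)`, defined through its combinatorial
integral representation over the interlacing scheme with top level `a`. -/
def MBF (θ : ℝ) {N : ℕ} (a : Fin N → ℝ) (y : Fin N → ℂ) : ℂ :=
  ((((∏ k : Fin N, Real.Gamma ((k.1 + 1) * θ)) /
        Real.Gamma θ ^ (N * (N + 1) / 2)) : ℝ) : ℂ) *
    (((∏ i : Fin N, ∏ j : Fin N,
        if i < j then |a i - a j| ^ (1 - 2 * θ) else 1) : ℝ) : ℂ) *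
    ∫ x in obpDomain a,
      Complex.exp (∑ k : Fin N,
        y k * ((sumLvl a x (k.1 + 1) - sumLvl a x k.1 : ℝ) : ℂ)) *
      ((obpWt θ a x : ℝ) : ℂ)

/-- Padding of an `m`-tuple with `N - m` zeros: `(y_1, …, y_m, 0^{N-m})`. -/
def padC {m N : ℕ} (_h : m ≤ N) (y : Fin m → ℂ) : Fin N → ℂ :=
  fun k => if h' : k.1 < m then y ⟨k.1, h'⟩ else 0

/-- Integrand `exp(yz) ∏ (z - a_i)^{-θ}` of the left-directed contour integral,
with `w^{-θ} := exp(-θ Log w)` for the principal branch `Log`. -/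
def contourFnL (θ : ℝ) {N : ℕ} (a : Fin N → ℝ) (y z : ℂ) : ℂ :=
  Complex.exp (y * z) *
    ∏ i : Fin N, Complex.exp (-(θ : ℂ) * Complex.log (z - (a i : ℂ)))

/-- Integrand `exp(-yz) ∏ (a_i - z)^{-θ}` of the right-directed contour integral. -/
def contourFnR (θ : ℝ) {N : ℕ} (a : Fin N → ℝ) (y z : ℂ) : ℂ :=
  Complex.exp (-y * z) *
    ∏ i : Fin N, Complex.exp (-(θ : ℂ) * Complex.log ((a i : ℂ) - z))

/-- `(y_1, …, y_m, y_{m+1})` with `y_{m+1} := y - (z_1 + ⋯ + z_m)`. -/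
def Yext {m : ℕ} (ys : Fin m → ℝ) (y : ℝ) (z : Fin m → ℝ) : Fin (m + 1) → ℝ :=
  fun j => if h : j.1 < m then ys ⟨j.1, h⟩ else y - ∑ i, z i

/-- `(z_1, …, z_m, z_{m+1})` with `z_{m+1} := 0`. -/
def Zext {m : ℕ} (z : Fin m → ℝ) : Fin (m + 1) → ℝ :=
  fun j => if h : j.1 < m then z ⟨j.1, h⟩ else 0

/-- The function `G_{θ, y_1, …, y_m, y}(z_1, …, z_m)`. -/
def Gfn (θ : ℝ) {m : ℕ} (ys : Fin m → ℝ) (y : ℝ) (z : Fin m → ℝ) : ℝ :=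
  (∏ i : Fin m, ∏ j : Fin m,
      if i < j then (ys i - ys j + z i) ^ (θ - 1) else 1) *
    ∏ i : Fin (m + 1), ∏ j : Fin (m + 1),
      if i < j then
        (Yext ys y z i - Yext ys y z j + Zext z i - Zext z j) *
          (Yext ys y z i - Yext ys y z j - Zext z j) ^ (θ - 1)
      else 1

/-- The function `F_{y_1, …, y_m, y}(z_1, …, z_m)`. -/
def Ffn {m : ℕ} (ys : Fin m → ℝ) (y : ℝ) (z : Fin m → ℝ) : ℝ :=
  (1 - (∑ i, z i) / y) * ∏ i, (1 + z i / ys i)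

/-- Tonelli's theorem for a product of functions of the separate coordinates. -/
theorem lintegral_pi_prod {n : ℕ} (f : Fin n → ℝ → ℝ≥0∞) (hf : ∀ i, Measurable (f i)) :
    ∫⁻ x : Fin n → ℝ, ∏ i, f i (x i) = ∏ i, ∫⁻ t, f i t := by
  induction n with
  | zero => simp [volume_pi]
  | succ n ih =>
    have hm := (volume_preserving_piFinSuccAbove (fun _ : Fin (n + 1) => ℝ) 0).symm
    rw [← hm.lintegral_comp_emb (MeasurableEquiv.measurableEmbedding _), Fin.prod_univ_succ,
      ← ih _ fun i => hf i.succ, Measure.volume_eq_prod,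
      ← lintegral_prod_mul (hf 0).aemeasurable (Finset.measurable_prod _ fun i _ =>
        (hf i.succ).comp (measurable_pi_apply i)).aemeasurable]
    refine lintegral_congr fun p => ?_
    simp [Fin.prod_univ_succ, MeasurableEquiv.piFinSuccAbove_symm_apply, Fin.insertNthEquiv]

/-- The absolute value of the Vandermonde product of a tuple. -/
def vdm {n : ℕ} (a : Fin n → ℝ) : ℝ := ∏ i, ∏ j, if i < j then |a i - a j| else 1

/-- The product of the distances between the entries of two tuples. -/
def crossProd {n k : ℕ} (a : Fin n → ℝ) (b : Fin k → ℝ) : ℝ := ∏ s, ∏ r, |a s - b r|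

theorem vdm_nonneg {n : ℕ} (a : Fin n → ℝ) : 0 ≤ vdm a :=
  Finset.prod_nonneg fun i _ => Finset.prod_nonneg fun j _ => by split_ifs <;> positivity

theorem vdm_pos {n : ℕ} {a : Fin n → ℝ} (ha : Function.Injective a) : 0 < vdm a := by
  refine Finset.prod_pos fun i _ => Finset.prod_pos fun j _ => ?_
  split_ifs with h
  · exact abs_pos.2 (sub_ne_zero.2 (ha.ne h.ne))
  · exact one_pos

theorem crossProd_nonneg {n k : ℕ} (a : Fin n → ℝ) (b : Fin k → ℝ) : 0 ≤ crossProd a b :=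
  Finset.prod_nonneg fun _ _ => Finset.prod_nonneg fun _ _ => abs_nonneg _

theorem prod_rpow_eq_vdm_rpow {n : ℕ} (a : Fin n → ℝ) (p : ℝ) :
    (∏ i, ∏ j, if i < j then |a i - a j| ^ p else 1) = vdm a ^ p := by
  unfold vdm
  rw [← Real.finsetProd_rpow _ _ fun i _ =>
    Finset.prod_nonneg fun j _ => by split_ifs <;> positivity]
  refine Finset.prod_congr rfl fun i _ => ?_
  rw [← Real.finsetProd_rpow _ _ fun j _ => by split_ifs <;> positivity]
  refine Finset.prod_congr rfl fun j _ => ?_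
  split_ifs <;> simp

theorem prod_rpow_eq_crossProd_rpow {n k : ℕ} (a : Fin n → ℝ) (b : Fin k → ℝ) (p : ℝ) :
    (∏ s, ∏ r, |a s - b r| ^ p) = crossProd a b ^ p := by
  unfold crossProd
  rw [← Real.finsetProd_rpow _ _ fun i _ => Finset.prod_nonneg fun j _ => abs_nonneg _]
  refine Finset.prod_congr rfl fun i _ => ?_
  rw [← Real.finsetProd_rpow _ _ fun j _ => abs_nonneg _]

@[fun_prop]
theorem continuous_vdm {n : ℕ} : Continuous (vdm (n := n)) := by
  unfold vdm
  refine continuous_finsetProd _ fun i _ => continuous_finsetProd _ fun j _ => ?_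
  split_ifs <;> fun_prop

theorem abs_det_vandermonde {n : ℕ} (a : Fin n → ℝ) : |(Matrix.vandermonde a).det| = vdm a := by
  rw [Matrix.det_vandermonde, vdm, Finset.abs_prod]
  refine Finset.prod_congr rfl fun i _ => ?_
  rw [Finset.abs_prod, ← Finset.prod_filter]
  refine Finset.prod_congr (by ext; simp) fun j _ => abs_sub_comm _ _

/-- `bandPow d x` is `√x ^ d` for positive `x`, and `0` otherwise. -/
def bandPow (d : ℕ) (x : ℝ) : ℝ≥0∞ := if 0 < x then ENNReal.ofReal (√x ^ d) else 0

theorem measurable_bandPow (d : ℕ) : Measurable (bandPow d) :=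
  Measurable.ite measurableSet_Ioi (by fun_prop) measurable_const

/-- A monic polynomial of degree `2n` which is nonnegative at the ends of `n` disjoint intervals
and negative somewhere inside each of them has two roots in each interval. -/
theorem exists_roots_of_neg {n : ℕ} {E : Polynomial ℝ} (hM : E.Monic)
    (hd : E.natDegree = 2 * n) {l u x : Fin n → ℝ}
    (hdisj : ∀ i j, i < j → u j < l i) (hl : ∀ i, 0 ≤ E.eval (l i)) (hu : ∀ i, 0 ≤ E.eval (u i))
    (hx : ∀ i, x i ∈ Set.Ioo (l i) (u i)) (hneg : ∀ i, E.eval (x i) < 0) :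
    ∃ p q : Fin n → ℝ, (∀ i, l i ≤ p i) ∧ (∀ i, p i < q i) ∧ (∀ i, q i ≤ u i) ∧
      E = ∏ i, ((Polynomial.X - Polynomial.C (p i)) * (Polynomial.X - Polynomial.C (q i))) := by
  have h1 : ∀ i, ∃ p, l i ≤ p ∧ p < x i ∧ E.eval p = 0 := fun i => by
    obtain ⟨p, hp, hp0⟩ := intermediate_value_Icc' (hx i).1.le
      (E.continuous.continuousOn (s := Set.Icc (l i) (x i))) ⟨(hneg i).le, hl i⟩
    refine ⟨p, hp.1, lt_of_le_of_ne hp.2 ?_, hp0⟩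
    rintro rfl
    exact (hneg i).ne hp0
  have h2 : ∀ i, ∃ q, x i < q ∧ q ≤ u i ∧ E.eval q = 0 := fun i => by
    obtain ⟨q, hq, hq0⟩ := intermediate_value_Icc (hx i).2.le
      (E.continuous.continuousOn (s := Set.Icc (x i) (u i))) ⟨(hneg i).le, hu i⟩
    refine ⟨q, lt_of_le_of_ne hq.1 ?_, hq.2, hq0⟩
    intro h
    rw [← h] at hq0
    exact (hneg i).ne hq0
  choose p hlp hpx hp0 using h1
  choose q hxq hqu hq0 using h2
  refine ⟨p, q, hlp, fun i => (hpx i).trans (hxq i), hqu, ?_⟩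
  set Q : Polynomial ℝ :=
    ∏ i, ((Polynomial.X - Polynomial.C (p i)) * (Polynomial.X - Polynomial.C (q i))) with hQ
  have hQM : Q.Monic := Polynomial.monic_prod_of_monic _ _ fun i _ =>
    (Polynomial.monic_X_sub_C _).mul (Polynomial.monic_X_sub_C _)
  have hQd : Q.natDegree = 2 * n := by
    rw [hQ, Polynomial.natDegree_prod_of_monic _ _ fun i _ =>
      (Polynomial.monic_X_sub_C _).mul (Polynomial.monic_X_sub_C _)]
    simp [Polynomial.natDegree_mul, Polynomial.X_sub_C_ne_zero, mul_comm]
  let v : Fin n ⊕ Fin n → ℝ := Sum.elim p q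
  have hdl : ∀ i j, i ≠ j → u j < l i ∨ u i < l j := fun i j hij =>
    (lt_or_gt_of_ne hij).imp (hdisj i j) (hdisj j i)
  have hv : Function.Injective v := by
    rintro (i | i) (j | j) h <;> simp only [v, Sum.elim_inl, Sum.elim_inr] at h <;>
      rcases eq_or_ne i j with hij | hij
    all_goals
      have := hlp i; have := hpx i; have := hxq i; have := hqu i
      have := hlp j; have := hpx j; have := hxq j; have := hqu j
    all_goals first
      | exact congrArg _ hij
      | (subst hij; linarith)
      | (rcases hdl _ _ hij with h' | h' <;> linarith)
  refine Polynomial.eq_of_degree_sub_lt_of_eval_index_eq Finset.univ (v := v) hv.injOn ?_ ?_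
  · have hE0 : E ≠ 0 := hM.ne_zero
    have : (E - Q).degree < E.degree := Polynomial.degree_sub_lt_left
      (by rw [Polynomial.degree_eq_natDegree hE0, Polynomial.degree_eq_natDegree hQM.ne_zero, hd,
        hQd]) hE0 (by rw [hM.leadingCoeff, hQM.leadingCoeff])
    rw [Polynomial.degree_eq_natDegree hE0, hd] at this
    simpa [two_mul] using this
  · rintro (i | i) -
    · simp only [v, Sum.elim_inl, hp0]
      rw [hQ, Polynomial.eval_prod, eq_comm]
      exact Finset.prod_eq_zero (Finset.mem_univ i) (by simp)
    · simp only [v, Sum.elim_inr, hq0]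
      rw [hQ, Polynomial.eval_prod, eq_comm]
      exact Finset.prod_eq_zero (Finset.mem_univ i) (by simp)

/-- On the `i`-th of `n` disjoint intervals, `∏ (X - p j) (X - q j)` is negative exactly between
`p i` and `q i`. -/
theorem eval_prod_neg_iff {n : ℕ} {l u p q : Fin n → ℝ} (hdisj : ∀ i j, i < j → u j < l i)
    (hlp : ∀ i, l i ≤ p i) (hpq : ∀ i, p i < q i) (hqu : ∀ i, q i ≤ u i) {i : Fin n} {x : ℝ}
    (hx : x ∈ Set.Ioo (l i) (u i)) :
    (∏ j, ((Polynomial.X - Polynomial.C (p j)) * (Polynomial.X - Polynomial.C (q j))) :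
      Polynomial ℝ).eval x < 0 ↔ x ∈ Set.Ioo (p i) (q i) := by
  rw [Polynomial.eval_prod, ← Finset.mul_prod_erase _ _ (Finset.mem_univ i)]
  simp only [Polynomial.eval_mul, Polynomial.eval_sub, Polynomial.eval_X, Polynomial.eval_C]
  have hpos : 0 < ∏ j ∈ Finset.univ.erase i, (x - p j) * (x - q j) := by
    refine Finset.prod_pos fun j hj => ?_
    have hji := Finset.ne_of_mem_erase hj
    have := hlp j; have := hpq j; have := hqu j
    rcases lt_or_gt_of_ne hji with h | h
    · have := hdisj _ _ h
      exact mul_pos_of_neg_of_neg (by linarith [hx.2]) (by linarith [hx.2])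
    · have := hdisj _ _ h
      exact mul_pos (by linarith [hx.1]) (by linarith [hx.1])
  have := hpq i
  constructor
  · intro h
    replace h : (x - p i) * (x - q i) < 0 := by
      by_contra! h'
      exact absurd h (not_lt.2 (mul_nonneg h' hpos.le))
    constructor
    · by_contra! h'
      nlinarith
    · by_contra! h'
      nlinarith
  · rintro ⟨h, h'⟩
    exact mul_neg_of_neg_of_pos (mul_neg_of_pos_of_neg (by linarith) (by linarith)) hpos

/-- The weight `(∏ √(-E (b i)) / vdm b) ^ d`, restricted to the region where `E` is negative at all
entries of `b`. -/
def bandWt {n : ℕ} (E : Polynomial ℝ) (d : ℕ) (b : Fin n → ℝ) : ℝ≥0∞ :=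
  ENNReal.ofReal ((vdm b)⁻¹ ^ d) * ∏ i, bandPow d (-E.eval (b i))

/-- The product of the open intervals `(l i, u i)`. -/
def openBox {n : ℕ} (l u : Fin n → ℝ) : Set (Fin n → ℝ) :=
  Set.univ.pi fun i => Set.Ioo (l i) (u i)

theorem measurableSet_openBox {n : ℕ} (l u : Fin n → ℝ) : MeasurableSet (openBox l u) :=
  MeasurableSet.univ_pi fun _ => measurableSet_Ioo

theorem injective_of_mem_openBox {n : ℕ} {l u b : Fin n → ℝ} (hdisj : ∀ i j, i < j → u j < l i)
    (hb : b ∈ openBox l u) : Function.Injective b := by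
  intro i j hij
  by_contra hne
  have hi := hb i trivial
  have hj := hb j trivial
  rcases lt_or_gt_of_ne hne with h | h
  · have := hdisj _ _ h
    linarith [hi.1, hj.2]
  · have := hdisj _ _ h
    linarith [hj.1, hi.2]

/-- The sum of the entries is symmetrically distributed under the uniform measure on the region
where `E` is negative. -/
theorem bandWt_zero_symm {n : ℕ} {E : Polynomial ℝ} (hM : E.Monic)
    (hd : E.natDegree = 2 * n) {σ : ℝ} (hσ : E.nextCoeff = -σ) {l u : Fin n → ℝ}
    (hdisj : ∀ i j, i < j → u j < l i) (hl : ∀ i, 0 ≤ E.eval (l i)) (hu : ∀ i, 0 ≤ E.eval (u i))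
    (g : ℝ → ℝ≥0∞) :
    ∫⁻ b in openBox l u, g (∑ i, b i) * bandWt E 0 b =
      ∫⁻ b in openBox l u, g (σ - ∑ i, b i) * bandWt E 0 b := by
  by_cases hex : ∃ x ∈ openBox l u, ∀ i, E.eval (x i) < 0
  · obtain ⟨x, hx, hneg⟩ := hex
    obtain ⟨p, q, hlp, hpq, hqu, hE⟩ :=
      exists_roots_of_neg hM hd hdisj hl hu (fun i => hx i trivial) hneg
    have hw : ∀ b ∈ openBox l u,
        bandWt E 0 b = (openBox p q).indicator 1 b := fun b hb => by
      have : ∀ i, (bandPow 0 (-E.eval (b i))) = if b i ∈ Set.Ioo (p i) (q i) then 1 else 0 := by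
        intro i
        have := eval_prod_neg_iff hdisj hlp hpq hqu (hb i trivial)
        rw [← hE] at this
        simp only [bandPow, neg_pos, this, pow_zero, ENNReal.ofReal_one]
      have hmem : b ∈ openBox p q ↔ ∀ i, b i ∈ Set.Ioo (p i) (q i) := Set.mem_univ_pi
      simp only [bandWt, this, pow_zero, ENNReal.ofReal_one, one_mul, Finset.prod_ite_zero,
        Finset.prod_const_one, Finset.mem_univ, true_imp_iff]
      by_cases hb' : b ∈ openBox p q
      · rw [Set.indicator_of_mem hb', if_pos (hmem.1 hb'), Pi.one_apply]
      · rw [Set.indicator_of_notMem hb', if_neg (mt hmem.2 hb')]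
    have hsub : openBox p q ⊆ openBox l u := Set.pi_mono fun i _ =>
      Set.Ioo_subset_Ioo (hlp i) (hqu i)
    have hred : ∀ f : (Fin n → ℝ) → ℝ≥0∞, ∫⁻ b in openBox l u, f b * bandWt E 0 b =
        ∫⁻ b, (openBox p q).indicator f b := fun f => by
      rw [← lintegral_indicator (measurableSet_openBox l u)]
      refine lintegral_congr fun b => ?_
      by_cases hb : b ∈ openBox l u
      · rw [Set.indicator_of_mem hb, hw b hb]
        by_cases hb' : b ∈ openBox p q <;> simp [hb']
      · rw [Set.indicator_of_notMem hb, Set.indicator_of_notMem fun h => hb (hsub h)]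
    have hsum : ∑ i, (p i + q i) = σ := by
      have h1 : E.nextCoeff = -∑ i, (p i + q i) := by
        rw [hE, Polynomial.Monic.nextCoeff_prod _ _ fun i _ =>
          (Polynomial.monic_X_sub_C _).mul (Polynomial.monic_X_sub_C _), ← Finset.sum_neg_distrib]
        refine Finset.sum_congr rfl fun i _ => ?_
        rw [(Polynomial.monic_X_sub_C _).nextCoeff_mul (Polynomial.monic_X_sub_C _),
          Polynomial.nextCoeff_X_sub_C, Polynomial.nextCoeff_X_sub_C]
        ring
      linarith
    rw [hred fun b => g (∑ i, b i), hred fun b => g (σ - ∑ i, b i),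
      ← lintegral_sub_left_eq_self _ (p + q)]
    refine lintegral_congr fun b => ?_
    have hmem : p + q - b ∈ openBox p q ↔ b ∈ openBox p q := by
      simp only [openBox, Set.mem_univ_pi, Set.mem_Ioo, Pi.sub_apply, Pi.add_apply]
      refine forall_congr' fun i => ?_
      constructor <;> rintro ⟨h, h'⟩ <;> constructor <;> linarith
    by_cases hb : b ∈ openBox p q
    · rw [Set.indicator_of_mem (hmem.2 hb), Set.indicator_of_mem hb]
      simp [Finset.sum_sub_distrib, hsum]
    · rw [Set.indicator_of_notMem (mt hmem.1 hb), Set.indicator_of_notMem hb]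
  · push Not at hex
    have hw : ∀ b ∈ openBox l u, bandWt E 0 b = 0 := fun b hb => by
      obtain ⟨i, hi⟩ := hex b hb
      rw [bandWt, Finset.prod_eq_zero (Finset.mem_univ i), mul_zero]
      simp [bandPow, hi]
    have hz : ∀ f : (Fin n → ℝ) → ℝ≥0∞, ∫⁻ b in openBox l u, f b * bandWt E 0 b = 0 := fun f => by
      rw [setLIntegral_congr_fun (measurableSet_openBox l u) (g := 0) fun b hb => by simp [hw b hb]]
      simp
    rw [hz, hz]

theorem lintegral_scale_real {c : ℝ} (hc : 0 < c) (f : ℝ → ℝ≥0∞) :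
    ∫⁻ x, f x = ENNReal.ofReal c * ∫⁻ x, f (c * x) := by
  have h := Real.smul_map_volume_mul_left hc.ne'
  have h2 : ∫⁻ x, f x ∂Measure.map (fun x => c * x) volume = ∫⁻ x, f (c * x) :=
    (Homeomorph.mulLeft₀ c hc.ne').measurableEmbedding.lintegral_map f
  conv_lhs => rw [← h]
  rw [lintegral_smul_measure, abs_of_pos hc, smul_eq_mul]
  exact congrArg _ h2

/-- The normalising constant in `lintegral_bandPow_sub_sq`. -/
def bandConst (d : ℕ) : ℝ≥0∞ := ∫⁻ w : ℝ, bandPow d (1 - w ^ 2)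

theorem lintegral_bandPow_sub_sq (d : ℕ) (ρ : ℝ) :
    ∫⁻ w : ℝ, bandPow d (ρ - w ^ 2) = bandConst d * bandPow (d + 1) ρ := by
  rcases le_or_gt ρ 0 with hρ | hρ
  · have h0 : ∀ w : ℝ, bandPow d (ρ - w ^ 2) = 0 := fun w =>
      if_neg (by nlinarith [sq_nonneg w])
    simp only [h0, lintegral_zero]
    rw [bandPow, if_neg hρ.not_gt, mul_zero]
  · have hr : 0 < √ρ := Real.sqrt_pos.2 hρ
    have hsc : ∀ w : ℝ, bandPow d (ρ - (√ρ * w) ^ 2) =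
        ENNReal.ofReal (√ρ ^ d) * bandPow d (1 - w ^ 2) := fun w => by
      have h1 : ρ - (√ρ * w) ^ 2 = ρ * (1 - w ^ 2) := by
        rw [mul_pow, Real.sq_sqrt hρ.le]; ring
      rw [h1, bandPow, bandPow]
      simp only [mul_pos_iff_of_pos_left hρ]
      split_ifs
      · rw [Real.sqrt_mul hρ.le, mul_pow, ENNReal.ofReal_mul (by positivity)]
      · simp
    rw [lintegral_scale_real hr]
    simp_rw [hsc]
    rw [lintegral_const_mul' _ _ ENNReal.ofReal_ne_top, bandConst, bandPow, if_pos hρ,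
      ← mul_assoc, ← ENNReal.ofReal_mul hr.le, mul_comm, pow_succ']

theorem bandConst_ne_zero (d : ℕ) : bandConst d ≠ 0 := by
  have hm : Measurable fun w : ℝ => bandPow d (1 - w ^ 2) :=
    (measurable_bandPow d).comp (by fun_prop)
  rw [bandConst, Ne, lintegral_eq_zero_iff hm]
  intro h
  have h1 : volume (Set.Ioo (-1 : ℝ) 1) = 0 := by
    refine measure_mono_null (fun w hw => ?_) h
    have hw1 : 0 < 1 - w ^ 2 := by nlinarith [hw.1, hw.2]
    simp only [Set.mem_compl_iff, Set.mem_ofPred_eq, bandPow, if_pos hw1, Pi.zero_apply,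
      ENNReal.ofReal_eq_zero, not_le]
    positivity
  norm_num at h1

theorem bandConst_ne_top (d : ℕ) : bandConst d ≠ ⊤ := by
  refine ne_top_of_le_ne_top (b := ∫⁻ w in Set.Ioo (-1 : ℝ) 1, 1) (by simp) ?_
  rw [← lintegral_indicator measurableSet_Ioo]
  refine lintegral_mono fun w => ?_
  simp only [bandPow]
  split_ifs with h
  · have hw : w ∈ Set.Ioo (-1 : ℝ) 1 := by constructor <;> nlinarith
    rw [Set.indicator_of_mem hw]
    refine ENNReal.ofReal_le_one.2 (pow_le_one₀ (by positivity) ?_)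
    exact Real.sqrt_le_one.2 (by nlinarith [sq_nonneg w])
  · exact zero_le

theorem lintegral_comp_mulVec {n : ℕ} {A : Matrix (Fin n) (Fin n) ℝ} (hA : A.det ≠ 0)
    {f : (Fin n → ℝ) → ℝ≥0∞} (hf : Measurable f) :
    ∫⁻ w, f (A.mulVec w) = ENNReal.ofReal |A.det⁻¹| * ∫⁻ w, f w := by
  have h := Real.map_matrix_volume_pi_eq_smul_volume_pi hA
  have h2 : ∫⁻ w, f w ∂(Measure.map (Matrix.toLin' A) volume) = ∫⁻ w, f (A.mulVec w) := by
    rw [lintegral_map hf (LinearMap.continuous_of_finiteDimensional _).measurable]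
    rfl
  rw [← h2, h, lintegral_smul_measure, smul_eq_mul]

/-- The polynomial with coefficient vector `w`. -/
def polyOfVec {n : ℕ} (w : Fin n → ℝ) : Polynomial ℝ :=
  ∑ k, Polynomial.C (w k) * Polynomial.X ^ (k : ℕ)

theorem eval_polyOfVec {n : ℕ} (w : Fin n → ℝ) (x : ℝ) :
    (polyOfVec w).eval x = ∑ k, w k * x ^ (k : ℕ) := by
  simp [polyOfVec, Polynomial.eval_finsetSum]

theorem degree_polyOfVec_lt {n : ℕ} (w : Fin n → ℝ) : (polyOfVec w).degree < n := by
  rw [← Polynomial.mem_degreeLT]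
  refine Submodule.sum_mem _ fun k _ => Polynomial.mem_degreeLT.2 ?_
  exact (Polynomial.degree_C_mul_X_pow_le _ _).trans_lt (by exact_mod_cast k.2)

theorem natDegree_polyOfVec_sq_lt {n : ℕ} (hn : 1 ≤ n) (w : Fin n → ℝ) :
    (polyOfVec w ^ 2).natDegree < 2 * n - 1 := by
  have h : (polyOfVec w).natDegree < n := by
    rcases eq_or_ne (polyOfVec w) 0 with h | h
    · rw [h, Polynomial.natDegree_zero]; omega
    · exact (Polynomial.natDegree_lt_iff_degree_lt h).2 (degree_polyOfVec_lt w)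
  have := Polynomial.natDegree_pow_le (p := polyOfVec w) (n := 2)
  omega

/-- A power of the weight is a mixture of the next lower powers for the polynomials `E + P²`. -/
theorem lintegral_bandWt_add_sq {n : ℕ} (E : Polynomial ℝ) (d : ℕ) {b : Fin n → ℝ}
    (hb : Function.Injective b) :
    ∫⁻ w : Fin n → ℝ, bandWt (E + polyOfVec w ^ 2) d b = bandConst d ^ n * bandWt E (d + 1) b := by
  have hdet : (Matrix.vandermonde b).det ≠ 0 := Matrix.det_vandermonde_ne_zero_iff.2 hb
  have hv := vdm_pos hb
  have h1 : ∀ w : Fin n → ℝ, bandWt (E + polyOfVec w ^ 2) d b = ENNReal.ofReal ((vdm b)⁻¹ ^ d) *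
      ∏ i, bandPow d (-E.eval (b i) - ((Matrix.vandermonde b).mulVec w i) ^ 2) := fun w => by
    rw [bandWt]
    congr 1
    refine Finset.prod_congr rfl fun i _ => ?_
    congr 1
    have : (Matrix.vandermonde b).mulVec w i = (polyOfVec w).eval (b i) := by
      rw [eval_polyOfVec, Matrix.mulVec, dotProduct]
      exact Finset.sum_congr rfl fun k _ => by rw [Matrix.vandermonde_apply, mul_comm]
    rw [this, Polynomial.eval_add, Polynomial.eval_pow]
    ring
  have hm : ∀ i, Measurable fun t : ℝ => bandPow d (-E.eval (b i) - t ^ 2) := fun i =>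
    (measurable_bandPow d).comp (by fun_prop)
  have hm' : Measurable fun x : Fin n → ℝ => ∏ i, bandPow d (-E.eval (b i) - (x i) ^ 2) :=
    Finset.measurable_prod _ fun i _ => (hm i).comp (measurable_pi_apply i)
  simp_rw [h1]
  rw [lintegral_const_mul' _ _ ENNReal.ofReal_ne_top, lintegral_comp_mulVec hdet hm',
    lintegral_pi_prod (fun i t => bandPow d (-E.eval (b i) - t ^ 2)) hm]
  simp_rw [lintegral_bandPow_sub_sq]
  rw [Finset.prod_mul_distrib, bandWt, abs_inv, abs_det_vandermonde, pow_succ,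
    ENNReal.ofReal_mul (by positivity)]
  simp only [Finset.prod_const, Finset.card_univ, Fintype.card_fin]
  ring

theorem measurable_bandWt_add_sq {α : Type*} [MeasurableSpace α] {n : ℕ} (E : Polynomial ℝ) (d : ℕ)
    {f g : α → Fin n → ℝ} (hf : Measurable f) (hg : Measurable g) :
    Measurable fun z => bandWt (E + polyOfVec (f z) ^ 2) d (g z) := by
  unfold bandWt
  have hi : ∀ i, Measurable fun z => g z i := fun i => (measurable_pi_apply i).comp hg
  refine Measurable.mul ?_ (Finset.measurable_prod _ fun i _ => (measurable_bandPow d).comp ?_)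
  · exact (((continuous_vdm.measurable.comp hg).inv).pow_const d).ennreal_ofReal
  · simp only [Polynomial.eval_add, Polynomial.eval_pow, eval_polyOfVec]
    have h1 : Measurable fun z => E.eval (g z i) := E.continuous.measurable.comp (hi i)
    have h2 : ∀ k, Measurable fun z => f z k := fun k => (measurable_pi_apply k).comp hf
    fun_prop

/-- The sum of the entries is symmetrically distributed under every integral power of the weight. -/
theorem bandWt_symm {n : ℕ} (hn : 1 ≤ n) {E : Polynomial ℝ} (hM : E.Monic)
    (hd : E.natDegree = 2 * n) {σ : ℝ} (hσ : E.nextCoeff = -σ) {l u : Fin n → ℝ}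
    (hdisj : ∀ i j, i < j → u j < l i) (hl : ∀ i, 0 ≤ E.eval (l i)) (hu : ∀ i, 0 ≤ E.eval (u i))
    {g : ℝ → ℝ≥0∞} (hg : Measurable g) (d : ℕ) :
    ∫⁻ b in openBox l u, g (∑ i, b i) * bandWt E d b =
      ∫⁻ b in openBox l u, g (σ - ∑ i, b i) * bandWt E d b := by
  induction d generalizing E with
  | zero => exact bandWt_zero_symm hM hd hσ hdisj hl hu g
  | succ d ih =>
    have hC0 : bandConst d ^ n ≠ 0 := pow_ne_zero _ (bandConst_ne_zero d)
    have hCt : bandConst d ^ n ≠ ⊤ := ENNReal.pow_ne_top (bandConst_ne_top d)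
    have key : ∀ f : (Fin n → ℝ) → ℝ≥0∞, Measurable f →
        bandConst d ^ n * ∫⁻ b in openBox l u, f b * bandWt E (d + 1) b =
          ∫⁻ w : Fin n → ℝ, ∫⁻ b in openBox l u, f b * bandWt (E + polyOfVec w ^ 2) d b := by
      intro f hf
      have hsw := lintegral_lintegral_swap (μ := (volume : Measure (Fin n → ℝ)))
        (ν := volume.restrict (openBox l u))
        (f := fun w b => f b * bandWt (E + polyOfVec w ^ 2) d b) ?_
      · rw [hsw, ← lintegral_const_mul' _ _ hCt]
        refine setLIntegral_congr_fun (measurableSet_openBox l u) fun b hb => ?_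
        have hmb : Measurable fun w : Fin n → ℝ => bandWt (E + polyOfVec w ^ 2) d b :=
          measurable_bandWt_add_sq E d measurable_id measurable_const
        rw [lintegral_const_mul _ hmb,
          lintegral_bandWt_add_sq E d (injective_of_mem_openBox hdisj hb)]
        ring
      · refine Measurable.aemeasurable ?_
        exact (hf.comp measurable_snd).mul
          (measurable_bandWt_add_sq E d measurable_fst measurable_snd)
    have hgs : Measurable fun b : Fin n → ℝ => g (∑ i, b i) := hg.comp (by fun_prop)
    have hgs' : Measurable fun b : Fin n → ℝ => g (σ - ∑ i, b i) := hg.comp (by fun_prop)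
    refine (ENNReal.mul_right_inj hC0 hCt).1 ?_
    rw [key _ hgs, key _ hgs']
    refine lintegral_congr fun w => ?_
    have hdeg := natDegree_polyOfVec_sq_lt hn w
    have hlt : (polyOfVec w ^ 2).natDegree < E.natDegree := by omega
    refine ih (hM.add_of_left (Polynomial.degree_lt_degree hlt)) ?_ ?_ ?_ ?_
    · rw [Polynomial.natDegree_add_eq_left_of_natDegree_lt hlt, hd]
    · rw [Polynomial.nextCoeff_of_natDegree_pos (by omega)] at hσ
      rw [Polynomial.nextCoeff_of_natDegree_pos
        (by rw [Polynomial.natDegree_add_eq_left_of_natDegree_lt hlt]; omega),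
        Polynomial.natDegree_add_eq_left_of_natDegree_lt hlt, Polynomial.coeff_add, hσ,
        Polynomial.coeff_eq_zero_of_natDegree_lt (by omega), add_zero]
    · intro i
      rw [Polynomial.eval_add, Polynomial.eval_pow]
      have := hl i
      positivity
    · intro i
      rw [Polynomial.eval_add, Polynomial.eval_pow]
      have := hu i
      positivity

/-- Finite measures on a bounded interval `[0, K]` with the same moments are equal. -/
theorem measure_eq_of_moments_eq {μ ν : Measure ℝ} [IsFiniteMeasure μ] [IsFiniteMeasure ν] {K : ℝ}
    (hμ : ∀ᵐ x ∂μ, x ∈ Set.Icc 0 K) (hν : ∀ᵐ x ∂ν, x ∈ Set.Icc 0 K)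
    (h : ∀ d : ℕ, ∫⁻ x, ENNReal.ofReal (x ^ d) ∂μ = ∫⁻ x, ENNReal.ofReal (x ^ d) ∂ν) : μ = ν := by
  have hint : ∀ {ρ : Measure ℝ} [IsFiniteMeasure ρ], (∀ᵐ x ∂ρ, x ∈ Set.Icc 0 K) →
      ∀ {f : ℝ → ℝ}, Continuous f → Integrable f ρ := by
    intro ρ _ hρ f hf
    obtain ⟨M, hM⟩ := (isCompact_Icc (a := (0 : ℝ)) (b := K)).exists_bound_of_continuousOn
      hf.continuousOn
    exact Integrable.of_bound hf.aestronglyMeasurable M (hρ.mono hM)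
  have hmom : ∀ d : ℕ, ∫ x, x ^ d ∂μ = ∫ x, x ^ d ∂ν := fun d => by
    rw [integral_eq_lintegral_of_nonneg_ae (hμ.mono fun x hx => pow_nonneg hx.1 d)
      (continuous_pow d).aestronglyMeasurable,
      integral_eq_lintegral_of_nonneg_ae (hν.mono fun x hx => pow_nonneg hx.1 d)
      (continuous_pow d).aestronglyMeasurable, h]
  have hpoly : ∀ p : Polynomial ℝ, ∫ x, p.eval x ∂μ = ∫ x, p.eval x ∂ν := fun p => by
    simp_rw [Polynomial.eval_eq_sum_range]
    rw [integral_finsetSum _ fun d _ => hint hμ (by fun_prop),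
      integral_finsetSum _ fun d _ => hint hν (by fun_prop)]
    simp_rw [integral_const_mul, hmom]
  refine ext_of_forall_integral_eq_of_IsFiniteMeasure fun f => ?_
  have hmass : ∀ ε > 0, |∫ x, f x ∂μ - ∫ x, f x ∂ν| ≤ ε * (μ.real Set.univ + ν.real Set.univ) := by
    intro ε hε
    obtain ⟨p, hp⟩ := exists_polynomial_near_of_continuousOn 0 K f f.continuous.continuousOn ε hε
    have hnear : ∀ {ρ : Measure ℝ} [IsFiniteMeasure ρ], (∀ᵐ x ∂ρ, x ∈ Set.Icc 0 K) →
        |∫ x, p.eval x ∂ρ - ∫ x, f x ∂ρ| ≤ ε * ρ.real Set.univ := by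
      intro ρ _ hρ
      rw [← integral_sub (hint hρ p.continuous) (hint hρ f.continuous)]
      exact norm_integral_le_of_norm_le_const (f := fun x => p.eval x - f x)
        (hρ.mono fun x hx => (hp x hx).le)
    have h1 := abs_le.1 (hnear hμ)
    have h2 := abs_le.1 (hnear hν)
    rw [hpoly] at h1
    rw [abs_le]
    constructor <;> linarith [h1.1, h1.2, h2.1, h2.2]
  set M := μ.real Set.univ + ν.real Set.univ with hMdef
  have hM : 0 ≤ M := by positivity
  by_contra hne
  have hpos : 0 < |∫ x, f x ∂μ - ∫ x, f x ∂ν| := abs_pos.2 (sub_ne_zero.2 hne)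
  have := hmass (|∫ x, f x ∂μ - ∫ x, f x ∂ν| / (2 * (M + 1))) (by positivity)
  rw [div_mul_eq_mul_div, le_div_iff₀ (by positivity)] at this
  nlinarith

/-- The monic polynomial with roots `l i` and `u i`. -/
def bandPoly {n : ℕ} (l u : Fin n → ℝ) : Polynomial ℝ :=
  ∏ i, ((Polynomial.X - Polynomial.C (l i)) * (Polynomial.X - Polynomial.C (u i)))

theorem monic_bandPoly {n : ℕ} (l u : Fin n → ℝ) : (bandPoly l u).Monic :=
  Polynomial.monic_prod_of_monic _ _ fun _ _ =>
    (Polynomial.monic_X_sub_C _).mul (Polynomial.monic_X_sub_C _)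

theorem natDegree_bandPoly {n : ℕ} (l u : Fin n → ℝ) : (bandPoly l u).natDegree = 2 * n := by
  rw [bandPoly, Polynomial.natDegree_prod_of_monic _ _ fun i _ =>
    (Polynomial.monic_X_sub_C _).mul (Polynomial.monic_X_sub_C _)]
  simp [Polynomial.natDegree_mul, Polynomial.X_sub_C_ne_zero, mul_comm]

theorem nextCoeff_bandPoly {n : ℕ} (l u : Fin n → ℝ) :
    (bandPoly l u).nextCoeff = -∑ i, (l i + u i) := by
  rw [bandPoly, Polynomial.Monic.nextCoeff_prod _ _ fun i _ =>
    (Polynomial.monic_X_sub_C _).mul (Polynomial.monic_X_sub_C _), ← Finset.sum_neg_distrib]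
  refine Finset.sum_congr rfl fun i _ => ?_
  rw [(Polynomial.monic_X_sub_C _).nextCoeff_mul (Polynomial.monic_X_sub_C _),
    Polynomial.nextCoeff_X_sub_C, Polynomial.nextCoeff_X_sub_C]
  ring

theorem eval_bandPoly {n : ℕ} (l u : Fin n → ℝ) (x : ℝ) :
    (bandPoly l u).eval x = ∏ j, ((x - l j) * (x - u j)) := by
  simp [bandPoly, Polynomial.eval_prod]

theorem eval_bandPoly_left {n : ℕ} (l u : Fin n → ℝ) (i : Fin n) :
    (bandPoly l u).eval (l i) = 0 := by
  rw [eval_bandPoly]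
  exact Finset.prod_eq_zero (Finset.mem_univ i) (by simp)

theorem eval_bandPoly_right {n : ℕ} (l u : Fin n → ℝ) (i : Fin n) :
    (bandPoly l u).eval (u i) = 0 := by
  rw [eval_bandPoly]
  exact Finset.prod_eq_zero (Finset.mem_univ i) (by simp)

/-- The weight `∏ √(-E (b i)) / vdm b` for `E = bandPoly l u`. -/
def bandRatio {n : ℕ} (l u b : Fin n → ℝ) : ℝ :=
  (vdm b)⁻¹ * ∏ i, √(-(bandPoly l u).eval (b i))

theorem bandRatio_nonneg {n : ℕ} (l u b : Fin n → ℝ) : 0 ≤ bandRatio l u b :=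
  mul_nonneg (inv_nonneg.2 (vdm_nonneg b)) (Finset.prod_nonneg fun _ _ => Real.sqrt_nonneg _)

theorem continuous_eval_coord {n : ℕ} (E : Polynomial ℝ) (i : Fin n) :
    Continuous fun b : Fin n → ℝ => E.eval (b i) :=
  E.continuous.comp (continuous_apply i)

theorem measurable_bandRatio {n : ℕ} (l u : Fin n → ℝ) : Measurable (bandRatio l u) := by
  unfold bandRatio
  refine Measurable.mul (by fun_prop) (Finset.measurable_prod _ fun i _ => ?_)
  exact (continuous_eval_coord _ i).neg.sqrt.measurable

theorem exists_bandRatio_le {n : ℕ} {l u : Fin n → ℝ} (hdisj : ∀ i j, i < j → u j < l i) :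
    ∃ K, ∀ b ∈ openBox l u, bandRatio l u b ≤ K := by
  have hinj : ∀ b ∈ Set.Icc l u, Function.Injective b := by
    intro b hb i j hij
    by_contra hne
    rcases lt_or_gt_of_ne hne with h | h
    · linarith [hdisj _ _ h, hb.1 i, hb.2 j]
    · linarith [hdisj _ _ h, hb.1 j, hb.2 i]
  have hc : ContinuousOn (bandRatio l u) (Set.Icc l u) := by
    refine ContinuousOn.mul (ContinuousOn.inv₀ (by fun_prop) fun b hb => (vdm_pos (hinj b hb)).ne')
      (Continuous.continuousOn (continuous_finsetProd _ fun i _ => ?_))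
    exact (continuous_eval_coord _ i).neg.sqrt
  obtain ⟨K, hK⟩ := isCompact_Icc.exists_bound_of_continuousOn hc
  refine ⟨K, fun b hb => (le_abs_self _).trans (hK b ⟨fun i => ?_, fun i => ?_⟩)⟩
  · exact (hb i trivial).1.le
  · exact (hb i trivial).2.le

theorem eval_bandPoly_neg {n : ℕ} {l u b : Fin n → ℝ} (hdisj : ∀ i j, i < j → u j < l i)
    (hb : b ∈ openBox l u) (i : Fin n) : (bandPoly l u).eval (b i) < 0 :=
  (eval_prod_neg_iff hdisj (fun _ => le_rfl)
    (fun j => (hb j trivial).1.trans (hb j trivial).2) (fun _ => le_rfl) (hb i trivial)).2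
    (hb i trivial)

theorem bandWt_bandPoly {n : ℕ} {l u b : Fin n → ℝ} (hdisj : ∀ i j, i < j → u j < l i)
    (hb : b ∈ openBox l u) (d : ℕ) :
    bandWt (bandPoly l u) d b = ENNReal.ofReal (bandRatio l u b ^ d) := by
  have h : ∀ i, bandPow d (-(bandPoly l u).eval (b i)) =
      ENNReal.ofReal (√(-(bandPoly l u).eval (b i)) ^ d) := fun i =>
    if_pos (neg_pos.2 (eval_bandPoly_neg hdisj hb i))
  have := vdm_nonneg b
  simp_rw [bandWt, h]
  rw [← ENNReal.ofReal_prod_of_nonneg fun i _ => by positivity,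
    ← ENNReal.ofReal_mul (by positivity), bandRatio, mul_pow, Finset.prod_pow]

/-- The sum of the entries is symmetrically distributed under every real power of the weight. -/
theorem bandRatio_symm {n : ℕ} (hn : 1 ≤ n) {l u : Fin n → ℝ}
    (hdisj : ∀ i j, i < j → u j < l i) (t p : ℝ) :
    ∫⁻ b in openBox l u, ENNReal.ofReal (Real.exp (t * ∑ i, b i)) *
        ENNReal.ofReal (bandRatio l u b ^ p) =
      ∫⁻ b in openBox l u, ENNReal.ofReal (Real.exp (t * (∑ i, (l i + u i) - ∑ i, b i))) *
        ENNReal.ofReal (bandRatio l u b ^ p) := by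
  obtain ⟨K, hK⟩ := exists_bandRatio_le hdisj
  let ν : ((Fin n → ℝ) → ℝ) → Measure ℝ := fun f =>
    ((volume.restrict (openBox l u)).withDensity fun b => ENNReal.ofReal (f b)).map (bandRatio l u)
  have hfin : ∀ f, Continuous f → IsFiniteMeasure (ν f) := fun f hf => by
    have hsub : openBox l u ⊆ Set.Icc l u := fun b hb =>
      ⟨fun i => (hb i trivial).1.le, fun i => (hb i trivial).2.le⟩
    have : IsFiniteMeasure
        ((volume.restrict (openBox l u)).withDensity fun b => ENNReal.ofReal (f b)) :=
      isFiniteMeasure_withDensity_ofReal (hf.integrableOn_Icc.mono_set hsub).2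
    exact Measure.isFiniteMeasure_map _ _
  have hsupp : ∀ f, Continuous f → ∀ᵐ x ∂ν f, x ∈ Set.Icc 0 K := fun f hf => by
    refine (ae_map_iff (measurable_bandRatio l u).aemeasurable measurableSet_Icc).2 ?_
    refine (withDensity_absolutelyContinuous _ _).ae_le ?_
    filter_upwards [ae_restrict_mem (measurableSet_openBox l u)] with b hb
    exact ⟨bandRatio_nonneg l u b, hK b hb⟩
  have hlin : ∀ f, Continuous f → ∀ h : ℝ → ℝ≥0∞, Measurable h → ∫⁻ x, h x ∂ν f =
      ∫⁻ b in openBox l u, ENNReal.ofReal (f b) * h (bandRatio l u b) := fun f hf h hh => by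
    rw [lintegral_map hh (measurable_bandRatio l u)]
    exact lintegral_withDensity_eq_lintegral_mul _ hf.measurable.ennreal_ofReal
      (hh.comp (measurable_bandRatio l u))
  have hc1 : Continuous fun b : Fin n → ℝ => Real.exp (t * ∑ i, b i) := by fun_prop
  have hc2 : Continuous fun b : Fin n → ℝ =>
    Real.exp (t * (∑ i, (l i + u i) - ∑ i, b i)) := by fun_prop
  have := hfin _ hc1
  have := hfin _ hc2
  have hν : ν (fun b => Real.exp (t * ∑ i, b i)) =
      ν (fun b => Real.exp (t * (∑ i, (l i + u i) - ∑ i, b i))) := by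
    refine measure_eq_of_moments_eq (hsupp _ hc1) (hsupp _ hc2) fun d => ?_
    have hmd : Measurable fun x : ℝ => ENNReal.ofReal (x ^ d) := by fun_prop
    rw [hlin _ hc1 _ hmd, hlin _ hc2 _ hmd]
    have := bandWt_symm hn (monic_bandPoly l u) (natDegree_bandPoly l u) (nextCoeff_bandPoly l u)
      hdisj (fun i => (eval_bandPoly_left l u i).ge) (fun i => (eval_bandPoly_right l u i).ge)
      (g := fun s => ENNReal.ofReal (Real.exp (t * s))) (by fun_prop) d
    convert this using 1 <;> refine setLIntegral_congr_fun (measurableSet_openBox l u)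
      fun b hb => ?_ <;> simp only [bandWt_bandPoly hdisj hb]
  have hmp : Measurable fun x : ℝ => ENNReal.ofReal (x ^ p) := by fun_prop
  rw [← hlin _ hc1 _ hmp, ← hlin _ hc2 _ hmp, hν]

/-- The Dixon–Anderson density: the conditional density of level `n` of the orbital beta process
given level `n + 1`. -/
def dixonDensity (θ : ℝ) {n : ℕ} (a : Fin (n + 1) → ℝ) (b : Fin n → ℝ) : ℝ :=
  Real.Gamma ((n + 1) * θ) / Real.Gamma θ ^ (n + 1) * vdm a ^ (1 - 2 * θ) * vdm b *
    crossProd a b ^ (θ - 1)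

/-- The multivariate Bessel function at a real point, computed level by level; `y k` is the
argument attached to level `k + 1`. -/
def corner (θ : ℝ) : (n : ℕ) → (Fin n → ℝ) → (ℕ → ℝ) → ℝ≥0∞
  | 0, _, _ => 1
  | n + 1, a, y => ∫⁻ b in {b : Fin n → ℝ | Interlaces b a},
      ENNReal.ofReal (dixonDensity θ a b * Real.exp (y n * (∑ i, a i - ∑ i, b i))) *
        corner θ n b y

theorem dixonDensity_nonneg {θ : ℝ} (hθ : 0 < θ) {n : ℕ} (a : Fin (n + 1) → ℝ) (b : Fin n → ℝ) :
    0 ≤ dixonDensity θ a b := by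
  have h1 := vdm_nonneg a
  have h2 := vdm_nonneg b
  have h3 := crossProd_nonneg a b
  have h4 := (Real.Gamma_pos_of_pos hθ).le
  have h5 : 0 ≤ Real.Gamma ((n + 1) * θ) := (Real.Gamma_pos_of_pos (by positivity)).le
  unfold dixonDensity
  positivity

theorem Interlaces.strictAnti {n : ℕ} {b : Fin n → ℝ} {a : Fin (n + 1) → ℝ} (h : Interlaces b a) :
    StrictAnti b := by
  cases n with
  | zero => exact fun i => i.elim0
  | succ n => exact Fin.strictAnti_iff_succ_lt.2 fun i => (h i.succ).1.trans (h i.castSucc).2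

theorem measurableSet_interlaces_prod {n : ℕ} :
    MeasurableSet {z : (Fin (n + 1) → ℝ) × (Fin n → ℝ) | Interlaces z.2 z.1} := by
  have : {z : (Fin (n + 1) → ℝ) × (Fin n → ℝ) | Interlaces z.2 z.1} =
      ⋂ i, ({z | z.2 i < z.1 i.castSucc} ∩ {z | z.1 i.succ < z.2 i}) := by
    ext z; simp [Interlaces]
  rw [this]
  refine MeasurableSet.iInter fun i => MeasurableSet.inter ?_ ?_
  · exact measurableSet_lt (by fun_prop) (by fun_prop)
  · exact measurableSet_lt (by fun_prop) (by fun_prop)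

theorem measurableSet_interlaces {n : ℕ} (a : Fin (n + 1) → ℝ) :
    MeasurableSet {b : Fin n → ℝ | Interlaces b a} :=
  measurable_prodMk_left (x := a) measurableSet_interlaces_prod

theorem measurable_dixonDensity (θ : ℝ) {n : ℕ} :
    Measurable fun z : (Fin (n + 1) → ℝ) × (Fin n → ℝ) => dixonDensity θ z.1 z.2 := by
  have h1 : Measurable fun z : (Fin (n + 1) → ℝ) × (Fin n → ℝ) => vdm z.1 :=
    continuous_vdm.measurable.comp measurable_fst
  have h2 : Measurable fun z : (Fin (n + 1) → ℝ) × (Fin n → ℝ) => vdm z.2 :=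
    continuous_vdm.measurable.comp measurable_snd
  have h3 : Measurable fun z : (Fin (n + 1) → ℝ) × (Fin n → ℝ) => crossProd z.1 z.2 := by
    unfold crossProd
    fun_prop
  unfold dixonDensity
  fun_prop

/-- The transition weight from `a` down to `b` with argument `s`. -/
def stepWt (θ s : ℝ) {n : ℕ} (a : Fin (n + 1) → ℝ) (b : Fin n → ℝ) : ℝ≥0∞ :=
  {b : Fin n → ℝ | Interlaces b a}.indicator
    (fun b => ENNReal.ofReal (dixonDensity θ a b * Real.exp (s * (∑ i, a i - ∑ i, b i)))) b

theorem measurable_stepWt (θ s : ℝ) {n : ℕ} :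
    Measurable fun z : (Fin (n + 1) → ℝ) × (Fin n → ℝ) => stepWt θ s z.1 z.2 := by
  have := measurable_dixonDensity θ (n := n)
  refine Measurable.indicator (f := fun z : (Fin (n + 1) → ℝ) × (Fin n → ℝ) =>
    ENNReal.ofReal (dixonDensity θ z.1 z.2 * Real.exp (s * (∑ i, z.1 i - ∑ i, z.2 i))))
    (by fun_prop) measurableSet_interlaces_prod

theorem corner_succ (θ : ℝ) {n : ℕ} (a : Fin (n + 1) → ℝ) (y : ℕ → ℝ) :
    corner θ (n + 1) a y = ∫⁻ b, stepWt θ (y n) a b * corner θ n b y := by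
  rw [corner, ← lintegral_indicator (measurableSet_interlaces a)]
  refine lintegral_congr fun b => ?_
  by_cases hb : b ∈ {b : Fin n → ℝ | Interlaces b a} <;> simp [stepWt, hb]

theorem measurable_corner (θ : ℝ) (n : ℕ) (y : ℕ → ℝ) :
    Measurable fun a : Fin n → ℝ => corner θ n a y := by
  induction n with
  | zero => exact measurable_const
  | succ n ih =>
    simp_rw [corner_succ]
    exact Measurable.lintegral_prod_right'
      ((measurable_stepWt θ (y n)).mul (ih.comp measurable_snd))

theorem corner_congr (θ : ℝ) {n : ℕ} (a : Fin n → ℝ) {y y' : ℕ → ℝ} (h : ∀ k < n, y k = y' k) :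
    corner θ n a y = corner θ n a y' := by
  induction n with
  | zero => rfl
  | succ n ih =>
    simp_rw [corner_succ, h n n.lt_succ_self]
    exact lintegral_congr fun b => by rw [ih b fun k hk => h k (hk.trans n.lt_succ_self)]

/-- The left ends of the intervals containing the entries of `b` when `c ≺ b ≺ a`. -/
def boxLeft {n : ℕ} (a : Fin (n + 2) → ℝ) (c : Fin n → ℝ) : Fin (n + 1) → ℝ :=
  Fin.snoc (α := fun _ => ℝ) (fun j => max (a j.castSucc.succ) (c j)) (a (Fin.last _))

/-- The right ends of the intervals containing the entries of `b` when `c ≺ b ≺ a`. -/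
def boxRight {n : ℕ} (a : Fin (n + 2) → ℝ) (c : Fin n → ℝ) : Fin (n + 1) → ℝ :=
  Fin.cons (a 0) fun j => min (a j.castSucc.succ) (c j)

theorem interlaces_iff_mem_openBox {n : ℕ} (a : Fin (n + 2) → ℝ) (c : Fin n → ℝ)
    (b : Fin (n + 1) → ℝ) :
    Interlaces b a ∧ Interlaces c b ↔ b ∈ openBox (boxLeft a c) (boxRight a c) := by
  have h1 : (∀ i, boxLeft a c i < b i) ↔
      (∀ i : Fin (n + 1), a i.succ < b i) ∧ ∀ j : Fin n, c j < b j.castSucc := by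
    rw [Fin.forall_fin_succ', Fin.forall_fin_succ' (P := fun i => a i.succ < b i)]
    simp only [boxLeft, Fin.snoc_castSucc, Fin.snoc_last, max_lt_iff, Fin.succ_last, forall_and]
    tauto
  have h2 : (∀ i, b i < boxRight a c i) ↔
      (∀ i : Fin (n + 1), b i < a i.castSucc) ∧ ∀ j : Fin n, b j.succ < c j := by
    rw [Fin.forall_fin_succ, Fin.forall_fin_succ (P := fun i => b i < a i.castSucc)]
    simp only [boxRight, Fin.cons_succ, Fin.cons_zero, lt_min_iff, Fin.castSucc_zero, forall_and,
      Fin.succ_castSucc]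
    tauto
  simp only [openBox, Set.mem_univ_pi, Set.mem_Ioo, forall_and, h1, h2, Interlaces]
  tauto

theorem prod_box {n : ℕ} (a : Fin (n + 2) → ℝ) (c : Fin n → ℝ) (x : ℝ) :
    ∏ j, ((x - boxLeft a c j) * (x - boxRight a c j)) = (∏ s, (x - a s)) * ∏ r, (x - c r) := by
  have h : ∀ j : Fin n, (x - max (a j.castSucc.succ) (c j)) * (x - min (a j.castSucc.succ) (c j)) =
      (x - a j.castSucc.succ) * (x - c j) := fun j => by
    rcases le_total (a j.castSucc.succ) (c j) with h | h <;> simp [h, mul_comm]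
  rw [Finset.prod_mul_distrib, Fin.prod_univ_castSucc, Fin.prod_univ_succ (n := n),
    Fin.prod_univ_succ (n := n + 1), Fin.prod_univ_castSucc (n := n)]
  simp only [boxLeft, boxRight, Fin.snoc_castSucc, Fin.snoc_last, Fin.cons_succ, Fin.cons_zero,
    Fin.succ_last]
  have h' := Finset.prod_congr rfl fun j (_ : j ∈ Finset.univ) => h j
  rw [Finset.prod_mul_distrib, Finset.prod_mul_distrib] at h'
  linear_combination (x - a 0) * (x - a (Fin.last (n + 1))) * h'

theorem sum_box {n : ℕ} (a : Fin (n + 2) → ℝ) (c : Fin n → ℝ) :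
    ∑ j, (boxLeft a c j + boxRight a c j) = ∑ s, a s + ∑ r, c r := by
  have h' := Finset.sum_congr rfl fun j (_ : j ∈ Finset.univ) =>
    max_add_min (a (j : Fin n).castSucc.succ) (c j)
  rw [Finset.sum_add_distrib, Finset.sum_add_distrib] at h'
  rw [Finset.sum_add_distrib, Fin.sum_univ_castSucc, Fin.sum_univ_succ (n := n),
    Fin.sum_univ_succ (n := n + 1), Fin.sum_univ_castSucc (n := n)]
  simp only [boxLeft, boxRight, Fin.snoc_castSucc, Fin.snoc_last, Fin.cons_succ, Fin.cons_zero,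
    Fin.succ_last]
  linear_combination h'

theorem boxRight_lt_boxLeft {n : ℕ} {a : Fin (n + 2) → ℝ} (ha : StrictAnti a) {c : Fin n → ℝ}
    (hc : ∀ k, c k ≠ a k.castSucc.succ) (i j : Fin (n + 1)) (hij : i < j) :
    boxRight a c j < boxLeft a c i := by
  obtain ⟨k, rfl⟩ := Fin.exists_succ_eq.2 (Fin.ne_zero_of_lt hij)
  obtain ⟨i, rfl⟩ := Fin.exists_castSucc_eq.2 (Fin.ne_last_of_lt hij)
  simp only [boxLeft, boxRight, Fin.snoc_castSucc, Fin.cons_succ]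
  rcases (Fin.castSucc_lt_succ_iff.1 hij).lt_or_eq with h | rfl
  · exact (min_le_left _ _).trans_lt ((ha (by simpa using h)).trans_le (le_max_left _ _))
  · exact min_lt_max.2 (hc i).symm

theorem bandRatio_rpow {n : ℕ} {a : Fin (n + 2) → ℝ} (ha : StrictAnti a) {c : Fin n → ℝ}
    (hc : ∀ k, c k ≠ a k.castSucc.succ) {b : Fin (n + 1) → ℝ}
    (hb : b ∈ openBox (boxLeft a c) (boxRight a c)) (θ : ℝ) :
    bandRatio (boxLeft a c) (boxRight a c) b ^ (2 * θ - 2) =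
      vdm b ^ (2 - 2 * θ) * (crossProd a b * crossProd b c) ^ (θ - 1) := by
  have hdisj := boxRight_lt_boxLeft ha hc
  have hE : crossProd a b * crossProd b c =
      (∏ i, √(-(bandPoly (boxLeft a c) (boxRight a c)).eval (b i))) ^ 2 := by
    rw [← Finset.prod_pow, crossProd, Finset.prod_comm, crossProd, ← Finset.prod_mul_distrib]
    refine Finset.prod_congr rfl fun i _ => ?_
    have hneg := eval_bandPoly_neg hdisj hb i
    rw [Real.sq_sqrt (by linarith), ← abs_of_neg hneg, eval_bandPoly, prod_box, abs_mul,
      Finset.abs_prod, Finset.abs_prod]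
    simp_rw [abs_sub_comm]
  have h0 : 0 ≤ ∏ i, √(-(bandPoly (boxLeft a c) (boxRight a c)).eval (b i)) :=
    Finset.prod_nonneg fun _ _ => Real.sqrt_nonneg _
  have hv := vdm_nonneg b
  rw [bandRatio, hE, Real.mul_rpow (by positivity) h0, Real.inv_rpow hv, ← Real.rpow_neg hv,
    ← Real.rpow_natCast, ← Real.rpow_mul h0]
  congr 2 <;> push_cast <;> ring

theorem exists_lintegral_stepWt_mul_stepWt {θ : ℝ} (hθ : 0 < θ) {n : ℕ} {a : Fin (n + 2) → ℝ}
    (ha : StrictAnti a) {c : Fin n → ℝ} (hc : ∀ k, c k ≠ a k.castSucc.succ) :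
    ∃ C : ℝ, 0 ≤ C ∧ ∀ p q : ℝ, ∫⁻ b, stepWt θ q a b * stepWt θ p b c =
      ENNReal.ofReal (C * Real.exp (q * ∑ i, a i - p * ∑ i, c i)) *
        ∫⁻ b in openBox (boxLeft a c) (boxRight a c),
          ENNReal.ofReal (Real.exp ((p - q) * ∑ i, b i)) *
          ENNReal.ofReal (bandRatio (boxLeft a c) (boxRight a c) b ^ (2 * θ - 2)) := by
  set C : ℝ := Real.Gamma (((n + 1 : ℕ) + 1) * θ) / Real.Gamma θ ^ (n + 1 + 1) *
    vdm a ^ (1 - 2 * θ) * (Real.Gamma ((n + 1) * θ) / Real.Gamma θ ^ (n + 1)) * vdm c with hCdef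
  have hC : 0 ≤ C := by
    have h1 := vdm_nonneg a
    have h2 := vdm_nonneg c
    have h4 := (Real.Gamma_pos_of_pos hθ).le
    have h5 : 0 ≤ Real.Gamma ((n + 1) * θ) := (Real.Gamma_pos_of_pos (by positivity)).le
    have h6 : 0 ≤ Real.Gamma (((n + 1 : ℕ) + 1) * θ) := (Real.Gamma_pos_of_pos (by positivity)).le
    positivity
  refine ⟨C, hC, fun p q => ?_⟩
  rw [← lintegral_const_mul' _ _ ENNReal.ofReal_ne_top,
    ← lintegral_indicator (measurableSet_openBox _ _)]
  refine lintegral_congr fun b => ?_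
  by_cases hb : b ∈ openBox (boxLeft a c) (boxRight a c)
  · obtain ⟨hba, hcb⟩ := (interlaces_iff_mem_openBox a c b).2 hb
    have hv : 0 < vdm b := vdm_pos hba.strictAnti.injective
    have hR := bandRatio_nonneg (boxLeft a c) (boxRight a c) b
    have hD1 := dixonDensity_nonneg hθ a b
    have hvb : vdm b ^ (2 - 2 * θ) = vdm b * vdm b ^ (1 - 2 * θ) := by
      rw [show 2 - 2 * θ = 1 + (1 - 2 * θ) by ring, Real.rpow_add hv, Real.rpow_one]
    rw [Set.indicator_of_mem hb, stepWt, Set.indicator_of_mem (by exact hba), stepWt,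
      Set.indicator_of_mem (by exact hcb), ← ENNReal.ofReal_mul (by positivity),
      ← ENNReal.ofReal_mul (by positivity), ← ENNReal.ofReal_mul (by positivity),
      bandRatio_rpow ha hc hb, hvb, Real.mul_rpow (crossProd_nonneg _ _) (crossProd_nonneg _ _)]
    congr 1
    have he : Real.exp (q * (∑ i, a i - ∑ i, b i)) * Real.exp (p * (∑ i, b i - ∑ i, c i)) =
        Real.exp (q * ∑ i, a i - p * ∑ i, c i) * Real.exp ((p - q) * ∑ i, b i) := by
      rw [← Real.exp_add, ← Real.exp_add]
      ring_nf
    simp only [dixonDensity, hCdef]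
    linear_combination (Real.Gamma (((n + 1 : ℕ) + 1) * θ) / Real.Gamma θ ^ (n + 1 + 1) *
      vdm a ^ (1 - 2 * θ) * vdm b * crossProd a b ^ (θ - 1) *
      (Real.Gamma ((n + 1) * θ) / Real.Gamma θ ^ (n + 1) * vdm b ^ (1 - 2 * θ) * vdm c *
        crossProd b c ^ (θ - 1))) * he
  · rw [Set.indicator_of_notMem hb]
    rw [← interlaces_iff_mem_openBox, not_and_or] at hb
    rcases hb with hb | hb
    · rw [stepWt, Set.indicator_of_notMem (by exact hb), zero_mul]
    · rw [stepWt, stepWt, Set.indicator_of_notMem (a := c) (by exact hb), mul_zero]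

theorem lintegral_stepWt_mul_stepWt_symm {θ : ℝ} (hθ : 0 < θ) (p q : ℝ) {n : ℕ} {a : Fin (n + 2) → ℝ}
    (ha : StrictAnti a) {c : Fin n → ℝ} (hc : ∀ k, c k ≠ a k.castSucc.succ) :
    ∫⁻ b, stepWt θ q a b * stepWt θ p b c = ∫⁻ b, stepWt θ p a b * stepWt θ q b c := by
  obtain ⟨C, hC, h⟩ := exists_lintegral_stepWt_mul_stepWt hθ ha hc
  rw [h, h, bandRatio_symm (Nat.le_add_left 1 n) (boxRight_lt_boxLeft ha hc),
    ← lintegral_const_mul' _ _ ENNReal.ofReal_ne_top,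
    ← lintegral_const_mul' _ _ ENNReal.ofReal_ne_top]
  refine lintegral_congr fun b => ?_
  rw [← mul_assoc, ← mul_assoc]
  congr 1
  rw [← ENNReal.ofReal_mul (by positivity), ← ENNReal.ofReal_mul (by positivity), sum_box, mul_assoc C, mul_assoc C, ← Real.exp_add,
    ← Real.exp_add]
  ring_nf

theorem corner_swap_top {θ : ℝ} (hθ : 0 < θ) {n : ℕ} {a : Fin (n + 2) → ℝ} (ha : StrictAnti a)
    {y y' : ℕ → ℝ} (h : ∀ k < n, y k = y' k) (h0 : y n = y' (n + 1)) (h1 : y (n + 1) = y' n) :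
    corner θ (n + 2) a y = corner θ (n + 2) a y' := by
  have key : ∀ y : ℕ → ℝ, corner θ (n + 2) a y =
      ∫⁻ c, (∫⁻ b, stepWt θ (y (n + 1)) a b * stepWt θ (y n) b c) * corner θ n c y := fun y => by
    have hm1 : Measurable fun b => stepWt θ (y (n + 1)) a b :=
      (measurable_stepWt θ (y (n + 1))).comp measurable_prodMk_left
    have hm2 : Measurable fun z : (Fin (n + 1) → ℝ) × (Fin n → ℝ) =>
        stepWt θ (y (n + 1)) a z.1 * (stepWt θ (y n) z.1 z.2 * corner θ n z.2 y) :=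
      (hm1.comp measurable_fst).mul ((measurable_stepWt θ (y n)).mul
        ((measurable_corner θ n y).comp measurable_snd))
    rw [corner_succ]
    simp_rw [corner_succ θ _ y]
    have e1 : ∀ b : Fin (n + 1) → ℝ, stepWt θ (y (n + 1)) a b *
        ∫⁻ c, stepWt θ (y n) b c * corner θ n c y =
        ∫⁻ c, stepWt θ (y (n + 1)) a b * (stepWt θ (y n) b c * corner θ n c y) := fun b =>
      (lintegral_const_mul _ (((measurable_stepWt θ (y n)).comp measurable_prodMk_left).mul
        (measurable_corner θ n y))).symm
    simp_rw [e1]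
    rw [lintegral_lintegral_swap hm2.aemeasurable]
    refine lintegral_congr fun c => ?_
    have hm3 : Measurable fun b => stepWt θ (y (n + 1)) a b * stepWt θ (y n) b c :=
      hm1.mul ((measurable_stepWt θ (y n)).comp measurable_prodMk_right)
    rw [← lintegral_mul_const _ hm3]
    exact lintegral_congr fun b => (mul_assoc _ _ _).symm
  rw [key, key]
  have hae : ∀ᵐ c : Fin n → ℝ, ∀ k, c k ≠ a k.castSucc.succ := by
    rw [ae_all_iff]
    intro k
    rw [ae_iff, volume_pi]
    simpa using Measure.pi_hyperplane (fun _ : Fin n => (volume : Measure ℝ)) k (a k.castSucc.succ)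
  refine lintegral_congr_ae ?_
  filter_upwards [hae] with c hc
  rw [h0, h1, lintegral_stepWt_mul_stepWt_symm hθ _ _ ha hc, corner_congr θ c h]

theorem corner_swap_adjacent {θ : ℝ} (hθ : 0 < θ) {n : ℕ} {a : Fin n → ℝ} (ha : StrictAnti a)
    {k : ℕ} (hk : k + 1 < n) {y y' : ℕ → ℝ} (h : ∀ j, j ≠ k → j ≠ k + 1 → y j = y' j)
    (h0 : y k = y' (k + 1)) (h1 : y (k + 1) = y' k) : corner θ n a y = corner θ n a y' := by
  induction n with
  | zero => omega
  | succ n ih =>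
    rcases Nat.lt_or_ge (k + 1) n with hkn | hkn
    · rw [corner_succ, corner_succ, h n (by omega) (by omega)]
      refine lintegral_congr fun b => ?_
      by_cases hb : Interlaces b a
      · rw [ih hb.strictAnti hkn]
      · rw [stepWt, Set.indicator_of_notMem (by exact hb), zero_mul, zero_mul]
    · obtain rfl : n = k + 1 := by omega
      exact corner_swap_top hθ ha (fun j hj => h j (by omega) (by omega)) h0 h1

/-- The multivariate Bessel function is symmetric in its arguments. -/
theorem corner_perm {θ : ℝ} (hθ : 0 < θ) {n : ℕ} {a : Fin n → ℝ} (ha : StrictAnti a)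
    (e : Equiv.Perm (Fin n)) {y y' : ℕ → ℝ} (h : ∀ i : Fin n, y' i = y (e i)) :
    corner θ n a y' = corner θ n a y := by
  cases n with
  | zero => rfl
  | succ n =>
    have he : e ∈ Submonoid.closure
        (Set.range fun i : Fin n => Equiv.swap i.castSucc i.succ) := by
      rw [Equiv.Perm.mclosure_swap_castSucc_succ]; trivial
    induction he using Submonoid.closure_induction generalizing y y' with
    | mem e he =>
      obtain ⟨i, rfl⟩ := he
      set y'' : ℕ → ℝ := fun j => if h : j < n + 1 then y' j else y j with hy''
      have e1 : corner θ (n + 1) a y' = corner θ (n + 1) a y'' :=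
        corner_congr θ a fun k hk => by simp only [hy'', hk, dif_pos]
      rw [e1]
      have hi := i.2
      refine corner_swap_adjacent hθ ha (k := i) (by omega) (fun j h1 h2 => ?_) ?_ ?_
      · simp only [hy'']
        split_ifs with hj
        · have := h ⟨j, hj⟩
          rwa [Equiv.swap_apply_of_ne_of_ne (fun h' => h1 (congrArg Fin.val h'))
            (fun h' => h2 (congrArg Fin.val h'))] at this
        · rfl
      · have := h i.castSucc
        rw [Equiv.swap_apply_left] at this
        simpa [hy'', show (i : ℕ) < n + 1 by omega] using this
      · have := h i.succ
        rw [Equiv.swap_apply_right] at this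
        simpa [hy''] using this
    | one => exact corner_congr θ a fun k hk => h ⟨k, hk⟩
    | mul e₁ e₂ _ _ ih₁ ih₂ =>
      set y'' : ℕ → ℝ := fun j => if h : j < n + 1 then y (e₁ ⟨j, h⟩) else 0 with hy''
      rw [ih₂ (y := y'') (y' := y') fun i => by rw [h, hy'']; simp only [Fin.is_lt, dif_pos]; rfl,
        ih₁ (y := y) fun i => by simp only [hy'', Fin.is_lt, dif_pos]]

/-- The triangular array obtained by adding the top level `b` to `x`. -/
def triSnoc {n : ℕ} (b : Fin (n + 1) → ℝ) (x : Tri n) : Tri (n + 1) :=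
  Fin.snoc (α := fun k : Fin (n + 1) => Fin (k.1 + 1) → ℝ) x b

theorem triSnoc_castSucc {n : ℕ} (b : Fin (n + 1) → ℝ) (x : Tri n) (k : Fin n) :
    triSnoc b x k.castSucc = x k :=
  Fin.snoc_castSucc (α := fun k : Fin (n + 1) => Fin (k.1 + 1) → ℝ) b x k

theorem triSnoc_last {n : ℕ} (b : Fin (n + 1) → ℝ) (x : Tri n) :
    triSnoc b x (Fin.last n) = b :=
  Fin.snoc_last (α := fun k : Fin (n + 1) => Fin (k.1 + 1) → ℝ) b x

theorem measurable_triSnoc {n : ℕ} :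
    Measurable fun z : (Fin (n + 1) → ℝ) × Tri n => triSnoc z.1 z.2 := by
  refine measurable_pi_lambda _ fun k => ?_
  induction k using Fin.lastCases with
  | last =>
    simp only [triSnoc_last]
    exact measurable_fst
  | cast k =>
    simp only [triSnoc_castSucc]
    exact (measurable_pi_apply k).comp measurable_snd

theorem map_triSnoc {n : ℕ} :
    Measure.map (fun z : (Fin (n + 1) → ℝ) × Tri n => triSnoc z.1 z.2) (volume.prod volume) =
      (volume : Measure (Tri (n + 1))) := by
  rw [volume_pi (α := fun k : Fin (n + 1) => Fin (k.1 + 1) → ℝ), eq_comm]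
  refine Measure.pi_eq fun s hs => ?_
  rw [Measure.map_apply measurable_triSnoc (MeasurableSet.univ_pi hs)]
  have : (fun z : (Fin (n + 1) → ℝ) × Tri n => triSnoc z.1 z.2) ⁻¹' Set.univ.pi s =
      s (Fin.last n) ×ˢ Set.univ.pi fun k : Fin n => s k.castSucc := by
    ext z
    simp only [Set.mem_preimage, Set.mem_univ_pi, Set.mem_prod]
    rw [Fin.forall_fin_succ', triSnoc_last, and_comm]
    simp only [triSnoc_castSucc]
  rw [this, Measure.prod_prod, Fin.prod_univ_castSucc, mul_comm]
  congr 1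
  exact Measure.pi_pi _ _

theorem lintegral_triSnoc {n : ℕ} {f : Tri (n + 1) → ℝ≥0∞} (hf : Measurable f) :
    ∫⁻ x, f x = ∫⁻ b : Fin (n + 1) → ℝ, ∫⁻ x : Tri n, f (triSnoc b x) := by
  rw [← map_triSnoc, lintegral_map hf measurable_triSnoc]
  exact lintegral_prod _ (hf.comp measurable_triSnoc).aemeasurable

theorem lvl_triSnoc_of_lt {n : ℕ} (a : Fin (n + 2) → ℝ) (b : Fin (n + 1) → ℝ) (x : Tri n) {k : ℕ}
    (hk : k < n + 2) (hk' : k < n + 1) :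
    lvl a (triSnoc b x) k hk = lvl b x k hk' := by
  have h1 : k < n + 2 - 1 := hk'
  rw [lvl, dif_pos h1]
  rcases Nat.lt_or_ge k n with h | h
  · have h2 : k < n + 1 - 1 := h
    rw [lvl, dif_pos h2]
    exact triSnoc_castSucc b x ⟨k, h⟩
  · obtain rfl : k = n := by omega
    rw [lvl, dif_neg (by omega)]
    exact triSnoc_last b x

theorem lvl_top {n : ℕ} (a : Fin (n + 1) → ℝ) (x : Tri n) (hk : n < n + 1) : lvl a x n hk = a := by
  rw [lvl, dif_neg (by omega)]

theorem triSnoc_mem_obpDomain {n : ℕ} (a : Fin (n + 2) → ℝ) (b : Fin (n + 1) → ℝ) (x : Tri n) :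
    triSnoc b x ∈ obpDomain a ↔ Interlaces b a ∧ x ∈ obpDomain b := by
  have h := Fin.forall_fin_succ' (n := n) (P := fun k =>
    Interlaces (triSnoc b x k) (lvl a (triSnoc b x) (k.1 + 1) (by have := k.isLt; omega)))
  refine h.trans ?_
  rw [and_comm]
  refine and_congr ?_ (forall_congr' fun k => ?_)
  · rw [triSnoc_last]
    exact iff_of_eq (congrArg (Interlaces b) (lvl_top a (triSnoc b x) _))
  · rw [triSnoc_castSucc]
    exact iff_of_eq (congrArg (Interlaces (x k)) (lvl_triSnoc_of_lt a b x _ _))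

theorem obpWt_triSnoc (θ : ℝ) {n : ℕ} (a : Fin (n + 2) → ℝ) (b : Fin (n + 1) → ℝ) (x : Tri n) :
    obpWt θ a (triSnoc b x) =
      obpWt θ b x * (vdm b ^ (2 - 2 * θ) * crossProd a b ^ (θ - 1)) := by
  rw [← prod_rpow_eq_vdm_rpow, ← prod_rpow_eq_crossProd_rpow]
  refine (Fin.prod_univ_castSucc (n := n) _).trans ?_
  refine congrArg₂ (· * ·) (Finset.prod_congr rfl fun k _ => ?_) ?_
  · rw [triSnoc_castSucc]
    refine congrArg₂ (· * ·) rfl (Finset.prod_congr rfl fun s _ => Finset.prod_congr rfl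
      fun r _ => ?_)
    exact congrArg (fun v => |v - x k r| ^ (θ - 1)) (congrFun (lvl_triSnoc_of_lt a b x _ _) s)
  · rw [triSnoc_last]
    refine congrArg₂ (· * ·) rfl (Finset.prod_congr rfl fun s _ => Finset.prod_congr rfl
      fun r _ => ?_)
    exact congrArg (fun v => |v - b r| ^ (θ - 1)) (congrFun (lvl_top a (triSnoc b x) _) s)

theorem sumLvl_top {n : ℕ} (a : Fin (n + 1) → ℝ) (x : Tri n) : sumLvl a x (n + 1) = ∑ i, a i := by
  rw [sumLvl, if_neg (by omega), dif_neg (by omega)]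

theorem sumLvl_triSnoc {n : ℕ} (a : Fin (n + 2) → ℝ) (b : Fin (n + 1) → ℝ) (x : Tri n) {k : ℕ}
    (hk : k ≤ n + 1) : sumLvl a (triSnoc b x) k = sumLvl b x k := by
  rcases Nat.eq_zero_or_pos k with rfl | hk0
  · simp [sumLvl]
  · rw [sumLvl, sumLvl, if_neg hk0.ne', if_neg hk0.ne', dif_pos (by omega)]
    rcases Nat.lt_or_ge (k - 1) n with h | h
    · rw [dif_pos (show k - 1 < n + 1 - 1 from h)]
      exact congrArg (fun v => ∑ i, v i) (triSnoc_castSucc b x ⟨k - 1, h⟩)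
    · obtain rfl : k = n + 1 := by omega
      rw [dif_neg (by omega)]
      exact congrArg (fun v => ∑ i, v i) (triSnoc_last b x)

/-- The exponent in the definition of the multivariate Bessel function. -/
def mbfExponent {n : ℕ} (a : Fin (n + 1) → ℝ) (x : Tri n) (y : ℕ → ℝ) : ℝ :=
  ∑ k : Fin (n + 1), y k * (sumLvl a x (k + 1) - sumLvl a x k)

theorem mbfExponent_triSnoc {n : ℕ} (a : Fin (n + 2) → ℝ) (b : Fin (n + 1) → ℝ) (x : Tri n)
    (y : ℕ → ℝ) : mbfExponent a (triSnoc b x) y =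
      mbfExponent b x y + y (n + 1) * (∑ i, a i - ∑ i, b i) := by
  rw [mbfExponent, Fin.sum_univ_castSucc, mbfExponent]
  congr 1
  · refine Finset.sum_congr rfl fun k _ => ?_
    have := k.2
    rw [sumLvl_triSnoc a b x (by simp; omega), sumLvl_triSnoc a b x (by simp)]
    rfl
  · rw [Fin.val_last, sumLvl_top, sumLvl_triSnoc a b x le_rfl, sumLvl_top]

/-- The integrand in the definition of the multivariate Bessel function. -/
def mbfIntegrand (θ : ℝ) {n : ℕ} (a : Fin (n + 1) → ℝ) (x : Tri n) (y : ℕ → ℝ) : ℝ :=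
  Real.exp (mbfExponent a x y) * obpWt θ a x

theorem obpWt_nonneg (θ : ℝ) {N : ℕ} (a : Fin N → ℝ) (x : Tri (N - 1)) : 0 ≤ obpWt θ a x :=
  Finset.prod_nonneg fun k _ => mul_nonneg
    (Finset.prod_nonneg fun i _ => Finset.prod_nonneg fun j _ => by split_ifs <;> positivity)
    (Finset.prod_nonneg fun s _ => Finset.prod_nonneg fun r _ => by positivity)

theorem measurable_lvl {N : ℕ} (a : Fin N → ℝ) {k : ℕ} (hk : k < N) (i : Fin (k + 1)) :
    Measurable fun x : Tri (N - 1) => lvl a x k hk i := by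
  unfold lvl
  split_ifs
  · fun_prop
  · fun_prop

theorem measurable_obpWt (θ : ℝ) {N : ℕ} (a : Fin N → ℝ) : Measurable (obpWt θ a) := by
  unfold obpWt
  refine Finset.measurable_prod _ fun k _ => Measurable.mul ?_ ?_
  · refine Finset.measurable_prod _ fun i _ => Finset.measurable_prod _ fun j _ => ?_
    split_ifs <;> fun_prop
  · refine Finset.measurable_prod _ fun s _ => Finset.measurable_prod _ fun r _ => ?_
    have := measurable_lvl a (k := k.1 + 1) (by have := k.isLt; omega) s
    fun_prop

theorem measurable_sumLvl {N : ℕ} (a : Fin N → ℝ) (k : ℕ) :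
    Measurable fun x : Tri (N - 1) => sumLvl a x k := by
  unfold sumLvl
  split_ifs <;> fun_prop

theorem measurableSet_obpDomain {N : ℕ} (a : Fin N → ℝ) : MeasurableSet (obpDomain a) := by
  refine MeasurableSet.congr (s := ⋂ k : Fin (N - 1), {x : Tri (N - 1) |
    Interlaces (x k) (lvl a x (k.1 + 1) (by have := k.isLt; omega))}) ?_ (by ext; simp [obpDomain])
  refine MeasurableSet.iInter fun k => ?_
  refine measurableSet_interlaces_prod.preimage (f := fun x : Tri (N - 1) =>
    (lvl a x (k.1 + 1) (by have := k.isLt; omega), x k)) ?_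
  exact (measurable_pi_lambda _ fun i => measurable_lvl a _ i).prodMk (measurable_pi_apply k)

theorem measurable_mbfIntegrand (θ : ℝ) {n : ℕ} (a : Fin (n + 1) → ℝ) (y : ℕ → ℝ) :
    Measurable fun x : Tri n => mbfIntegrand θ a x y := by
  have h1 : ∀ k, Measurable fun x : Tri n => sumLvl a x k := measurable_sumLvl a
  have h2 : Measurable fun x : Tri n => obpWt θ a x := measurable_obpWt θ a
  unfold mbfIntegrand mbfExponent
  fun_prop

/-- The normalising constant in the definition of the multivariate Bessel function. -/
def mbfConst (θ : ℝ) (N : ℕ) : ℝ :=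
  (∏ k : Fin N, Real.Gamma ((k.1 + 1) * θ)) / Real.Gamma θ ^ (N * (N + 1) / 2)

theorem mbfConst_nonneg {θ : ℝ} (hθ : 0 < θ) (N : ℕ) : 0 ≤ mbfConst θ N := by
  have := (Real.Gamma_pos_of_pos hθ).le
  exact div_nonneg (Finset.prod_nonneg fun k _ => (Real.Gamma_pos_of_pos (by positivity)).le)
    (by positivity)

theorem mbfConst_succ (θ : ℝ) (n : ℕ) : mbfConst θ (n + 1) =
    mbfConst θ n * (Real.Gamma ((n + 1) * θ) / Real.Gamma θ ^ (n + 1)) := by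
  have h : (n + 1) * (n + 1 + 1) / 2 = n * (n + 1) / 2 + (n + 1) := by
    rw [show (n + 1) * (n + 1 + 1) = n * (n + 1) + (n + 1) * 2 by ring,
      Nat.add_mul_div_right _ _ two_pos]
  rw [mbfConst, mbfConst, Fin.prod_univ_castSucc, h, pow_add, mul_div_mul_comm]
  simp

/-- The interlacing scheme below a top level with `n + 1` entries, as a set of arrays with `n`
levels. -/
def interlacingScheme {n : ℕ} (a : Fin (n + 1) → ℝ) : Set (Tri n) := obpDomain a

theorem measurableSet_interlacingScheme {n : ℕ} (a : Fin (n + 1) → ℝ) :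
    MeasurableSet (interlacingScheme a) :=
  measurableSet_obpDomain a

theorem triSnoc_mem_interlacingScheme {n : ℕ} (a : Fin (n + 2) → ℝ) (b : Fin (n + 1) → ℝ)
    (x : Tri n) :
    triSnoc b x ∈ interlacingScheme a ↔ Interlaces b a ∧ x ∈ interlacingScheme b :=
  triSnoc_mem_obpDomain a b x

/-- The level-by-level recursion computes the integral over the interlacing scheme. -/
theorem corner_eq_lintegral_interlacingScheme {θ : ℝ} (hθ : 0 < θ) {n : ℕ} {a : Fin (n + 1) → ℝ}
    (ha : StrictAnti a) (y : ℕ → ℝ) : corner θ (n + 1) a y =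
      ENNReal.ofReal (mbfConst θ (n + 1) * vdm a ^ (1 - 2 * θ)) *
        ∫⁻ x in interlacingScheme a, ENNReal.ofReal (mbfIntegrand θ a x y) := by
  induction n with
  | zero =>
    have hdom : interlacingScheme a = Set.univ :=
      Set.eq_univ_of_forall fun x k => k.elim0
    have hint : {b : Fin 0 → ℝ | Interlaces b a} = Set.univ :=
      Set.eq_univ_of_forall fun x k => k.elim0
    have hΓ := (Real.Gamma_pos_of_pos hθ).ne'
    have hv : vdm a = 1 := by simp [vdm]
    rw [hdom, Measure.restrict_univ, corner, hint, Measure.restrict_univ, volume_pi, volume_pi,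
      Measure.pi_of_empty, Measure.pi_of_empty, lintegral_dirac, lintegral_dirac, corner, mul_one,
      ← ENNReal.ofReal_mul (by rw [hv, Real.one_rpow, mul_one]; exact mbfConst_nonneg hθ _)]
    congr 1
    rw [dixonDensity, hv, mbfConst, mbfIntegrand, mbfExponent]
    simp [vdm, crossProd, hΓ, sumLvl, obpWt]
  | succ n ih =>
    have hm : Measurable ((interlacingScheme a).indicator
        fun x => ENNReal.ofReal (mbfIntegrand θ a x y)) :=
      (measurable_mbfIntegrand θ a y).ennreal_ofReal.indicator (measurableSet_interlacingScheme a)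
    rw [← lintegral_indicator (measurableSet_interlacingScheme a), lintegral_triSnoc hm,
      ← lintegral_const_mul' _ _ ENNReal.ofReal_ne_top, corner_succ]
    refine lintegral_congr fun b => ?_
    by_cases hb : Interlaces b a
    · have hv := vdm_pos hb.strictAnti.injective
      have hva := vdm_nonneg a
      have hcr := crossProd_nonneg a b
      have hD := dixonDensity_nonneg hθ a b
      rw [ih hb.strictAnti, stepWt, Set.indicator_of_mem (by exact hb),
        ← lintegral_indicator (measurableSet_interlacingScheme b), ← mul_assoc,
        ← lintegral_const_mul' _ _ ENNReal.ofReal_ne_top,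
        ← ENNReal.ofReal_mul (by positivity),
        ← lintegral_const_mul' _ _ ENNReal.ofReal_ne_top]
      refine lintegral_congr fun x => ?_
      by_cases hx : x ∈ interlacingScheme b
      · rw [Set.indicator_of_mem hx,
          Set.indicator_of_mem ((triSnoc_mem_interlacingScheme a b x).2 ⟨hb, hx⟩),
          ← ENNReal.ofReal_mul (mul_nonneg (by positivity)
            (mul_nonneg (mbfConst_nonneg hθ _) (by positivity))),
          ← ENNReal.ofReal_mul (mul_nonneg (mbfConst_nonneg hθ _) (by positivity))]
        congr 1
        have hvb : vdm b ^ (2 - 2 * θ) = vdm b * vdm b ^ (1 - 2 * θ) := by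
          rw [show 2 - 2 * θ = 1 + (1 - 2 * θ) by ring, Real.rpow_add hv, Real.rpow_one]
        rw [mbfIntegrand, mbfIntegrand, mbfExponent_triSnoc, obpWt_triSnoc, Real.exp_add, hvb,
          mbfConst_succ θ (n + 1), dixonDensity]
        ring
      · rw [Set.indicator_of_notMem hx, Set.indicator_of_notMem
          fun h => hx ((triSnoc_mem_interlacingScheme a b x).1 h).2, mul_zero, mul_zero]
    · rw [stepWt, Set.indicator_of_notMem (by exact hb), zero_mul]
      have : ∀ x : Tri n, (interlacingScheme a).indicator
          (fun x => ENNReal.ofReal (mbfIntegrand θ a x y)) (triSnoc b x) = 0 := fun x =>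
        Set.indicator_of_notMem (fun h => hb ((triSnoc_mem_interlacingScheme a b x).1 h).1) _
      simp [this]

/-- At real points, the multivariate Bessel function is given by the level-by-level recursion. -/
theorem MBF_eq_corner {θ : ℝ} (hθ : 0 < θ) {n : ℕ} {a : Fin (n + 1) → ℝ} (ha : StrictAnti a)
    (y : ℕ → ℝ) :
    MBF θ a (fun k => ((y k : ℝ) : ℂ)) = ((corner θ (n + 1) a y).toReal : ℂ) := by
  have h1 : ∀ x : Tri n, Complex.exp (∑ k : Fin (n + 1),
      ((y k : ℝ) : ℂ) * ((sumLvl a x (k.1 + 1) - sumLvl a x k.1 : ℝ) : ℂ)) *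
      ((obpWt θ a x : ℝ) : ℂ) = ((mbfIntegrand θ a x y : ℝ) : ℂ) := fun x => by
    simp [mbfIntegrand, mbfExponent]
  have h2 : ∀ x : Tri n, 0 ≤ mbfIntegrand θ a x y := fun x =>
    mul_nonneg (Real.exp_nonneg _) (obpWt_nonneg θ a x)
  rw [MBF, prod_rpow_eq_vdm_rpow]
  have h3 : ∫ x in interlacingScheme a, Complex.exp (∑ k : Fin (n + 1),
      ((y k : ℝ) : ℂ) * ((sumLvl a x (k.1 + 1) - sumLvl a x k.1 : ℝ) : ℂ)) *
      ((obpWt θ a x : ℝ) : ℂ) =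
      ((∫⁻ x in interlacingScheme a, ENNReal.ofReal (mbfIntegrand θ a x y)).toReal : ℂ) := by
    simp_rw [h1]
    rw [integral_complex_ofReal, integral_eq_lintegral_of_nonneg_ae (ae_of_all _ h2)
      (measurable_mbfIntegrand θ a y).aestronglyMeasurable]
  refine (congrArg (_ * ·) h3).trans ?_
  rw [corner_eq_lintegral_interlacingScheme hθ ha, ENNReal.toReal_mul, ENNReal.toReal_ofReal]
  · rw [Complex.ofReal_mul, Complex.ofReal_mul]
    rfl
  · exact mul_nonneg (mbfConst_nonneg hθ _) (Real.rpow_nonneg (vdm_nonneg a) _)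

theorem prod_abs_prod_erase_sub {n : ℕ} (a : Fin n → ℝ) :
    ∏ i, |∏ j ∈ Finset.univ.erase i, (a i - a j)| = vdm a ^ 2 := by
  have h1 : ∀ i, |∏ j ∈ Finset.univ.erase i, (a i - a j)| =
      (∏ j, if i < j then |a i - a j| else 1) * ∏ j, if j < i then |a j - a i| else 1 := by
    intro i
    rw [Finset.abs_prod, ← Finset.prod_mul_distrib, ← Finset.mul_prod_erase _ _ (Finset.mem_univ i)]
    simp only [lt_irrefl, if_false, one_mul]
    refine Finset.prod_congr rfl fun j hj => ?_
    rcases lt_or_gt_of_ne (Finset.ne_of_mem_erase hj) with h | h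
    · simp [h, h.not_gt, abs_sub_comm]
    · simp [h, h.not_gt]
  simp_rw [h1]
  rw [Finset.prod_mul_distrib, Finset.prod_comm (f := fun i j => if j < i then |a j - a i| else 1),
    sq]
  rfl

theorem vdm_cons {n : ℕ} (t : ℝ) (c : Fin n → ℝ) :
    vdm (Fin.cons t c : Fin (n + 1) → ℝ) = |∏ r, (t - c r)| * vdm c := by
  unfold vdm
  rw [Fin.prod_univ_succ, Finset.abs_prod]
  congr 1
  · rw [Fin.prod_univ_succ]
    simp
  · refine Finset.prod_congr rfl fun i _ => ?_
    rw [Fin.prod_univ_succ]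
    simp

/-- The polynomials `∏ (X - c_r)` and `∏_{r' ≠ r} (X - c_{r'})`, indexed by `0` and `r + 1`. -/
def nodalPoly {n : ℕ} (c : Fin n → ℝ) : Fin (n + 1) → Polynomial ℝ :=
  Fin.cons (∏ r, (Polynomial.X - Polynomial.C (c r)))
    fun r => ∏ r' ∈ Finset.univ.erase r, (Polynomial.X - Polynomial.C (c r'))

theorem natDegree_nodalPoly_lt {n : ℕ} (c : Fin n → ℝ) (k : Fin (n + 1)) :
    (nodalPoly c k).natDegree < n + 1 := by
  refine Fin.cases ?_ (fun r => ?_) k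
  · simp [nodalPoly]
  · have := Finset.card_le_univ (Finset.univ.erase r)
    simp only [nodalPoly, Fin.cons_succ, Polynomial.natDegree_finsetProd_X_sub_C_eq_card]
    simp at this ⊢

theorem of_eval_nodalPoly {n : ℕ} (c : Fin n → ℝ) (x : Fin (n + 1) → ℝ) :
    Matrix.of (fun i k => (nodalPoly c k).eval (x i)) = Matrix.vandermonde x *
      Matrix.of fun (j k : Fin (n + 1)) => (nodalPoly c k).coeff j := by
  ext i k
  rw [Matrix.of_apply, Polynomial.eval_eq_sum_range' (natDegree_nodalPoly_lt c k),
    Matrix.mul_apply, Finset.sum_range]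
  exact Finset.sum_congr rfl fun j _ => by simp [Matrix.vandermonde_apply, mul_comm]

theorem abs_det_eval_nodalPoly {n : ℕ} {c : Fin n → ℝ} (hc : Function.Injective c)
    (a : Fin (n + 1) → ℝ) {t : ℝ} (ht : ∀ r, t ≠ c r) :
    |(Matrix.of fun i k => (nodalPoly c k).eval (a i)).det| = vdm a * vdm c := by
  set x : Fin (n + 1) → ℝ := Fin.cons t c with hx
  have hp : |∏ r, (t - c r)| ≠ 0 :=
    abs_ne_zero.2 (Finset.prod_ne_zero_iff.2 fun r _ => sub_ne_zero.2 (ht r))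
  have hcx := (vdm_pos hc).ne'
  have h1 : |(Matrix.of fun i k => (nodalPoly c k).eval (x i)).det| =
      |∏ r, (t - c r)| * vdm c ^ 2 := by
    rw [Matrix.det_of_isUpperTriangular, Fin.prod_univ_succ, abs_mul, Finset.abs_prod,
      ← prod_abs_prod_erase_sub]
    · simp [nodalPoly, hx, Polynomial.eval_prod]
    · intro i k hik
      obtain ⟨r, rfl⟩ := Fin.exists_succ_eq.2 (Fin.ne_zero_of_lt hik)
      simp only [Matrix.of_apply, hx, Fin.cons_succ]
      refine Fin.cases (fun _ => ?_) (fun r' h => ?_) k hik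
      · simp only [nodalPoly, Fin.cons_zero, Polynomial.eval_prod]
        exact Finset.prod_eq_zero (Finset.mem_univ r) (by simp)
      · simp only [nodalPoly, Fin.cons_succ, Polynomial.eval_prod]
        exact Finset.prod_eq_zero (i := r) (by
          simpa using (Fin.succ_lt_succ_iff.1 h).ne') (by simp)
  rw [of_eval_nodalPoly, Matrix.det_mul, abs_mul, abs_det_vandermonde] at h1 ⊢
  rw [hx, vdm_cons] at h1
  congr 1
  refine mul_left_cancel₀ (mul_ne_zero hp hcx) ?_
  rw [h1]; ring

theorem prod_erase_eq_prod_succAbove {n : ℕ} (f : Fin (n + 1) → ℝ) (i : Fin (n + 1)) :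
    ∏ j ∈ Finset.univ.erase i, f j = ∏ r, f (i.succAbove r) := by
  rw [Fin.univ_succAbove n i, Finset.cons_eq_insert, Finset.erase_insert (by simp), Finset.prod_map,
    Fin.coe_succAboveEmb]

/-- The residues of `∏ (z - b_r) / ∏ (z - a_i)` at the points `a_i`. -/
def residue {n : ℕ} (a : Fin (n + 1) → ℝ) (b : Fin n → ℝ) (i : Fin (n + 1)) : ℝ :=
  (∏ r, (a i - b r)) / ∏ j ∈ Finset.univ.erase i, (a i - a j)

theorem residue_pos {n : ℕ} {a : Fin (n + 1) → ℝ} (ha : StrictAnti a) {b : Fin n → ℝ}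
    (hb : Interlaces b a) (i : Fin (n + 1)) : 0 < residue a b i := by
  rw [residue, prod_erase_eq_prod_succAbove (fun j => a i - a j), ← Finset.prod_div_distrib]
  refine Finset.prod_pos fun r _ => ?_
  rcases lt_or_ge r.castSucc i with h | h
  · have h1 := ha h
    have h2 := ha.antitone (Fin.castSucc_lt_iff_succ_le.1 h)
    have h3 := (hb r).2
    rw [Fin.succAbove_of_castSucc_lt _ _ h]
    exact div_pos_of_neg_of_neg (by linarith) (by linarith)
  · have h1 := ha (Fin.le_castSucc_iff.1 h)
    have h2 := ha.antitone h
    have h3 := (hb r).1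
    rw [Fin.succAbove_of_le_castSucc _ _ h]
    exact div_pos (by linarith) (by linarith)

theorem sum_residue {n : ℕ} {a : Fin (n + 1) → ℝ} (ha : Function.Injective a) (b : Fin n → ℝ) :
    ∑ i, residue a b i = 1 := by
  have hdeg : (∏ r, (Polynomial.X - Polynomial.C (b r))).natDegree = n := by simp
  have hmon : (∏ r, (Polynomial.X - Polynomial.C (b r))).Monic :=
    Polynomial.monic_prod_of_monic _ _ fun r _ => Polynomial.monic_X_sub_C _
  have h := Lagrange.coeff_eq_sum (s := Finset.univ) (v := a) ha.injOn
    (P := ∏ r, (Polynomial.X - Polynomial.C (b r)))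
    (by rw [Polynomial.degree_eq_natDegree hmon.ne_zero, hdeg]
        simpa using by exact_mod_cast n.lt_succ_self)
  rw [Finset.card_univ, Fintype.card_fin, Nat.add_sub_cancel] at h
  simp only [Polynomial.eval_prod, Polynomial.eval_sub, Polynomial.eval_X, Polynomial.eval_C] at h
  unfold residue
  rw [← h]
  exact (congrArg _ hdeg.symm).trans hmon

theorem sum_residue_mul {n : ℕ} {a : Fin (n + 1) → ℝ} (ha : Function.Injective a) (b : Fin n → ℝ) :
    ∑ i, residue a b i * a i = ∑ i, a i - ∑ i, b i := by
  set c : Fin (n + 1) → ℝ := Fin.cons 0 b with hc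
  have hmon : ∀ d : Fin (n + 1) → ℝ, (∏ r, (Polynomial.X - Polynomial.C (d r))).Monic := fun d =>
    Polynomial.monic_prod_of_monic _ _ fun r _ => Polynomial.monic_X_sub_C _
  have hdeg : ∀ d : Fin (n + 1) → ℝ,
      (∏ r, (Polynomial.X - Polynomial.C (d r))).degree = ((n + 1 : ℕ) : WithBot ℕ) := fun d => by
    rw [Polynomial.degree_eq_natDegree (hmon d).ne_zero]
    simp
  have hcoeff : ∀ d : Fin (n + 1) → ℝ,
      (∏ r, (Polynomial.X - Polynomial.C (d r))).coeff n = -∑ i, d i := fun d => by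
    simpa using Polynomial.prod_X_sub_C_coeff_card_pred Finset.univ d (by simp)
  have h := Lagrange.coeff_eq_sum (s := Finset.univ) (v := a) ha.injOn
    (P := ∏ r, (Polynomial.X - Polynomial.C (c r)) - ∏ r, (Polynomial.X - Polynomial.C (a r)))
    ((Polynomial.degree_sub_lt_left ((hdeg c).trans (hdeg a).symm) (hmon c).ne_zero
      ((hmon c).trans (hmon a).symm)).trans_eq (by simp [hdeg]))
  rw [Finset.card_univ, Fintype.card_fin, Nat.add_sub_cancel, Polynomial.coeff_sub, hcoeff,
    hcoeff] at h
  have h0 : ∀ i, ∏ r, (a i - a r) = 0 := fun i =>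
    Finset.prod_eq_zero (Finset.mem_univ i) (sub_self _)
  have hc0 : ∀ i, ∏ r, (a i - c r) = a i * ∏ r, (a i - b r) := fun i => by
    simp [Fin.prod_univ_succ, hc]
  have hcs : ∑ r, c r = ∑ r, b r := by simp [Fin.sum_univ_succ, hc]
  simp only [Polynomial.eval_prod, Polynomial.eval_sub, Polynomial.eval_X, Polynomial.eval_C, h0,
    sub_zero, hc0, hcs] at h
  rw [show ∑ i, a i - ∑ i, b i = -∑ r, b r - -∑ i, a i by ring, h]
  exact Finset.sum_congr rfl fun i _ => by rw [residue]; ring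

/-- The map sending the pair `(g, b)`, encoded as a tuple with first entry `g` and tail `b`, to
`g` times the residues of `∏ (z - b_r) / ∏ (z - a_i)`. -/
def residueMap {n : ℕ} (a : Fin (n + 1) → ℝ) (x : Fin (n + 1) → ℝ) (i : Fin (n + 1)) : ℝ :=
  x 0 * residue a (Fin.tail x) i

/-- The domain of `residueMap`. -/
def residueDomain {n : ℕ} (a : Fin (n + 1) → ℝ) : Set (Fin (n + 1) → ℝ) :=
  {x | 0 < x 0 ∧ Interlaces (Fin.tail x) a}

theorem prod_erase_sub_ne_zero {n : ℕ} {a : Fin n → ℝ} (ha : Function.Injective a) (i : Fin n) :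
    ∏ j ∈ Finset.univ.erase i, (a i - a j) ≠ 0 :=
  Finset.prod_ne_zero_iff.2 fun _ hj => sub_ne_zero.2 (ha.ne (Finset.ne_of_mem_erase hj).symm)

theorem sum_residueMap {n : ℕ} {a : Fin (n + 1) → ℝ} (ha : Function.Injective a)
    (x : Fin (n + 1) → ℝ) : ∑ i, residueMap a x i = x 0 := by
  simp_rw [residueMap, ← Finset.mul_sum, sum_residue ha, mul_one]

theorem degree_nodalPoly_lt {n : ℕ} (c : Fin n → ℝ) (k : Fin (n + 1)) :
    (nodalPoly c k).degree < ((n + 1 : ℕ) : WithBot ℕ) :=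
  Polynomial.degree_le_natDegree.trans_lt (by exact_mod_cast natDegree_nodalPoly_lt c k)

theorem injOn_residueMap {n : ℕ} {a : Fin (n + 1) → ℝ} (ha : StrictAnti a) :
    Set.InjOn (residueMap a) (residueDomain a) := by
  intro x hx x' hx' h
  have h0 : x 0 = x' 0 := by rw [← sum_residueMap ha.injective x, h, sum_residueMap ha.injective]
  have hprod : ∀ i, ∏ r, (a i - Fin.tail x r) = ∏ r, (a i - Fin.tail x' r) := fun i => by
    have := congrFun h i
    rw [residueMap, residueMap, ← h0] at this
    exact (div_left_inj' (prod_erase_sub_ne_zero ha.injective i)).1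
      (mul_left_cancel₀ hx.1.ne' this)
  have hpoly := Polynomial.eq_of_degrees_lt_of_eval_index_eq (Finset.univ) (v := a)
    (f := nodalPoly (Fin.tail x) 0) (g := nodalPoly (Fin.tail x') 0) ha.injective.injOn
    (by simpa using degree_nodalPoly_lt _ _)
    (by simpa using degree_nodalPoly_lt _ _)
    (fun i _ => by simpa [nodalPoly, Polynomial.eval_prod] using hprod i)
  refine funext fun i => Fin.cases h0 (fun r => ?_) i
  have hr : (nodalPoly (Fin.tail x') 0).eval (Fin.tail x r) = 0 := by
    rw [← hpoly, nodalPoly, Fin.cons_zero, Polynomial.eval_prod]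
    exact Finset.prod_eq_zero (Finset.mem_univ r) (by simp)
  rw [nodalPoly, Fin.cons_zero, Polynomial.eval_prod, Finset.prod_eq_zero_iff] at hr
  obtain ⟨r', -, hr'⟩ := hr
  have heq : Fin.tail x r = Fin.tail x' r' := by simpa [sub_eq_zero] using hr'
  have h1 := hx.2 r
  have h2 := hx'.2 r'
  rcases lt_trichotomy r r' with h | rfl | h
  · have := ha.antitone (Fin.castSucc_lt_iff_succ_le.1 (Fin.castSucc_lt_castSucc_iff.2 h))
    linarith
  · exact heq
  · have := ha.antitone (Fin.castSucc_lt_iff_succ_le.1 (Fin.castSucc_lt_castSucc_iff.2 h))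
    linarith

theorem prod_erase_sub_mul_neg {n : ℕ} {a : Fin (n + 1) → ℝ} (ha : StrictAnti a) (r : Fin n) :
    (∏ j ∈ Finset.univ.erase r.castSucc, (a r.castSucc - a j)) *
      ∏ j ∈ Finset.univ.erase r.succ, (a r.succ - a j) < 0 := by
  have hne : r.castSucc ≠ r.succ := (Fin.castSucc_lt_succ).ne
  rw [← Finset.mul_prod_erase _ _ (Finset.mem_erase.2 ⟨hne.symm, Finset.mem_univ r.succ⟩),
    ← Finset.mul_prod_erase _ _ (Finset.mem_erase.2 ⟨hne, Finset.mem_univ r.castSucc⟩),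
    mul_mul_mul_comm, Finset.erase_right_comm, ← Finset.prod_mul_distrib]
  have h0 := ha (Fin.castSucc_lt_succ (i := r))
  refine mul_neg_of_neg_of_pos (mul_neg_of_pos_of_neg (by linarith) (by linarith))
    (Finset.prod_pos fun j hj => ?_)
  have hj1 := Finset.ne_of_mem_erase hj
  have hj2 := Finset.ne_of_mem_erase (Finset.mem_of_mem_erase hj)
  rcases lt_or_gt_of_ne hj1 with h | h
  · have := ha h
    exact mul_pos_of_neg_of_neg (by linarith) (by linarith)
  · have := ha (lt_of_le_of_ne (Fin.castSucc_lt_iff_succ_le.1 h) hj2.symm)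
    exact mul_pos (by linarith) (by linarith)

theorem exists_root_Ioo {f : ℝ → ℝ} (hf : Continuous f) {s t : ℝ} (hst : s < t)
    (h : f s * f t < 0) : ∃ z ∈ Set.Ioo s t, f z = 0 := by
  rcases mul_neg_iff.1 h with ⟨h1, h2⟩ | ⟨h1, h2⟩
  · exact intermediate_value_Ioo' hst.le hf.continuousOn ⟨h2, h1⟩
  · exact intermediate_value_Ioo hst.le hf.continuousOn ⟨h1, h2⟩

theorem image_residueMap {n : ℕ} {a : Fin (n + 1) → ℝ} (ha : StrictAnti a) :
    residueMap a '' residueDomain a = {γ | ∀ i, 0 < γ i} := by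
  refine Set.Subset.antisymm ?_ fun γ hγ => ?_
  · rintro _ ⟨x, hx, rfl⟩ i
    exact mul_pos hx.1 (residue_pos ha hx.2 i)
  set Q : Polynomial ℝ := ∑ i, Polynomial.C (γ i) *
    ∏ j ∈ Finset.univ.erase i, (Polynomial.X - Polynomial.C (a j)) with hQ
  have hQa : ∀ i, Q.eval (a i) = γ i * ∏ j ∈ Finset.univ.erase i, (a i - a j) := fun i => by
    rw [hQ, Polynomial.eval_finsetSum, Finset.sum_eq_single i]
    · simp [Polynomial.eval_prod]
    · intro k _ hk
      rw [Polynomial.eval_mul, Polynomial.eval_prod, Finset.prod_eq_zero (i := i) (by simp [hk.symm])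
        (by simp), mul_zero]
    · simp
  have hQdeg : Q.degree < ((n + 1 : ℕ) : WithBot ℕ) := by
    refine (Polynomial.degree_sum_le _ _).trans_lt ?_
    rw [Finset.sup_lt_iff (by simp)]
    intro i _
    rw [Polynomial.degree_C_mul (hγ i).ne']
    refine Polynomial.degree_le_natDegree.trans_lt ?_
    rw [Polynomial.natDegree_finsetProd_X_sub_C_eq_card]
    simp
    exact_mod_cast n.lt_succ_self
  have hroot : ∀ r : Fin n, ∃ z ∈ Set.Ioo (a r.succ) (a r.castSucc), Q.eval z = 0 := fun r => by
    refine exists_root_Ioo Q.continuous (ha Fin.castSucc_lt_succ) ?_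
    rw [hQa, hQa, mul_mul_mul_comm, mul_comm (∏ j ∈ Finset.univ.erase r.succ, _)]
    exact mul_neg_of_pos_of_neg (mul_pos (hγ _) (hγ _)) (prod_erase_sub_mul_neg ha r)
  choose b hb hbQ using hroot
  have hint : Interlaces b a := fun r => ⟨(hb r).2, (hb r).1⟩
  have hlt : ∀ r, b r < a 0 := fun r => (hb r).2.trans_le (ha.antitone (Fin.zero_le _))
  have hres := residue_pos ha hint
  have hpos : ∏ r, (a 0 - b r) ≠ 0 :=
    Finset.prod_ne_zero_iff.2 fun r _ => sub_ne_zero.2 (hlt r).ne'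
  set g := γ 0 / residue a b 0 with hg
  have hinj : Function.Injective (Fin.cons (a 0) b : Fin (n + 1) → ℝ) :=
    Fin.cons_injective_iff.2 ⟨fun ⟨r, hr⟩ => (hlt r).ne hr, hint.strictAnti.injective⟩
  have hpoly := Polynomial.eq_of_degrees_lt_of_eval_index_eq (Finset.univ)
    (v := (Fin.cons (a 0) b : Fin (n + 1) → ℝ)) (f := Q)
    (g := Polynomial.C g * nodalPoly b 0) hinj.injOn (by simpa using hQdeg)
    (by
      rw [Polynomial.degree_C_mul (div_pos (hγ 0) (hres 0)).ne']
      simpa using degree_nodalPoly_lt b 0)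
    (fun i _ => by
      refine Fin.cases ?_ (fun r => ?_) i
      · simp only [Fin.cons_zero, hQa, nodalPoly, Polynomial.eval_mul, Polynomial.eval_C,
          Polynomial.eval_prod, Polynomial.eval_sub, Polynomial.eval_X, hg, residue]
        field_simp
      · rw [Fin.cons_succ, hbQ, Polynomial.eval_mul, nodalPoly, Fin.cons_zero, Polynomial.eval_prod,
          Finset.prod_eq_zero (Finset.mem_univ r) (by simp), mul_zero])
  refine ⟨Fin.cons g b, ⟨div_pos (hγ 0) (hres 0), by rwa [Fin.tail_cons]⟩, funext fun i => ?_⟩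
  have h := hQa i
  rw [hpoly] at h
  simp only [nodalPoly, Fin.cons_zero, Polynomial.eval_mul, Polynomial.eval_C, Polynomial.eval_prod,
    Polynomial.eval_sub, Polynomial.eval_X] at h
  rw [residueMap, Fin.cons_zero, Fin.tail_cons, residue, ← mul_div_assoc, h,
    mul_div_cancel_right₀ _ (prod_erase_sub_ne_zero ha.injective i)]

/-- The Jacobian matrix of `residueMap`. -/
def residueJacobian {n : ℕ} (a x : Fin (n + 1) → ℝ) : Matrix (Fin (n + 1)) (Fin (n + 1)) ℝ :=
  Matrix.of fun i k => (∏ j ∈ Finset.univ.erase i, (a i - a j))⁻¹ *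
    Matrix.of (fun i k => (Fin.cons 1 (fun _ => -x 0) : Fin (n + 1) → ℝ) k *
      Matrix.of (fun i k => (nodalPoly (Fin.tail x) k).eval (a i)) i k) i k

theorem abs_det_residueJacobian {n : ℕ} {a x : Fin (n + 1) → ℝ} (ha : StrictAnti a)
    (hx : x ∈ residueDomain a) :
    |(residueJacobian a x).det| = x 0 ^ n * vdm (Fin.tail x) / vdm a := by
  have h := (vdm_pos ha.injective).ne'
  have ht : ∀ r, a 0 ≠ Fin.tail x r := fun r =>
    ((hx.2 r).1.trans_le (ha.antitone (Fin.zero_le _))).ne'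
  rw [residueJacobian, Matrix.det_mul_column, Matrix.det_mul_row, abs_mul, abs_mul,
    abs_det_eval_nodalPoly hx.2.strictAnti.injective a ht, Finset.prod_inv_distrib, abs_inv,
    Finset.abs_prod, prod_abs_prod_erase_sub, Fin.prod_univ_succ]
  simp only [Fin.cons_zero, Fin.cons_succ, one_mul, Finset.prod_const, Finset.card_univ,
    Fintype.card_fin, abs_pow, abs_neg, abs_of_pos hx.1]
  field_simp

theorem hasFDerivAt_residueMap {n : ℕ} (a x : Fin (n + 1) → ℝ) :
    HasFDerivAt (residueMap a) (Matrix.toLin' (residueJacobian a x)).toContinuousLinearMap x := by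
  have h1 : HasFDerivAt (fun x : Fin (n + 1) → ℝ => x 0)
      (ContinuousLinearMap.proj (R := ℝ) (φ := fun _ : Fin (n + 1) => ℝ) 0) x :=
    hasFDerivAt_apply 0 x
  have h2 : ∀ i (r : Fin n), HasFDerivAt (fun x : Fin (n + 1) → ℝ => a i - Fin.tail x r)
      (-ContinuousLinearMap.proj (R := ℝ) (φ := fun _ : Fin (n + 1) => ℝ) r.succ) x := fun i r =>
    (hasFDerivAt_apply (𝕜 := ℝ) r.succ x).const_sub (a i)
  have h3 := fun i => (h1.mul (HasFDerivAt.finsetProd (u := Finset.univ)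
    fun r _ => h2 i r)).const_mul (∏ j ∈ Finset.univ.erase i, (a i - a j))⁻¹
  have h4 := hasFDerivAt_pi.2 h3
  refine (h4.congr_fderiv ?_).congr_of_eventuallyEq (Eventually.of_forall fun y => ?_)
  · ext v i
    simp [residueJacobian, Matrix.mulVec, dotProduct, Fin.sum_univ_succ, nodalPoly,
      Polynomial.eval_prod, Finset.mul_sum]
    rw [add_comm]
    simp only [mul_assoc]
  · ext i
    simp only [residueMap, residue, Pi.mul_apply]
    ring

theorem measurableSet_residueDomain {n : ℕ} (a : Fin (n + 1) → ℝ) :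
    MeasurableSet (residueDomain a) :=
  (measurableSet_lt measurable_const (measurable_pi_apply 0)).inter
    ((measurableSet_interlaces a).preimage
      (measurable_pi_lambda _ fun r => measurable_pi_apply r.succ))

/-- The change of variables from the positive orthant to pairs `(g, b)` with `g > 0`, `b ≺ a`. -/
theorem lintegral_pos_orthant {n : ℕ} {a : Fin (n + 1) → ℝ} (ha : StrictAnti a)
    (f : (Fin (n + 1) → ℝ) → ℝ≥0∞) :
    ∫⁻ γ in {γ | ∀ i, 0 < γ i}, f γ = ∫⁻ x in residueDomain a,
      ENNReal.ofReal (x 0 ^ n * vdm (Fin.tail x) / vdm a) * f (residueMap a x) := by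
  rw [← image_residueMap ha, lintegral_image_eq_lintegral_abs_det_fderiv_mul volume
    (measurableSet_residueDomain a) (fun x _ => (hasFDerivAt_residueMap a x).hasFDerivWithinAt)
    (injOn_residueMap ha)]
  refine setLIntegral_congr_fun (measurableSet_residueDomain a) fun x hx => ?_
  rw [← abs_det_residueJacobian ha hx, ← LinearMap.det_toLin']
  rfl

/-- The density of the gamma law with shape `p` and rate `1`. -/
def gammaDens (p t : ℝ) : ℝ≥0∞ :=
  (Set.Ioi 0).indicator (fun t => ENNReal.ofReal (t ^ (p - 1) * Real.exp (-t) / Real.Gamma p)) t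

@[fun_prop]
theorem measurable_gammaDens (p : ℝ) : Measurable (gammaDens p) :=
  Measurable.indicator (by fun_prop) measurableSet_Ioi

theorem lintegral_gammaDens_mul_exp {p c : ℝ} (hp : 0 < p) (hc : c < 1) :
    ∫⁻ t, gammaDens p t * ENNReal.ofReal (Real.exp (c * t)) = ENNReal.ofReal ((1 - c) ^ (-p)) := by
  have hr : 0 < 1 - c := by linarith
  have hΓ := Real.Gamma_pos_of_pos hp
  have h : ∀ᵐ t : ℝ, gammaDens p t * ENNReal.ofReal (Real.exp (c * t)) =
      ENNReal.ofReal ((1 - c) ^ (-p)) * ProbabilityTheory.gammaPDF p (1 - c) t := by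
    filter_upwards [Measure.ae_ne volume (0 : ℝ)] with t ht
    rcases ht.lt_or_gt with h | h
    · rw [gammaDens, Set.indicator_of_notMem (by simpa using h.le),
        ProbabilityTheory.gammaPDF_of_neg h, zero_mul, mul_zero]
    · rw [gammaDens, Set.indicator_of_mem (Set.mem_Ioi.2 h), ProbabilityTheory.gammaPDF_of_nonneg h.le,
        ← ENNReal.ofReal_mul (by positivity), ← ENNReal.ofReal_mul (by positivity)]
      congr 1
      rw [Real.rpow_neg hr.le, show -((1 - c) * t) = -t + c * t by ring, Real.exp_add]
      have := (Real.rpow_pos_of_pos hr p).ne'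
      field_simp
  rw [lintegral_congr_ae h, lintegral_const_mul' _ _ ENNReal.ofReal_ne_top,
    ProbabilityTheory.lintegral_gammaPDF_eq_one hp hr, mul_one]

theorem lintegral_gammaDens {p : ℝ} (hp : 0 < p) : ∫⁻ t, gammaDens p t = 1 := by
  simpa using lintegral_gammaDens_mul_exp hp zero_lt_one

theorem prod_gammaDens_residueMap {θ : ℝ} (hθ : 0 < θ) {n : ℕ} {a : Fin (n + 1) → ℝ}
    (ha : StrictAnti a) {x : Fin (n + 1) → ℝ} (hx : x ∈ residueDomain a) :
    ENNReal.ofReal (x 0 ^ n * vdm (Fin.tail x) / vdm a) * ∏ i, gammaDens θ (residueMap a x i) =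
      gammaDens ((n + 1) * θ) (x 0) * ENNReal.ofReal (dixonDensity θ a (Fin.tail x)) := by
  have hpos : ∀ i, 0 < residueMap a x i := fun i => mul_pos hx.1 (residue_pos ha hx.2 i)
  have hx0 := hx.1
  have hΓ := Real.Gamma_pos_of_pos hθ
  have hΓ' : 0 < Real.Gamma ((n + 1) * θ) := Real.Gamma_pos_of_pos (by positivity)
  have hva := vdm_pos ha.injective
  have hvb := vdm_pos hx.2.strictAnti.injective
  have hcr := crossProd_nonneg a (Fin.tail x)
  have hprod : ∏ i, residueMap a x i =
      x 0 ^ (n + 1) * (crossProd a (Fin.tail x) * (vdm a ^ 2)⁻¹) := by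
    rw [← abs_of_pos (Finset.prod_pos fun i _ => hpos i), Finset.abs_prod]
    simp_rw [residueMap, residue, abs_mul, abs_div, abs_of_pos hx.1]
    rw [Finset.prod_mul_distrib, Finset.prod_div_distrib, prod_abs_prod_erase_sub]
    simp [crossProd, Finset.abs_prod, div_eq_mul_inv]
  have hG : ∏ i, gammaDens θ (residueMap a x i) = ENNReal.ofReal ((x 0 ^ (n + 1) *
      (crossProd a (Fin.tail x) * (vdm a ^ 2)⁻¹)) ^ (θ - 1) *
      Real.exp (-x 0) / Real.Gamma θ ^ (n + 1)) := by
    have : ∀ i, gammaDens θ (residueMap a x i) = ENNReal.ofReal (residueMap a x i ^ (θ - 1) *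
        Real.exp (-residueMap a x i) / Real.Gamma θ) := fun i => Set.indicator_of_mem (hpos i) _
    simp_rw [this]
    rw [← ENNReal.ofReal_prod_of_nonneg fun i _ => by have := hpos i; positivity,
      Finset.prod_div_distrib, Finset.prod_mul_distrib,
      Real.finsetProd_rpow _ _ fun i _ => (hpos i).le, hprod, ← Real.exp_sum,
      Finset.sum_neg_distrib, sum_residueMap ha.injective]
    simp
  rw [hG, gammaDens, Set.indicator_of_mem (Set.mem_Ioi.2 hx0), ← ENNReal.ofReal_mul (by positivity),
    ← ENNReal.ofReal_mul (by positivity)]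
  congr 1
  have h1 : x 0 ^ ((n + 1) * θ - 1) = x 0 ^ n * (x 0 ^ (n + 1)) ^ (θ - 1) := by
    rw [← Real.rpow_natCast (x 0) (n + 1), ← Real.rpow_mul hx.1.le, ← Real.rpow_natCast,
      ← Real.rpow_add hx.1]
    congr 1
    push_cast
    ring
  have h2 : ((vdm a ^ 2)⁻¹) ^ (θ - 1) = vdm a * vdm a ^ (1 - 2 * θ) := by
    rw [Real.inv_rpow (by positivity), ← Real.rpow_natCast, ← Real.rpow_mul hva.le,
      ← Real.rpow_neg hva.le]
    nth_rewrite 2 [← Real.rpow_one (vdm a)]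
    rw [← Real.rpow_add hva]
    congr 1
    push_cast
    ring
  rw [dixonDensity, h1, Real.mul_rpow (by positivity) (by positivity),
    Real.mul_rpow (by positivity) (by positivity), h2]
  field_simp

theorem lintegral_fin_cons {n : ℕ} {f : (Fin (n + 1) → ℝ) → ℝ≥0∞} (hf : Measurable f) :
    ∫⁻ x, f x = ∫⁻ g : ℝ, ∫⁻ b : Fin n → ℝ, f (Fin.cons g b) := by
  have hm := (volume_preserving_piFinSuccAbove (fun _ : Fin (n + 1) => ℝ) 0).symm
  rw [← hm.lintegral_comp_emb (MeasurableEquiv.measurableEmbedding _), Measure.volume_eq_prod,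
    lintegral_prod _ (by fun_prop)]
  refine lintegral_congr fun g => lintegral_congr fun b => ?_
  congr 1
  simp [MeasurableEquiv.piFinSuccAbove_symm_apply, Fin.insertNthEquiv]

theorem stepWt_ne_top (θ s : ℝ) {n : ℕ} (a : Fin (n + 1) → ℝ) (b : Fin n → ℝ) :
    stepWt θ s a b ≠ ∞ := by
  by_cases h : Interlaces b a <;> simp [stepWt, h]

/-- The Dixon–Anderson integral: a vector of independent gamma variables is the product of an
independent gamma variable and the residue vector of a tuple with the Dixon–Anderson density. -/
theorem lintegral_prod_gammaDens {θ : ℝ} (hθ : 0 < θ) {n : ℕ} {a : Fin (n + 1) → ℝ}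
    (ha : StrictAnti a) {f : (Fin (n + 1) → ℝ) → ℝ≥0∞} (hf : Measurable f) :
    ∫⁻ γ, (∏ i, gammaDens θ (γ i)) * f γ = ∫⁻ b, stepWt θ 0 a b *
      ∫⁻ g, gammaDens ((n + 1) * θ) g * f fun i => g * residue a b i := by
  have hpos : MeasurableSet {γ : Fin (n + 1) → ℝ | ∀ i, 0 < γ i} :=
    MeasurableSet.congr (s := ⋂ i, {γ : Fin (n + 1) → ℝ | 0 < γ i}) (MeasurableSet.iInter fun i =>
      measurableSet_lt measurable_const (measurable_pi_apply i)) (by ext; simp)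
  have hres : Measurable fun z : ℝ × (Fin n → ℝ) => fun i => z.1 * residue a z.2 i := by
    unfold residue
    fun_prop
  have hstep : Measurable fun b : Fin n → ℝ => stepWt θ 0 a b :=
    (measurable_stepWt θ 0).comp measurable_prodMk_left
  have htail : Measurable (Fin.tail : (Fin (n + 1) → ℝ) → Fin n → ℝ) :=
    measurable_pi_lambda _ fun r => measurable_pi_apply r.succ
  have h1 : ∫⁻ γ, (∏ i, gammaDens θ (γ i)) * f γ =
      ∫⁻ γ in {γ | ∀ i, 0 < γ i}, (∏ i, gammaDens θ (γ i)) * f γ := by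
    rw [← lintegral_indicator hpos]
    refine lintegral_congr fun γ => ?_
    by_cases hγ : ∀ i, 0 < γ i
    · rw [Set.indicator_of_mem (by exact hγ)]
    · rw [Set.indicator_of_notMem (by exact hγ)]
      obtain ⟨i, hi⟩ := not_forall.1 hγ
      rw [Finset.prod_eq_zero (Finset.mem_univ i) (Set.indicator_of_notMem hi _), zero_mul]
  have h2 : ∀ x : Fin (n + 1) → ℝ, (residueDomain a).indicator (fun x =>
      ENNReal.ofReal (x 0 ^ n * vdm (Fin.tail x) / vdm a) *
        ((∏ i, gammaDens θ (residueMap a x i)) * f (residueMap a x))) x =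
      stepWt θ 0 a (Fin.tail x) * (gammaDens ((n + 1) * θ) (x 0) *
        f fun i => x 0 * residue a (Fin.tail x) i) := by
    intro x
    by_cases hx : x ∈ residueDomain a
    · rw [Set.indicator_of_mem hx, ← mul_assoc, prod_gammaDens_residueMap hθ ha hx, stepWt,
        Set.indicator_of_mem (by exact hx.2), zero_mul, Real.exp_zero, mul_one, mul_right_comm,
        mul_comm]
      rfl
    · rw [Set.indicator_of_notMem hx]
      by_cases h0 : 0 < x 0
      · rw [stepWt, Set.indicator_of_notMem (fun h => hx ⟨h0, h⟩), zero_mul]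
      · rw [gammaDens, Set.indicator_of_notMem (s := Set.Ioi (0 : ℝ)) h0, zero_mul, mul_zero]
  have h3 : Measurable fun z : ℝ × (Fin n → ℝ) => stepWt θ 0 a z.2 *
      (gammaDens ((n + 1) * θ) z.1 * f fun i => z.1 * residue a z.2 i) :=
    (hstep.comp measurable_snd).mul
      (((measurable_gammaDens _).comp measurable_fst).mul (hf.comp hres))
  have h4 : Measurable fun x : Fin (n + 1) → ℝ => stepWt θ 0 a (Fin.tail x) *
      (gammaDens ((n + 1) * θ) (x 0) * f fun i => x 0 * residue a (Fin.tail x) i) :=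
    h3.comp ((measurable_pi_apply 0).prodMk htail)
  rw [h1, lintegral_pos_orthant ha, ← lintegral_indicator (measurableSet_residueDomain a),
    lintegral_congr h2, lintegral_fin_cons h4]
  simp only [Fin.cons_zero, Fin.tail_cons]
  rw [lintegral_lintegral_swap h3.aemeasurable]
  exact lintegral_congr fun b => lintegral_const_mul' _ _ (stepWt_ne_top θ 0 a b)

/-- The law of `n` independent gamma variables with shape `θ`. -/
def gammaPi (θ : ℝ) (n : ℕ) : Measure (Fin n → ℝ) :=
  volume.withDensity fun γ => ∏ i, gammaDens θ (γ i)

/-- The mean of the values `x` with weights `γ`. -/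
def wmean {n : ℕ} (γ x : Fin n → ℝ) : ℝ := (∑ i, γ i * x i) / ∑ i, γ i

@[fun_prop]
theorem measurable_wmean {n : ℕ} (x : Fin n → ℝ) : Measurable fun γ => wmean γ x := by
  unfold wmean
  fun_prop

theorem mul_wmean {n : ℕ} (s : ℝ) (γ x : Fin n → ℝ) :
    s * wmean γ x = wmean γ fun i => s * x i := by
  simp_rw [wmean, mul_left_comm _ s]
  rw [← Finset.mul_sum, mul_div_assoc]

theorem measurable_prod_gammaDens (θ : ℝ) (n : ℕ) :
    Measurable fun γ : Fin n → ℝ => ∏ i, gammaDens θ (γ i) :=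
  Finset.measurable_prod _ fun i _ => (measurable_gammaDens θ).comp (measurable_pi_apply i)

theorem lintegral_gammaPi (θ : ℝ) {n : ℕ} {f : (Fin n → ℝ) → ℝ≥0∞} (hf : Measurable f) :
    ∫⁻ γ, f γ ∂gammaPi θ n = ∫⁻ γ, (∏ i, gammaDens θ (γ i)) * f γ :=
  lintegral_withDensity_eq_lintegral_mul _ (measurable_prod_gammaDens θ n) hf

theorem ae_gammaPi_pos (θ : ℝ) (n : ℕ) : ∀ᵐ γ ∂gammaPi θ n, ∀ i, 0 < γ i := by
  rw [gammaPi, ae_withDensity_iff (measurable_prod_gammaDens θ n)]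
  refine Eventually.of_forall fun γ hγ i => ?_
  by_contra h
  exact hγ (Finset.prod_eq_zero (Finset.mem_univ i)
    (Set.indicator_of_notMem (s := Set.Ioi (0 : ℝ)) h _))

theorem lintegral_gammaPi_tail {θ : ℝ} (hθ : 0 < θ) {n : ℕ} {f : (Fin n → ℝ) → ℝ≥0∞}
    (hf : Measurable f) :
    ∫⁻ γ, f (Fin.tail γ) ∂gammaPi θ (n + 1) = ∫⁻ γ, f γ ∂gammaPi θ n := by
  have htail : Measurable (Fin.tail : (Fin (n + 1) → ℝ) → Fin n → ℝ) :=
    measurable_pi_lambda _ fun r => measurable_pi_apply r.succ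
  have h := measurable_prod_gammaDens θ n
  rw [lintegral_gammaPi θ (f := fun γ => f (Fin.tail γ)) (hf.comp htail), lintegral_gammaPi θ hf,
    lintegral_fin_cons (f := fun γ => (∏ i, gammaDens θ (γ i)) * f (Fin.tail γ))
      ((measurable_prod_gammaDens θ _).mul (hf.comp htail))]
  simp only [Fin.prod_univ_succ, Fin.cons_zero, Fin.cons_succ, Fin.tail_cons, mul_assoc]
  have h' : ∀ g : ℝ, ∫⁻ b : Fin n → ℝ, gammaDens θ g * ((∏ i, gammaDens θ (b i)) * f b) =
      gammaDens θ g * ∫⁻ b : Fin n → ℝ, (∏ i, gammaDens θ (b i)) * f b := fun g =>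
    lintegral_const_mul _ (h.mul hf)
  simp_rw [h']
  rw [lintegral_mul_const _ (measurable_gammaDens θ), lintegral_gammaDens hθ, one_mul]

theorem lintegral_gammaPi_exp_wmean {θ : ℝ} (hθ : 0 < θ) {n : ℕ} {a : Fin (n + 1) → ℝ}
    (ha : StrictAnti a) (x : Fin (n + 1) → ℝ) :
    ∫⁻ γ, ENNReal.ofReal (Real.exp (wmean γ x)) ∂gammaPi θ (n + 1) =
      ∫⁻ b, stepWt θ 0 a b * ENNReal.ofReal (Real.exp (∑ i, residue a b i * x i)) := by
  rw [lintegral_gammaPi θ (by fun_prop), lintegral_prod_gammaDens hθ ha (by fun_prop)]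
  refine lintegral_congr fun b => ?_
  congr 1
  have h : ∀ g : ℝ, gammaDens ((n + 1) * θ) g *
      ENNReal.ofReal (Real.exp (wmean (fun i => g * residue a b i) x)) =
      gammaDens ((n + 1) * θ) g * ENNReal.ofReal (Real.exp (∑ i, residue a b i * x i)) := by
    intro g
    by_cases hg : 0 < g
    · rw [wmean, ← Finset.mul_sum, sum_residue ha.injective]
      simp_rw [mul_assoc]
      rw [← Finset.mul_sum, mul_one, mul_div_cancel_left₀ _ hg.ne']
    · rw [gammaDens, Set.indicator_of_notMem (s := Set.Ioi (0 : ℝ)) hg, zero_mul, zero_mul]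
  simp_rw [h]
  rw [lintegral_mul_const _ (measurable_gammaDens _), lintegral_gammaDens (by positivity), one_mul]

theorem stepWt_eq_mul_exp {θ : ℝ} (hθ : 0 < θ) (s : ℝ) {n : ℕ} (a : Fin (n + 1) → ℝ)
    (b : Fin n → ℝ) :
    stepWt θ s a b = stepWt θ 0 a b * ENNReal.ofReal (Real.exp (s * (∑ i, a i - ∑ i, b i))) := by
  by_cases h : Interlaces b a
  · simp [stepWt, h, ENNReal.ofReal_mul (dixonDensity_nonneg hθ a b)]
  · simp [stepWt, h]

theorem lintegral_stepWt {θ : ℝ} (hθ : 0 < θ) (s : ℝ) {n : ℕ} {a : Fin (n + 1) → ℝ}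
    (ha : StrictAnti a) :
    ∫⁻ b, stepWt θ s a b =
      ∫⁻ γ, ENNReal.ofReal (Real.exp (s * wmean γ a)) ∂gammaPi θ (n + 1) := by
  have h := lintegral_gammaPi_exp_wmean hθ ha fun i => s * a i
  simp_rw [← mul_wmean] at h
  rw [h]
  refine lintegral_congr fun b => ?_
  rw [stepWt_eq_mul_exp hθ s]
  simp_rw [mul_left_comm _ s]
  rw [← Finset.mul_sum, sum_residue_mul ha.injective]

theorem lintegral_stepWt_zero {θ : ℝ} (hθ : 0 < θ) {n : ℕ} {a : Fin (n + 1) → ℝ}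
    (ha : StrictAnti a) : ∫⁻ b, stepWt θ 0 a b = 1 := by
  rw [lintegral_stepWt hθ 0 ha, lintegral_gammaPi θ (by fun_prop)]
  simp only [zero_mul, Real.exp_zero, ENNReal.ofReal_one, mul_one]
  have := lintegral_pi_prod (fun _ : Fin (n + 1) => gammaDens θ) fun _ => measurable_gammaDens θ
  simpa [lintegral_gammaDens hθ] using this

theorem exp_le_one_sub_div_rpow {p z : ℝ} (hp : 0 < p) (hz : z < p) :
    Real.exp z ≤ (1 - z / p) ^ (-p) := by
  have h : 0 < 1 - z / p := by rw [sub_pos, div_lt_one hp]; exact hz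
  rw [Real.rpow_def_of_pos h, Real.exp_le_exp]
  have h1 := Real.log_le_sub_one_of_pos h
  have h2 : z / p * p = z := div_mul_cancel₀ _ hp.ne'
  nlinarith

theorem one_sub_rpow_neg_le_exp {θ u : ℝ} (hθ : 0 < θ) (hu : |u| ≤ 1 / 2) :
    (1 - u) ^ (-θ) ≤ Real.exp (θ * (u + 2 * u ^ 2)) := by
  have h1 : 0 < 1 - u := by linarith [le_abs_self u]
  have h2 := Real.abs_log_sub_add_sum_range_le (x := u) (by linarith) 1
  have h3 : |u| ^ 2 / (1 - |u|) ≤ 2 * u ^ 2 := by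
    rw [div_le_iff₀ (by linarith), sq_abs]
    nlinarith [sq_nonneg u]
  simp only [Finset.range_one, Finset.sum_singleton, Nat.cast_zero, zero_add, pow_one, div_one] at h2
  rw [Real.rpow_def_of_pos h1, Real.exp_le_exp]
  have := (abs_le.1 (h2.trans h3)).1
  nlinarith

/-- The Laplace transform of a Dirichlet mean is dominated by that of the corresponding combination
of independent gamma variables. -/
theorem lintegral_gammaPi_exp_wmean_le {θ : ℝ} (hθ : 0 < θ) {n : ℕ} {x : Fin (n + 1) → ℝ}
    (hx : ∀ i, |x i / ((n + 1) * θ)| ≤ 1 / 2) :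
    ∫⁻ γ, ENNReal.ofReal (Real.exp (wmean γ x)) ∂gammaPi θ (n + 1) ≤
      ENNReal.ofReal (Real.exp (θ * ∑ i, (x i / ((n + 1) * θ) + 2 * (x i / ((n + 1) * θ)) ^ 2))) := by
  have hp : 0 < (n + 1) * θ := by positivity
  set p := (n + 1) * θ with hpdef
  have ha : StrictAnti fun i : Fin (n + 1) => -(i : ℝ) := fun i j h => by
    simpa using h
  rw [lintegral_gammaPi_exp_wmean hθ ha]
  calc _ ≤ ∫⁻ b, stepWt θ 0 (fun i : Fin (n + 1) => -(i : ℝ)) b *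
        ∫⁻ g, gammaDens p g * ENNReal.ofReal
          (Real.exp (∑ i, (g * residue (fun i : Fin (n + 1) => -(i : ℝ)) b i) * (x i / p))) := by
        refine lintegral_mono fun b => ?_
        by_cases hb : Interlaces b fun i : Fin (n + 1) => -(i : ℝ)
        · refine mul_le_mul_right ?_ _
          set z := ∑ i, residue (fun i : Fin (n + 1) => -(i : ℝ)) b i * x i with hz
          have hzp : ∀ g : ℝ, ∑ i, (g * residue (fun i : Fin (n + 1) => -(i : ℝ)) b i) * (x i / p) =
              z / p * g := fun g => by
            rw [hz, Finset.sum_div, Finset.sum_mul]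
            exact Finset.sum_congr rfl fun i _ => by ring
          have hlt : z < p := by
            have h1 : z ≤ ∑ i, residue (fun i : Fin (n + 1) => -(i : ℝ)) b i * (p / 2) :=
              Finset.sum_le_sum fun i _ => mul_le_mul_of_nonneg_left (by
                have := (abs_le.1 (hx i)).2
                rw [div_le_iff₀ hp] at this
                linarith) (residue_pos ha hb i).le
            rw [← Finset.sum_mul, sum_residue ha.injective] at h1
            linarith
          simp_rw [hzp]
          rw [lintegral_gammaDens_mul_exp hp ((div_lt_one hp).2 hlt)]
          exact ENNReal.ofReal_le_ofReal (exp_le_one_sub_div_rpow hp hlt)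
        · simp [stepWt, hb]
    _ = ∫⁻ γ : Fin (n + 1) → ℝ, ∏ i, (gammaDens θ (γ i) *
          ENNReal.ofReal (Real.exp (x i / p * γ i))) := by
        rw [← lintegral_prod_gammaDens hθ ha (f := fun γ => ENNReal.ofReal
          (Real.exp (∑ i, γ i * (x i / p)))) (by fun_prop)]
        refine lintegral_congr fun γ => ?_
        rw [Finset.prod_mul_distrib, ← ENNReal.ofReal_prod_of_nonneg fun i _ => (Real.exp_pos _).le,
          ← Real.exp_sum]
        simp_rw [mul_comm]
    _ = ∏ i, ENNReal.ofReal ((1 - x i / p) ^ (-θ)) := by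
        rw [lintegral_pi_prod (fun i t => gammaDens θ t * ENNReal.ofReal (Real.exp (x i / p * t)))
          fun i => by fun_prop]
        refine Finset.prod_congr rfl fun i _ => lintegral_gammaDens_mul_exp hθ ?_
        linarith [(abs_le.1 (hx i)).2]
    _ ≤ ∏ i, ENNReal.ofReal (Real.exp (θ * (x i / p + 2 * (x i / p) ^ 2))) :=
        Finset.prod_le_prod' fun i _ => ENNReal.ofReal_le_ofReal (one_sub_rpow_neg_le_exp hθ (hx i))
    _ = _ := by
        rw [← ENNReal.ofReal_prod_of_nonneg fun i _ => (Real.exp_pos _).le, ← Real.exp_sum,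
          Finset.mul_sum]

/-- The tuple `a` has entries of size at most `L` and the modulus of its sum is at most `t * L`. -/
def SizeBound {n : ℕ} (L t : ℝ) (a : Fin n → ℝ) : Prop :=
  (∀ i, |a i| ≤ L) ∧ |∑ i, a i| ≤ t * L

theorem SizeBound.of_interlaces {n : ℕ} {L t : ℝ} {a : Fin (n + 1) → ℝ} (ha : StrictAnti a)
    {b : Fin n → ℝ} (hb : Interlaces b a) (h : SizeBound L t a) : SizeBound L (t + 1) b := by
  refine ⟨fun i => ?_, ?_⟩
  · have h1 := abs_le.1 (h.1 i.castSucc)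
    have h2 := abs_le.1 (h.1 i.succ)
    have h3 := hb i
    exact abs_le.2 ⟨by linarith, by linarith⟩
  · have h1 : |∑ i, residue a b i * a i| ≤ L := by
      calc _ ≤ ∑ i, |residue a b i * a i| := Finset.abs_sum_le_sum_abs _ _
        _ ≤ ∑ i, residue a b i * L := Finset.sum_le_sum fun i _ => by
            rw [abs_mul, abs_of_pos (residue_pos ha hb i)]
            exact mul_le_mul_of_nonneg_left (h.1 i) (residue_pos ha hb i).le
        _ = L := by rw [← Finset.sum_mul, sum_residue ha.injective, one_mul]
    rw [sum_residue_mul ha.injective] at h1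
    have h2 := abs_le.1 h1
    have h3 := abs_le.1 h.2
    exact abs_le.2 ⟨by linarith, by linarith⟩

theorem lintegral_gammaPi_exp_mul_wmean_le {θ : ℝ} (hθ : 0 < θ) {n : ℕ} {L t s : ℝ}
    {a : Fin (n + 1) → ℝ} (h : SizeBound L t a) (hs : |s| * L / ((n + 1) * θ) ≤ 1 / 2) :
    ∫⁻ γ, ENNReal.ofReal (Real.exp (s * wmean γ a)) ∂gammaPi θ (n + 1) ≤
      ENNReal.ofReal (Real.exp (θ * (t * (|s| * L / ((n + 1) * θ)) +
        2 * (n + 1) * (|s| * L / ((n + 1) * θ)) ^ 2))) := by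
  have hp : 0 < (n + 1) * θ := by positivity
  have h2 : ∀ i, |s * a i / ((n + 1) * θ)| ≤ |s| * L / ((n + 1) * θ) := fun i => by
    rw [abs_div, abs_mul, abs_of_pos hp]
    gcongr
    exact h.1 i
  simp_rw [mul_wmean]
  refine (lintegral_gammaPi_exp_wmean_le hθ fun i => (h2 i).trans hs).trans
    (ENNReal.ofReal_le_ofReal (Real.exp_le_exp.2 (mul_le_mul_of_nonneg_left ?_ hθ.le)))
  rw [Finset.sum_add_distrib]
  refine add_le_add ?_ ?_
  · rw [← Finset.sum_div, ← Finset.mul_sum]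
    calc _ ≤ |s * ∑ i, a i| / ((n + 1) * θ) := by gcongr; exact le_abs_self _
      _ ≤ |s| * (t * L) / ((n + 1) * θ) := by rw [abs_mul]; gcongr; exact h.2
      _ = _ := by ring
  · calc _ ≤ ∑ i : Fin (n + 1), 2 * (|s| * L / ((n + 1) * θ)) ^ 2 :=
          Finset.sum_le_sum fun i _ => by
            rw [← sq_abs (s * a i / _)]
            gcongr
            exact h2 i
      _ = _ := by simp; ring

/-- A bound for the distance of the entries of `b` to the entries of `a` below them, when `b ≺ a`,
preceded by `2 * L`. -/
def gapVec {n : ℕ} (L : ℝ) (a : Fin (n + 1) → ℝ) (b : Fin n → ℝ) : Fin (n + 1) → ℝ :=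
  Fin.cons (2 * L) fun i => b i - a i.succ

theorem gapVec_nonneg {n : ℕ} {L : ℝ} {a : Fin (n + 1) → ℝ} {b : Fin n → ℝ} (hb : Interlaces b a)
    (hL : 0 < L) (i : Fin (n + 1)) : 0 ≤ gapVec L a b i := by
  refine Fin.cases ?_ (fun i => ?_) i
  · simpa [gapVec] using hL.le
  · simpa [gapVec] using (hb i).2.le

theorem sum_gapVec_le {n : ℕ} {L t : ℝ} {a : Fin (n + 1) → ℝ} {b : Fin n → ℝ}
    (hb : Interlaces b a) (h : SizeBound L t a) : ∑ i, gapVec L a b i ≤ 4 * L := by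
  have h1 : ∑ i, (b i - a i.succ) ≤ ∑ i : Fin n, (a i.castSucc - a i.succ) :=
    Finset.sum_le_sum fun i _ => by linarith [(hb i).1]
  have h2 : ∑ i : Fin n, (a i.castSucc - a i.succ) = a 0 - a (Fin.last n) := by
    have h3 := Fin.sum_univ_succ a
    have h4 := Fin.sum_univ_castSucc a
    rw [Finset.sum_sub_distrib]
    linarith
  have h3 := abs_le.1 (h.1 0)
  have h4 := abs_le.1 (h.1 (Fin.last n))
  simp only [gapVec, Fin.sum_univ_succ, Fin.cons_zero, Fin.cons_succ]
  linarith

theorem abs_wmean_sub_wmean_tail_le {n : ℕ} {L t : ℝ} {a : Fin (n + 2) → ℝ} {b : Fin (n + 1) → ℝ}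
    (ha : StrictAnti a) (hb : Interlaces b a) (h : SizeBound L t a) {γ : Fin (n + 2) → ℝ}
    (hγ : ∀ i, 0 < γ i) :
    |wmean γ a - wmean (Fin.tail γ) b| ≤ wmean γ (gapVec L a b) := by
  have hb' := (h.of_interlaces ha hb).1
  have hS : 0 < ∑ i, Fin.tail γ i := Finset.sum_pos (fun i _ => hγ i.succ) Finset.univ_nonempty
  have hγ0 := hγ 0
  set v := wmean (Fin.tail γ) b with hv
  have hvS : v * ∑ i, Fin.tail γ i = ∑ i, Fin.tail γ i * b i := div_mul_cancel₀ _ hS.ne'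
  have hvL : |v| ≤ L := by
    rw [hv, wmean, abs_div, abs_of_pos hS, div_le_iff₀ hS]
    calc _ ≤ ∑ i, |Fin.tail γ i * b i| := Finset.abs_sum_le_sum_abs _ _
      _ ≤ ∑ i, Fin.tail γ i * L := Finset.sum_le_sum fun i _ => by
          rw [abs_mul, Fin.tail, abs_of_pos (hγ i.succ)]
          exact mul_le_mul_of_nonneg_left (hb' i) (hγ i.succ).le
      _ = _ := by rw [← Finset.sum_mul, mul_comm]
  have hT : ∑ i, γ i = γ 0 + ∑ i, Fin.tail γ i := Fin.sum_univ_succ γ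
  have hTpos : 0 < ∑ i, γ i := by rw [hT]; positivity
  have h1 : wmean γ a - v = (γ 0 * (a 0 - v) - ∑ i, Fin.tail γ i * (b i - a i.succ)) / ∑ i, γ i := by
    rw [eq_div_iff hTpos.ne', sub_mul, wmean, div_mul_cancel₀ _ hTpos.ne', hT, mul_add, hvS,
      Fin.sum_univ_succ]
    simp_rw [mul_sub, Finset.sum_sub_distrib, Fin.tail]
    ring
  have h2 : ∑ i, γ i * gapVec L a b i = γ 0 * (2 * L) + ∑ i, Fin.tail γ i * (b i - a i.succ) := by
    rw [Fin.sum_univ_succ]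
    rfl
  have h3 : 0 ≤ ∑ i, Fin.tail γ i * (b i - a i.succ) :=
    Finset.sum_nonneg fun i _ => mul_nonneg (hγ i.succ).le (by linarith [(hb i).2])
  have h4 := abs_le.1 (h.1 0)
  have h5 := abs_le.1 hvL
  rw [h1, wmean, abs_div, abs_of_pos hTpos, h2]
  gcongr
  exact abs_le.2 ⟨by nlinarith, by nlinarith⟩

theorem lintegral_gammaPi_exp_gapVec_le {θ : ℝ} (hθ : 0 < θ) {n : ℕ} {L t : ℝ} (hL : 0 < L)
    {a : Fin (n + 1) → ℝ} {b : Fin n → ℝ} (hb : Interlaces b a) (h : SizeBound L t a) :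
    ∫⁻ γ, ENNReal.ofReal (Real.exp ((n + 1) * θ / (4 * L) * wmean γ (gapVec L a b)))
      ∂gammaPi θ (n + 1) ≤ ENNReal.ofReal (Real.exp (2 * θ)) := by
  have hp : 0 < (n + 1) * θ := by positivity
  have h0 := gapVec_nonneg hb hL
  have h2 : ∀ i, (n + 1) * θ / (4 * L) * gapVec L a b i / ((n + 1) * θ) = gapVec L a b i / (4 * L) :=
    fun i => by field_simp
  have h3 : ∀ i, gapVec L a b i ≤ 2 * L := fun i => by
    refine Fin.cases ?_ (fun i => ?_) i
    · simp [gapVec]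
    · simp only [gapVec, Fin.cons_succ]
      linarith [(abs_le.1 (h.1 i.castSucc)).2, (abs_le.1 (h.1 i.succ)).1, (hb i).1]
  have h4 : ∀ i, gapVec L a b i / (4 * L) ≤ 1 / 2 := fun i => by
    rw [div_le_iff₀ (by positivity)]
    linarith [h3 i]
  have h5 : ∀ i, 0 ≤ gapVec L a b i / (4 * L) := fun i => div_nonneg (h0 i) (by positivity)
  simp_rw [mul_wmean]
  refine (lintegral_gammaPi_exp_wmean_le hθ fun i => ?_).trans
    (ENNReal.ofReal_le_ofReal (Real.exp_le_exp.2 ?_))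
  · rw [h2, abs_of_nonneg (h5 i)]
    exact h4 i
  · rw [mul_comm 2]
    refine mul_le_mul_of_nonneg_left ?_ hθ.le
    simp_rw [h2]
    calc _ ≤ ∑ i, 2 * (gapVec L a b i / (4 * L)) :=
          Finset.sum_le_sum fun i _ => by nlinarith [h4 i, h5 i]
      _ ≤ 2 := by
          rw [← Finset.mul_sum, ← Finset.sum_div]
          have : (∑ i, gapVec L a b i) / (4 * L) ≤ 1 := by
            rw [div_le_one (by positivity)]
            exact sum_gapVec_le hb h
          linarith

theorem exp_sub_exp_le {X Y s D l : ℝ} (h : |X - Y| ≤ |s| * D) (hD : 0 ≤ D) (hl : 0 < l) :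
    Real.exp X ≤ Real.exp Y +
      |s| * ((l ^ 2)⁻¹ * Real.exp (l * D) + Real.exp (2 * X) + Real.exp (2 * Y)) := by
  have h1 : Real.exp X - Real.exp Y ≤ |s| * D * (Real.exp X + Real.exp Y) := by
    have h2 : Real.exp X * (1 - (X - Y)) ≤ Real.exp Y := by
      have := mul_le_mul_of_nonneg_left (Real.add_one_le_exp (Y - X)) (Real.exp_pos X).le
      rw [← Real.exp_add] at this
      ring_nf at this ⊢
      exact this
    have h3 := le_abs_self (X - Y)
    have h4 := Real.exp_pos X
    have h5 := Real.exp_pos Y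
    have h6 : 0 ≤ |s| * D := by positivity
    nlinarith
  have h2 : D ^ 2 ≤ 2 * ((l ^ 2)⁻¹ * Real.exp (l * D)) := by
    have := Real.quadratic_le_exp_of_nonneg (mul_nonneg hl.le hD)
    have h3 : l ^ 2 * D ^ 2 ≤ 2 * Real.exp (l * D) := by nlinarith [mul_nonneg hl.le hD]
    rw [show 2 * ((l ^ 2)⁻¹ * Real.exp (l * D)) = (2 * Real.exp (l * D)) / l ^ 2 by ring,
      le_div_iff₀ (by positivity)]
    linarith
  have h3 : D * (Real.exp X + Real.exp Y) ≤
      (l ^ 2)⁻¹ * Real.exp (l * D) + Real.exp (2 * X) + Real.exp (2 * Y) := by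
    rw [two_mul X, two_mul Y, Real.exp_add, Real.exp_add]
    nlinarith [sq_nonneg (D - (Real.exp X + Real.exp Y)), sq_nonneg (Real.exp X - Real.exp Y)]
  have h4 := mul_le_mul_of_nonneg_left h3 (abs_nonneg s)
  linarith

theorem SizeBound.mono {n : ℕ} {L t t' : ℝ} (hL : 0 ≤ L) (ht : t ≤ t') {a : Fin n → ℝ}
    (h : SizeBound L t a) : SizeBound L t' a :=
  ⟨h.1, h.2.trans (mul_le_mul_of_nonneg_right ht hL)⟩

/-- The exponent bounding the one-variable Bessel functions at arguments of size `Y / √r`. -/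
def growth (θ C τ Y : ℝ) : ℝ := 2 * Y * C * τ + 8 * Y ^ 2 * C ^ 2 / θ

theorem lintegral_gammaPi_exp_le_growth {θ : ℝ} (hθ : 0 < θ) {n : ℕ} {r C τ Y s : ℝ}
    (hr : 1 ≤ r) (hC : 0 < C) (hτ : 0 ≤ τ) (hY : 0 ≤ Y) (hn : r / 2 ≤ n + 1) (hn' : n + 1 ≤ r)
    (hs : |s| ≤ Y / √r) (hbig : 4 * Y * C ≤ θ * √r) {a : Fin (n + 1) → ℝ}
    (h : SizeBound (C * r) τ a) :
    ∫⁻ γ, ENNReal.ofReal (Real.exp (s * wmean γ a)) ∂gammaPi θ (n + 1) ≤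
      ENNReal.ofReal (Real.exp (growth θ C τ Y)) := by
  have hr0 : 0 < r := by linarith
  have hq : 0 < √r := Real.sqrt_pos.2 hr0
  have hq1 : 1 ≤ √r := Real.one_le_sqrt.2 hr
  have hqq : √r * √r = r := Real.mul_self_sqrt hr0.le
  set u := |s| * (C * r) / ((n + 1) * θ) with hu
  have hu0 : 0 ≤ u := by positivity
  have hu1 : u ≤ 2 * Y * C / (θ * √r) := by
    calc u ≤ Y / √r * (C * r) / (r / 2 * θ) := by rw [hu]; gcongr
      _ = _ := by field_simp
  have hu2 : u ≤ 1 / 2 := hu1.trans (by rw [div_le_iff₀ (by positivity)]; linarith)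
  refine (lintegral_gammaPi_exp_mul_wmean_le hθ h hu2).trans
    (ENNReal.ofReal_le_ofReal (Real.exp_le_exp.2 ?_))
  rw [← hu, growth, mul_add]
  refine add_le_add ?_ ?_
  · have h1 : θ * u ≤ 2 * Y * C := by
      rw [le_div_iff₀ (by positivity)] at hu1
      nlinarith [mul_nonneg hθ.le hu0]
    nlinarith
  · calc θ * (2 * (n + 1) * u ^ 2) ≤ θ * (2 * r * (2 * Y * C / (θ * √r)) ^ 2) := by gcongr
      _ = _ := by rw [div_pow, mul_pow θ, Real.sq_sqrt hr0.le]; field_simp; ring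

theorem lintegral_exp_gammaPi_congr_le {θ : ℝ} (hθ : 0 < θ) {n : ℕ} {L t s l : ℝ} (hL : 0 < L)
    (hl : l = ((n + 1 : ℕ) + 1) * θ / (4 * L))
    {a : Fin (n + 2) → ℝ} {b : Fin (n + 1) → ℝ} (ha : StrictAnti a) (hb : Interlaces b a)
    (h : SizeBound L t a) {A : ℝ≥0∞}
    (hA : ∫⁻ γ, ENNReal.ofReal (Real.exp (2 * s * wmean γ a)) ∂gammaPi θ (n + 2) ≤ A)
    (hB : ∫⁻ γ, ENNReal.ofReal (Real.exp (2 * s * wmean γ b)) ∂gammaPi θ (n + 1) ≤ A) :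
    (∫⁻ b', stepWt θ s a b' ≤ (∫⁻ c, stepWt θ s b c) + ENNReal.ofReal |s| *
      (ENNReal.ofReal ((l ^ 2)⁻¹) * ENNReal.ofReal (Real.exp (2 * θ)) + A + A)) ∧
    ∫⁻ c, stepWt θ s b c ≤ (∫⁻ b', stepWt θ s a b') + ENNReal.ofReal |s| *
      (ENNReal.ofReal ((l ^ 2)⁻¹) * ENNReal.ofReal (Real.exp (2 * θ)) + A + A) := by
  have hl0 : 0 < l := by rw [hl]; positivity
  have htail : Measurable (Fin.tail : (Fin (n + 2) → ℝ) → Fin (n + 1) → ℝ) :=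
    measurable_pi_lambda _ fun r => measurable_pi_apply r.succ
  have hwt : Measurable fun γ : Fin (n + 2) → ℝ => wmean (Fin.tail γ) b :=
    (measurable_wmean b).comp htail
  have hD := lintegral_gammaPi_exp_gapVec_le hθ hL hb h
  rw [← hl] at hD
  have hb2 : ∫⁻ c, stepWt θ s b c = ∫⁻ γ, ENNReal.ofReal (Real.exp (s * wmean (Fin.tail γ) b))
      ∂gammaPi θ (n + 2) := by
    rw [lintegral_stepWt hθ s hb.strictAnti]
    exact (lintegral_gammaPi_tail hθ (f := fun γ => ENNReal.ofReal (Real.exp (s * wmean γ b)))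
      (by fun_prop)).symm
  have hB2 : ∫⁻ γ, ENNReal.ofReal (Real.exp (2 * s * wmean (Fin.tail γ) b)) ∂gammaPi θ (n + 2) ≤
      A := by
    refine Eq.trans_le ?_ hB
    exact lintegral_gammaPi_tail hθ (f := fun γ => ENNReal.ofReal (Real.exp (2 * s * wmean γ b)))
      (by fun_prop)
  have hpt : ∀ X Y D : ℝ, |X - Y| ≤ |s| * D → 0 ≤ D →
      ENNReal.ofReal (Real.exp X) ≤ ENNReal.ofReal (Real.exp Y) + ENNReal.ofReal |s| *
        (ENNReal.ofReal ((l ^ 2)⁻¹) * ENNReal.ofReal (Real.exp (l * D)) +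
          ENNReal.ofReal (Real.exp (2 * X)) + ENNReal.ofReal (Real.exp (2 * Y))) := by
    intro X Y D h hD
    rw [← ENNReal.ofReal_mul (by positivity), ← ENNReal.ofReal_add (by positivity) (by positivity),
      ← ENNReal.ofReal_add (by positivity) (by positivity), ← ENNReal.ofReal_mul (by positivity),
      ← ENNReal.ofReal_add (by positivity) (by positivity)]
    exact ENNReal.ofReal_le_ofReal (exp_sub_exp_le h hD hl0)
  have hdist : ∀ᵐ γ ∂gammaPi θ (n + 2), 0 ≤ wmean γ (gapVec L a b) ∧
      |s * wmean γ a - s * wmean (Fin.tail γ) b| ≤ |s| * wmean γ (gapVec L a b) := by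
    filter_upwards [ae_gammaPi_pos θ (n + 2)] with γ hγ
    have h1 := abs_wmean_sub_wmean_tail_le ha hb h hγ
    refine ⟨(abs_nonneg _).trans h1, ?_⟩
    rw [← mul_sub, abs_mul]
    exact mul_le_mul_of_nonneg_left h1 (abs_nonneg s)
  have hI : ∀ F G : (Fin (n + 2) → ℝ) → ℝ, Measurable F → Measurable G →
      (∀ᵐ γ ∂gammaPi θ (n + 2), |s * F γ - s * G γ| ≤ |s| * wmean γ (gapVec L a b)) →
      ∫⁻ γ, ENNReal.ofReal (Real.exp (2 * s * F γ)) ∂gammaPi θ (n + 2) ≤ A →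
      ∫⁻ γ, ENNReal.ofReal (Real.exp (2 * s * G γ)) ∂gammaPi θ (n + 2) ≤ A →
      ∫⁻ γ, ENNReal.ofReal (Real.exp (s * F γ)) ∂gammaPi θ (n + 2) ≤
        ∫⁻ γ, ENNReal.ofReal (Real.exp (s * G γ)) ∂gammaPi θ (n + 2) + ENNReal.ofReal |s| *
          (ENNReal.ofReal ((l ^ 2)⁻¹) * ENNReal.ofReal (Real.exp (2 * θ)) + A + A) := by
    intro F G hF hG hFG hFA hGA
    calc _ ≤ ∫⁻ γ, (ENNReal.ofReal (Real.exp (s * G γ)) + ENNReal.ofReal |s| *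
          (ENNReal.ofReal ((l ^ 2)⁻¹) * ENNReal.ofReal (Real.exp (l * wmean γ (gapVec L a b))) +
          ENNReal.ofReal (Real.exp (2 * s * F γ)) + ENNReal.ofReal (Real.exp (2 * s * G γ))))
          ∂gammaPi θ (n + 2) := by
          refine lintegral_mono_ae ?_
          filter_upwards [hFG, hdist] with γ h1 h2
          simpa only [mul_assoc] using hpt _ _ _ h1 h2.1
      _ ≤ _ := by
          rw [lintegral_add_left (by fun_prop), lintegral_const_mul _ (by fun_prop),
            lintegral_add_left (by fun_prop), lintegral_add_left (by fun_prop),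
            lintegral_const_mul _ (by fun_prop)]
          gcongr
  rw [lintegral_stepWt hθ s ha, hb2]
  refine ⟨hI _ _ (measurable_wmean a) hwt (hdist.mono fun γ h => h.2) hA hB2,
    hI _ _ hwt (measurable_wmean a) (hdist.mono fun γ h => ?_) hB2 hA⟩
  rw [abs_sub_comm]
  exact h.2

/-- The bound for the change of the one-variable Bessel function over one level, divided by the
modulus of the argument. -/
def levelError (θ C τ Y : ℝ) : ℝ :=
  (8 * C / θ) ^ 2 * Real.exp (2 * θ) + 2 * Real.exp (growth θ C τ (2 * Y))

/-- Going one level down changes the one-variable Bessel function at an argument of size `Y / √r`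
by a small amount. -/
theorem lintegral_stepWt_interlaces {θ : ℝ} (hθ : 0 < θ) {n : ℕ} {r C τ t Y s : ℝ}
    (hr : 1 ≤ r) (hC : 0 < C) (ht : 0 ≤ t) (htτ : t + 1 ≤ τ) (hY : 0 ≤ Y) (hn : r / 2 ≤ n + 1)
    (hn' : n + 2 ≤ r) (hs : |s| ≤ Y / √r) (hbig : 8 * Y * C ≤ θ * √r)
    {a : Fin (n + 2) → ℝ} {b : Fin (n + 1) → ℝ} (ha : StrictAnti a) (hb : Interlaces b a)
    (h : SizeBound (C * r) t a) :
    (∫⁻ b', stepWt θ s a b' ≤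
      (∫⁻ c, stepWt θ s b c) + ENNReal.ofReal (|s| * levelError θ C τ Y)) ∧
    ∫⁻ c, stepWt θ s b c ≤
      (∫⁻ b', stepWt θ s a b') + ENNReal.ofReal (|s| * levelError θ C τ Y) := by
  have hr0 : 0 < r := by linarith
  have hL : 0 < C * r := by positivity
  have hs2 : |2 * s| ≤ 2 * Y / √r := by
    rw [abs_mul, abs_two, mul_div_assoc]
    linarith
  have hA := lintegral_gammaPi_exp_le_growth (n := n + 1) hθ hr hC (by linarith : 0 ≤ τ)
    (by positivity : 0 ≤ 2 * Y) (by push_cast; linarith) (by push_cast; linarith) hs2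
    (by linarith) (h.mono hL.le (by linarith))
  have hB := lintegral_gammaPi_exp_le_growth (n := n) hθ hr hC (by linarith : 0 ≤ τ)
    (by positivity : 0 ≤ 2 * Y) hn (by linarith) hs2
    (by linarith) ((h.of_interlaces ha hb).mono hL.le htτ)
  have hl : ((((n + 1 : ℕ) + 1) * θ / (4 * (C * r))) ^ 2)⁻¹ ≤ (8 * C / θ) ^ 2 := by
    rw [← inv_pow, inv_div]
    gcongr ?_ ^ 2
    rw [div_le_div_iff₀ (by positivity) hθ]
    push_cast
    nlinarith [mul_pos hC hθ]
  have hE : ENNReal.ofReal |s| * (ENNReal.ofReal ((((n + 1 : ℕ) + 1) * θ / (4 * (C * r))) ^ 2)⁻¹ *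
      ENNReal.ofReal (Real.exp (2 * θ)) + ENNReal.ofReal (Real.exp (growth θ C τ (2 * Y))) +
      ENNReal.ofReal (Real.exp (growth θ C τ (2 * Y)))) ≤
      ENNReal.ofReal (|s| * levelError θ C τ Y) := by
    rw [← ENNReal.ofReal_mul (by positivity), ← ENNReal.ofReal_add (by positivity) (by positivity),
      ← ENNReal.ofReal_add (by positivity) (by positivity), ← ENNReal.ofReal_mul (by positivity),
      levelError, add_assoc, ← two_mul]
    gcongr
  obtain ⟨h1, h2⟩ := lintegral_exp_gammaPi_congr_le hθ hL rfl ha hb h hA hB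
  exact ⟨h1.trans (add_le_add_right hE _), h2.trans (add_le_add_right hE _)⟩

theorem measurable_stepWt_right (θ s : ℝ) {n : ℕ} (a : Fin (n + 1) → ℝ) :
    Measurable fun b : Fin n → ℝ => stepWt θ s a b :=
  (measurable_stepWt θ s).comp measurable_prodMk_left

theorem lintegral_stepWt_mul_mono (θ s : ℝ) {n : ℕ} {a : Fin (n + 1) → ℝ}
    {f g : (Fin n → ℝ) → ℝ≥0∞} (h : ∀ b, Interlaces b a → f b ≤ g b) :
    ∫⁻ b, stepWt θ s a b * f b ≤ ∫⁻ b, stepWt θ s a b * g b := by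
  refine lintegral_mono fun b => ?_
  by_cases hb : Interlaces b a
  · exact mul_le_mul_right (h b hb) _
  · simp [stepWt, hb]

theorem corner_of_eq_zero {θ : ℝ} (hθ : 0 < θ) {n : ℕ} {y : ℕ → ℝ} (hy : ∀ k < n, y k = 0)
    {a : Fin n → ℝ} (ha : StrictAnti a) : corner θ n a y = 1 := by
  induction n with
  | zero => rfl
  | succ n ih =>
    have h : ∀ b, Interlaces b a → corner θ n b y = 1 := fun b hb =>
      ih (fun k hk => hy k (hk.trans n.lt_succ_self)) hb.strictAnti
    rw [corner_succ, hy n n.lt_succ_self, le_antisymm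
      (lintegral_stepWt_mul_mono θ 0 fun b hb => (h b hb).le)
      (lintegral_stepWt_mul_mono θ 0 fun b hb => (h b hb).ge)]
    simpa using lintegral_stepWt_zero hθ ha

theorem corner_succ_of_eq_zero {θ : ℝ} (hθ : 0 < θ) {n : ℕ} {y : ℕ → ℝ} (hy : ∀ k < n, y k = 0)
    (a : Fin (n + 1) → ℝ) : corner θ (n + 1) a y = ∫⁻ b, stepWt θ (y n) a b := by
  have h : ∀ b, Interlaces b a → corner θ n b y = 1 := fun b hb =>
    corner_of_eq_zero hθ hy hb.strictAnti
  rw [corner_succ, le_antisymm (lintegral_stepWt_mul_mono θ _ fun b hb => (h b hb).le)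
    (lintegral_stepWt_mul_mono θ _ fun b hb => (h b hb).ge)]
  simp

/-- Moving one argument from level `n + 1` to the top level, as a separate factor, changes the
Bessel function by a small amount. -/
theorem corner_update_splitting {θ : ℝ} (hθ : 0 < θ) {n : ℕ} {r C τ Y s : ℝ} (hr : 1 ≤ r)
    (hC : 0 < C) (hY : 0 ≤ Y) (hn : r / 2 ≤ n + 1) (hs : |s| ≤ Y / √r)
    (hbig : 8 * Y * C ≤ θ * √r) {z : ℕ → ℝ} (hz0 : ∀ k ≤ n, z k = 0)
    (hz : ∀ k, |z k| ≤ Y / √r) {K ε : ℝ≥0∞}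
    (hK : K = ENNReal.ofReal (Real.exp (growth θ C τ Y)))
    (hε : ε = ENNReal.ofReal (|s| * levelError θ C τ Y)) (j : ℕ) (hj : n + j + 1 ≤ r) {t : ℝ}
    (ht : 0 ≤ t) (htτ : t + j ≤ τ) {a : Fin (n + j + 1) → ℝ} (ha : StrictAnti a)
    (h : SizeBound (C * r) t a) :
    corner θ (n + j + 1) a z ≤ K ^ j ∧
    corner θ (n + j + 1) a (Function.update z n s) ≤
      (∫⁻ b, stepWt θ s a b) * corner θ (n + j + 1) a z + j * ε * K ^ j ∧
    (∫⁻ b, stepWt θ s a b) * corner θ (n + j + 1) a z ≤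
      corner θ (n + j + 1) a (Function.update z n s) + j * ε * K ^ j := by
  induction j generalizing t with
  | zero =>
    have h1 : corner θ (n + 0 + 1) a z = 1 :=
      corner_of_eq_zero hθ (fun k hk => hz0 k (Nat.lt_succ_iff.1 hk)) ha
    have h2 : corner θ (n + 0 + 1) a (Function.update z n s) = ∫⁻ b, stepWt θ s a b := by
      have := corner_succ_of_eq_zero hθ (y := Function.update z n s)
        (fun k hk => (Function.update_of_ne (Nat.ne_of_lt hk) _ _).trans (hz0 k (Nat.le_of_lt hk))) a
      rwa [Function.update_self] at this
    simp [h1, h2]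
  | succ j ih =>
    push_cast at hj htτ
    have hstep : ∫⁻ b, stepWt θ (z (n + (j + 1))) a b ≤ K := by
      rw [lintegral_stepWt hθ _ ha, hK]
      refine lintegral_gammaPi_exp_le_growth hθ hr hC (by linarith [j.cast_nonneg (α := ℝ)]) hY
        (by push_cast; linarith [j.cast_nonneg (α := ℝ)]) (by push_cast; linarith) (hz _)
        (by nlinarith [mul_nonneg hY hC.le]) (h.mono (by positivity) (by linarith [j.cast_nonneg (α := ℝ)]))
    have hb := fun (b : Fin (n + j + 1) → ℝ) (hb : Interlaces b a) =>
      ih (by linarith) (by linarith : 0 ≤ t + 1) (by linarith) hb.strictAnti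
        (h.of_interlaces ha hb)
    have hΦ := fun (b : Fin (n + j + 1) → ℝ) (hb : Interlaces b a) =>
      lintegral_stepWt_interlaces (n := n + j) (τ := τ) hθ hr hC ht (by linarith [j.cast_nonneg (α := ℝ)]) hY
        (by push_cast; linarith [j.cast_nonneg (α := ℝ)]) (by push_cast; linarith) hs hbig ha hb h
    rw [← hε] at hΦ
    have hne : Function.update z n s (n + (j + 1)) = z (n + (j + 1)) :=
      Function.update_of_ne (by omega) _ _
    have hm := measurable_stepWt_right θ (z (n + (j + 1))) a
    have hexp : ((j + 1 : ℕ) : ℝ≥0∞) * ε * K ^ (j + 1) = K * (ε * K ^ j + j * ε * K ^ j) := by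
      push_cast
      ring
    have hc := corner_succ θ (n := n + (j + 1)) a z
    have hc' := corner_succ θ (n := n + (j + 1)) a (Function.update z n s)
    rw [hne] at hc'
    have hmc := measurable_corner θ (n + (j + 1)) z
    have hmc' := measurable_corner θ (n + (j + 1)) (Function.update z n s)
    set Φ := ∫⁻ b, stepWt θ s a b with hΦdef
    have hpull : Φ * ∫⁻ b, stepWt θ (z (n + (j + 1))) a b * corner θ (n + (j + 1)) b z =
        ∫⁻ b, stepWt θ (z (n + (j + 1))) a b * (Φ * corner θ (n + (j + 1)) b z) := by
      rw [← lintegral_const_mul _ (by exact hm.mul hmc)]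
      exact lintegral_congr fun b => mul_left_comm _ _ _
    have hadd : ∀ {f : (Fin (n + (j + 1)) → ℝ) → ℝ≥0∞} (_ : Measurable f) (e : ℝ≥0∞),
        ∫⁻ b, stepWt θ (z (n + (j + 1))) a b * (f b + e) ≤
          (∫⁻ b, stepWt θ (z (n + (j + 1))) a b * f b) + K * e := by
      intro f hf e
      simp_rw [mul_add]
      rw [lintegral_add_left (by exact hm.mul hf), lintegral_mul_const _ hm]
      gcongr
    refine ⟨?_, ?_, ?_⟩
    · rw [hc, pow_succ']
      calc _ ≤ ∫⁻ b, stepWt θ (z (n + (j + 1))) a b * K ^ j :=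
            lintegral_stepWt_mul_mono θ _ fun b h => (hb b h).1
        _ ≤ _ := by rw [lintegral_mul_const _ hm]; gcongr
    · rw [hc, hc', hpull, hexp]
      refine le_trans (lintegral_stepWt_mul_mono θ _ fun b h => ?_) (hadd (hmc.const_mul Φ) _)
      calc _ ≤ (Φ + ε) * corner θ (n + j + 1) b z + j * ε * K ^ j :=
            (hb b h).2.1.trans (by gcongr; exact (hΦ b h).2)
        _ ≤ Φ * corner θ (n + j + 1) b z + ε * K ^ j + j * ε * K ^ j := by
            rw [add_mul]; gcongr; exact (hb b h).1
        _ = _ := add_assoc _ _ _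
    · rw [hc, hc', hpull, hexp]
      refine le_trans (lintegral_stepWt_mul_mono θ _ fun b h => ?_) (hadd hmc' _)
      calc _ ≤ ((∫⁻ c, stepWt θ s b c) + ε) * corner θ (n + j + 1) b z := by
            gcongr ?_ * _
            exact (hΦ b h).1
        _ ≤ corner θ (n + j + 1) b (Function.update z n s) + j * ε * K ^ j + ε * K ^ j := by
            rw [add_mul]
            gcongr
            · exact (hb b h).2.2
            · exact (hb b h).1
        _ = _ := by rw [add_assoc, add_comm (_ * ε * _)]; rfl

/-- Attaching the arguments to the levels in the opposite order does not change the Bessel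
function. -/
theorem MBF_eq_corner_rev {θ : ℝ} (hθ : 0 < θ) {n : ℕ} {a : Fin (n + 1) → ℝ} (ha : StrictAnti a)
    {y : Fin (n + 1) → ℂ} {z : ℕ → ℝ} (h : ∀ k : Fin (n + 1), y k = ((z (n - k.1) : ℝ) : ℂ)) :
    MBF θ a y = ((corner θ (n + 1) a z).toReal : ℂ) := by
  rw [funext h, MBF_eq_corner hθ ha fun k => z (n - k),
    corner_perm hθ ha Fin.revPerm (y := z) fun i => ?_]
  simp [Fin.val_rev]

theorem norm_MBF_mul_sub_le {θ : ℝ} (hθ : 0 < θ) {n m : ℕ} {r C Y y : ℝ} {ys : Fin m → ℝ}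
    (hr : r = (n + m + 1 : ℕ)) (hC : 0 < C) (hn : r / 2 ≤ n + 1) (hys : ∀ i, |ys i| ≤ Y)
    (hy : |y| ≤ Y) (hbig : 8 * Y * C ≤ θ * √r) {a : Fin (n + m + 1) → ℝ} (ha : StrictAnti a)
    (h : SizeBound (C * r) 0 a) (h1 : m ≤ n + m + 1) (h2 : 1 ≤ n + m + 1)
    (h3 : m + 1 ≤ n + m + 1) :
    ‖MBF θ a (padC h1 fun i => ((-ys i / √r : ℝ) : ℂ)) *
        MBF θ a (padC h2 fun _ : Fin 1 => ((-y / √r : ℝ) : ℂ)) -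
      MBF θ a (padC h3 fun j : Fin (m + 1) =>
        if h' : j.1 < m then ((-ys ⟨j.1, h'⟩ / √r : ℝ) : ℂ) else ((-y / √r : ℝ) : ℂ))‖ ≤
      m * (|y| / √r * levelError θ C m Y) * Real.exp (growth θ C m Y) ^ m := by
  have hY : 0 ≤ Y := (abs_nonneg y).trans hy
  have hr1 : 1 ≤ r := by rw [hr]; exact_mod_cast h2
  have hq : 0 < √r := Real.sqrt_pos.2 (by linarith)
  have hdiv : ∀ u : ℝ, |-u / √r| = |u| / √r := fun u => by
    rw [abs_div, abs_neg, abs_of_pos hq]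
  set s := -y / √r with hs
  set z : ℕ → ℝ := fun k => if h : n + m - k < m then -ys ⟨n + m - k, h⟩ / √r else 0 with hz
  have hz0 : ∀ k ≤ n, z k = 0 := fun k hk => dif_neg (by omega)
  have hzb : ∀ k, |z k| ≤ Y / √r := fun k => by
    simp only [hz]
    split_ifs
    · rw [hdiv]
      gcongr
      exact hys _
    · simpa using div_nonneg hY hq.le
  have hsb : |s| ≤ Y / √r := by rw [hs, hdiv]; gcongr
  have e1 : MBF θ a (padC h1 fun i => ((-ys i / √r : ℝ) : ℂ)) =
      ((corner θ (n + m + 1) a z).toReal : ℂ) := by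
    refine MBF_eq_corner_rev hθ ha fun k => ?_
    have hk : n + m - (n + m - k.1) = k.1 := by have := k.isLt; omega
    simp only [padC, hz, hk]
    split_ifs <;> simp
  have e2 : MBF θ a (padC h2 fun _ : Fin 1 => (s : ℂ)) = ((∫⁻ b, stepWt θ s a b).toReal : ℂ) := by
    rw [MBF_eq_corner_rev hθ ha (z := Function.update 0 (n + m) s) fun k => ?_,
      corner_succ_of_eq_zero hθ fun k hk => ?_, Function.update_self]
    · rw [Function.update_of_ne (Nat.ne_of_lt hk)]
      rfl
    · have hk := k.isLt
      by_cases hk0 : k.1 = 0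
      · simp [padC, hk0]
      · rw [Function.update_of_ne (by omega), padC, dif_neg (by omega)]
        simp
  have e3 : MBF θ a (padC h3 fun j : Fin (m + 1) =>
      if h' : j.1 < m then ((-ys ⟨j.1, h'⟩ / √r : ℝ) : ℂ) else (s : ℂ)) =
      ((corner θ (n + m + 1) a (Function.update z n s)).toReal : ℂ) := by
    refine MBF_eq_corner_rev hθ ha fun k => ?_
    have hk := k.isLt
    have hk' : n + m - (n + m - k.1) = k.1 := by omega
    rcases lt_trichotomy k.1 m with hkm | hkm | hkm
    · rw [Function.update_of_ne (by omega), padC, dif_pos (by omega)]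
      simp only [hz, hk', hkm, dif_pos]
    · rw [show n + m - k.1 = n by omega, Function.update_self, padC, dif_pos (by omega),
        dif_neg hkm.not_lt]
    · rw [Function.update_of_ne (by omega), padC, dif_neg (by omega), hz0 _ (by omega)]
      simp
  obtain ⟨hc, hle, hge⟩ := corner_update_splitting (τ := m) hθ hr1 hC hY hn hsb hbig hz0 hzb rfl rfl
    m (by rw [hr]; push_cast; rfl) le_rfl (by simp) ha h
  have hΦ : ∫⁻ b, stepWt θ s a b ≠ ∞ := by
    rw [lintegral_stepWt hθ s ha]
    refine ((lintegral_gammaPi_exp_le_growth hθ hr1 hC le_rfl hY ?_ ?_ hsb ?_ h).trans_lt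
      ENNReal.ofReal_lt_top).ne
    · push_cast; linarith [m.cast_nonneg (α := ℝ)]
    · rw [hr]; push_cast; rfl
    · nlinarith [mul_nonneg hY hC.le]
  have hcT : corner θ (n + m + 1) a z ≠ ∞ :=
    (hc.trans_lt (ENNReal.pow_lt_top ENNReal.ofReal_lt_top)).ne
  have hlev : 0 ≤ |s| * levelError θ C m Y := by unfold levelError; positivity
  have herr : (m : ℝ≥0∞) * ENNReal.ofReal (|s| * levelError θ C m Y) *
      ENNReal.ofReal (Real.exp (growth θ C m Y)) ^ m =
      ENNReal.ofReal (m * (|y| / √r * levelError θ C m Y) * Real.exp (growth θ C m Y) ^ m) := by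
    rw [← hdiv, ← hs, ENNReal.ofReal_mul (p := m * _) (by positivity),
      ENNReal.ofReal_mul (p := (m : ℝ)) (by positivity), ENNReal.ofReal_natCast, ENNReal.ofReal_pow (by positivity)]
  have hErr : 0 ≤ m * (|y| / √r * levelError θ C m Y) * Real.exp (growth θ C m Y) ^ m := by
    rw [← hdiv, ← hs]
    positivity
  rw [herr] at hle hge
  have hc'T : corner θ (n + m + 1) a (Function.update z n s) ≠ ∞ :=
    (hle.trans_lt (ENNReal.add_lt_top.2 ⟨ENNReal.mul_lt_top hΦ.lt_top hcT.lt_top,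
      ENNReal.ofReal_lt_top⟩)).ne
  have hle' := ENNReal.toReal_mono (by finiteness) hle
  have hge' := ENNReal.toReal_mono (by finiteness) hge
  rw [ENNReal.toReal_add (by finiteness) (by finiteness), ENNReal.toReal_mul,
    ENNReal.toReal_ofReal hErr] at hle' hge'
  rw [e1, e2, e3, ← Complex.ofReal_mul, ← Complex.ofReal_sub, Complex.norm_real, Real.norm_eq_abs,
    abs_le]
  exact ⟨by linarith, by linarith⟩

/-- (Equation (8.13), the key inductive asymptotic splitting)
`𝓑_{a(N)}(-y₁/√N,…,-y_m/√N;N;θ) 𝓑_{a(N)}(-y/√N;N;θ)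
  - 𝓑_{a(N)}(-y₁/√N,…,-y_m/√N,-y/√N;N;θ) → 0`. -/
theorem mbf_asymptotic_splitting
    (θ : ℝ) (hθ : 0 < θ) (m : ℕ) (hm : 1 ≤ m)
    (ys : Fin m → ℝ) (y : ℝ) (hy : 0 < y)
    (hord : StrictAnti ys) (hlast : y < ys ⟨m - 1, by omega⟩)
    (hgap : ∀ i : ℕ, ∀ h2 : i + 2 < m,
      ys ⟨i + 2, h2⟩ < ys ⟨i, by omega⟩ - ys ⟨i + 1, by omega⟩)
    (hgaplast : ∀ h2 : 2 ≤ m, y < ys ⟨m - 2, by omega⟩ - ys ⟨m - 1, by omega⟩)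
    (a : (N : ℕ) → Fin N → ℝ) (μ : Measure ℝ) (hreg : RegularSeq a μ)
    (hzero : ∀ N : ℕ, 1 ≤ N → ∑ i, a N i = 0) :
    Tendsto
      (fun N : ℕ =>
        if h : m + 1 ≤ N then
          MBF θ (a N)
              (padC (le_trans (Nat.le_succ m) h)
                fun i => ((-ys i / Real.sqrt N : ℝ) : ℂ)) *
            MBF θ (a N)
              (padC (le_trans (by omega : 1 ≤ m + 1) h)
                fun _ : Fin 1 => ((-y / Real.sqrt N : ℝ) : ℂ)) -
          MBF θ (a N)
            (padC h fun j : Fin (m + 1) =>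
              if h' : j.1 < m then ((-ys ⟨j.1, h'⟩ / Real.sqrt N : ℝ) : ℂ)
              else ((-y / Real.sqrt N : ℝ) : ℂ))
        else 0)
      atTop (𝓝 0) := by
  obtain ⟨hanti, ⟨C₀, hC₀⟩, -⟩ := hreg
  set C := max C₀ 1
  have hC : 0 < C := lt_max_of_lt_right one_pos
  set Y := |y| + ∑ i, |ys i|
  have hyY : |y| ≤ Y := le_add_of_nonneg_right (Finset.sum_nonneg fun i _ => abs_nonneg _)
  have hysY : ∀ i, |ys i| ≤ Y := fun i =>
    (Finset.single_le_sum (fun i _ => abs_nonneg (ys i)) (Finset.mem_univ i)).trans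
      (le_add_of_nonneg_left (abs_nonneg y))
  have hsqrt : Tendsto (fun N : ℕ => √(N : ℝ)) atTop atTop :=
    Real.tendsto_sqrt_atTop.comp tendsto_natCast_atTop_atTop
  have hlim : Tendsto (fun N : ℕ => m * (|y| / √(N : ℝ) * levelError θ C m Y) *
      Real.exp (growth θ C m Y) ^ m) atTop (𝓝 0) := by
    simpa using (((tendsto_const_nhds (x := |y|)).div_atTop hsqrt).mul_const
      (levelError θ C m Y)).const_mul (m : ℝ) |>.mul_const (Real.exp (growth θ C m Y) ^ m)
  refine squeeze_zero_norm' ?_ hlim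
  filter_upwards [eventually_ge_atTop (2 * m + 1),
    (hsqrt.const_mul_atTop hθ).eventually_ge_atTop (8 * Y * C)] with N hN hbig
  obtain ⟨n, rfl⟩ : ∃ n, N = n + m + 1 := ⟨N - m - 1, by omega⟩
  rw [dif_pos (by omega)]
  have ha := hanti (n + m + 1) (by omega)
  refine norm_MBF_mul_sub_le hθ rfl hC ?_ hysY hyY hbig ha ⟨fun i => ?_, ?_⟩ _ _ _
  · have : (m : ℝ) ≤ n := by exact_mod_cast (by omega : m ≤ n)
    push_cast
    linarith
  · have h1 := hC₀ (n + m + 1) (by omega)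
    have hle : C₀ * (n + m + 1 : ℕ) ≤ C * (n + m + 1 : ℕ) :=
      mul_le_mul_of_nonneg_right (le_max_left _ _) (Nat.cast_nonneg _)
    have h2 := abs_le.1 h1.1
    have h3 := abs_le.1 h1.2
    have h4 := ha.antitone (Fin.zero_le i)
    have h5 := ha.antitone (Fin.le_last i)
    exact abs_le.2 ⟨by linarith [show a (n + m + 1) (Fin.last _) ≥ -(C₀ * (n + m + 1 : ℕ)) from h3.1],
      by linarith [show a (n + m + 1) 0 ≤ C₀ * (n + m + 1 : ℕ) from h2.2]⟩
  · rw [hzero _ (by omega)]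
    simp

end
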